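/- arXiv:math/0008002 — 3 statements merged into one kernel-verified Lean document; each statement's English description precedes it below -/
import Mathlib

section
/- Let X be a locally complete intersection variety over an algebraically closed field. If X_m is irreducible for some m ≥ 1, then X is normal. -/
noncomputable section

/-- The universal substitution `U_i ↦ ∑_j X_{i,j} t^j` computing the equations of jet schemes:
a polynomial `f` in the variables `σ` is sent to a polynomial in `t` whose coefficients are the
equations of the jet scheme of `V(f)`. -/
def jetSub (k : Type*) [CommRing k] (σ : Type*) (m : ℕ) :
    MvPolynomial σ k →ₐ[k] Polynomial (MvPolynomial (σ × Fin (m + 1)) k) :=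
  MvPolynomial.aeval fun i =>
    ∑ j : Fin (m + 1), Polynomial.C (MvPolynomial.X (i, j)) * Polynomial.X ^ (j : ℕ)

/-- The ideal of the `m`-th jet scheme of the closed subscheme of affine space `Spec k[σ]`
defined by the equations in `F`: it is generated by the coefficients of `t^l`, `0 ≤ l ≤ m`,
of the universal substitutions of the elements of `F`. -/
def jetIdeal (k : Type*) [CommRing k] (σ : Type*) (m : ℕ)
    (F : Set (MvPolynomial σ k)) : Ideal (MvPolynomial (σ × Fin (m + 1)) k) :=
  Ideal.span {g | ∃ f ∈ F, ∃ l ≤ m, g = Polynomial.coeff (jetSub k σ m f) l}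

/-- The ideal of the fiber `π_m⁻¹(x)` of the `m`-th jet scheme over the point `x`. -/
def jetFiberIdeal (k : Type*) [CommRing k] (σ : Type*) (m : ℕ)
    (F : Set (MvPolynomial σ k)) (x : σ → k) : Ideal (MvPolynomial (σ × Fin (m + 1)) k) :=
  jetIdeal k σ m F ⊔
    Ideal.span (Set.range fun i : σ =>
      MvPolynomial.X (i, (0 : Fin (m + 1))) - MvPolynomial.C (x i))

/-- The ideal of the locus `π_m⁻¹(Z)` of `m`-jets lying over the closed subscheme `Z = V(G)`. -/
def jetOverIdeal (k : Type*) [CommRing k] (σ : Type*) (m : ℕ)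
    (F G : Set (MvPolynomial σ k)) : Ideal (MvPolynomial (σ × Fin (m + 1)) k) :=
  jetIdeal k σ m F ⊔
    Ideal.span ((MvPolynomial.rename fun i : σ => (i, (0 : Fin (m + 1)))) '' G)

/-- The Zariski tangent space at a point `x` of the subvariety of affine space cut out by the
equations `F`, namely the common kernel of the differentials at `x`. -/
def tangentSpaceAt (k : Type*) [Field k] {σ : Type*} [Fintype σ]
    (F : Set (MvPolynomial σ k)) (x : σ → k) : Submodule k (σ → k) :=
  ⨅ f ∈ F, LinearMap.ker (∑ i : σ,
    MvPolynomial.eval x (MvPolynomial.pderiv i f) •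
      (LinearMap.proj i : (σ → k) →ₗ[k] k))

universe u

section Depth

open RingTheory.Sequence CategoryTheory Abelian IsLocalRing Pointwise

/-- The depth of the module `M` over the local ring `A` is at least `n`: the maximal ideal contains
an `M`-regular sequence of length `n`. -/
def HasDepth (A : Type u) [CommRing A] [IsLocalRing A] (M : Type u) [AddCommGroup M] [Module A M]
    (n : ℕ) : Prop :=
  ∃ rs : List A, rs.length = n ∧ (∀ r ∈ rs, r ∈ maximalIdeal A) ∧ IsRegular M rs

theorem maximalIdeal_smul_top_lt_top {A : Type u} [CommRing A] [IsLocalRing A] {M : Type u}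
    [AddCommGroup M] [Module A M] [Module.Finite A M] [Nontrivial M] :
    maximalIdeal A • (⊤ : Submodule A M) < ⊤ := by
  refine lt_top_iff_ne_top.mpr fun h => ?_
  exact (Submodule.top_ne_ideal_smul_of_le_jacobson_annihilator
    (IsLocalRing.maximalIdeal_le_jacobson _)) h.symm

theorem HasDepth.quotSMulTop {A : Type u} [CommRing A] [IsLocalRing A] [IsNoetherianRing A]
    {M : Type u} [AddCommGroup M] [Module A M] [Module.Finite A M] {n : ℕ}
    (h : HasDepth A M (n + 1)) {y : A} (hy : y ∈ maximalIdeal A) (hreg : IsSMulRegular M y) :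
    HasDepth A (QuotSMulTop y M) n := by
  have hM : Nontrivial M := by
    obtain ⟨rs, -, -, h⟩ := h
    exact h.nontrivial
  have hQ : Nontrivial (QuotSMulTop y M) := by
    refine Submodule.Quotient.nontrivial_iff.mpr fun h0 => ?_
    refine (maximalIdeal_smul_top_lt_top (A := A) (M := M)).not_ge ?_
    have h1 : y • (⊤ : Submodule A M) ≤ maximalIdeal A • ⊤ := by
      intro w hw
      obtain ⟨z, -, rfl⟩ := Submodule.mem_smul_pointwise_iff_exists w y ⊤ |>.mp hw
      exact Submodule.smul_mem_smul hy trivial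
    exact h0.symm.le.trans h1
  obtain ⟨rs, hlen, hmem, hrs⟩ := h
  let K : ModuleCat.{u} A := ModuleCat.of A (A ⧸ maximalIdeal A)
  have hK : Module.support A (A ⧸ maximalIdeal A) =
      PrimeSpectrum.zeroLocus (maximalIdeal A : Set A) := by
    rw [Module.support_eq_zeroLocus, Ideal.annihilator_quotient]
  have h1 : ∀ i < n + 1, Subsingleton (Ext K (ModuleCat.of A M) i) := by
    have := ModuleCat.subsingleton_ext_of_exists_isRegular (maximalIdeal A) K hK.subset
      (ModuleCat.of A M) maximalIdeal_smul_top_lt_top rs hmem hrs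
    rwa [hlen] at this
  refine ModuleCat.exists_isRegular_of_exists_subsingleton_ext (maximalIdeal A) n
    (ModuleCat.of A (QuotSMulTop y M)) maximalIdeal_smul_top_lt_top K hK fun i hi => ?_
  have hse := IsSMulRegular.smulShortComplex_shortExact (M := ModuleCat.of A M) (r := y) hreg
  refine ⟨fun a b => ?_⟩
  have hz : ∀ a : Ext K (ModuleCat.of A (QuotSMulTop y M)) i, a = 0 := by
    intro a
    have := h1 (i + 1) (by omega)
    have := h1 i (by omega)
    obtain ⟨x₂, hx₂⟩ := Ext.covariant_sequence_exact₃ K hse a rfl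
      (@Subsingleton.elim (Ext K (ModuleCat.of A M) (i + 1)) (h1 (i + 1) (by omega)) _ _)
    rw [← hx₂, @Subsingleton.elim (Ext K (ModuleCat.of A M) i) (h1 i (by omega)) x₂ 0]
    exact Ext.zero_comp (C := ModuleCat.{u} A) ..
  rw [hz a, hz b]

theorem HasDepth.le_ringKrullDim {A : Type u} [CommRing A] [IsLocalRing A] [IsNoetherianRing A]
    {n : ℕ} : ∀ {M : Type u} [AddCommGroup M] [Module A M] [Module.Finite A M]
    (_ : HasDepth A M n) {L : Ideal A} (_ : IsAssociatedPrime L M),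
    (n : WithBot ℕ∞) ≤ ringKrullDim (A ⧸ L) := by
  induction n with
  | zero =>
    intro M _ _ _ h L hL
    have := hL.isPrime
    exact ringKrullDim_nonneg_of_nontrivial
  | succ n ih =>
    intro M _ _ _ h L hL
    have hLp := hL.isPrime
    obtain ⟨rs, hlen, hmem, hreg⟩ := h
    match rs, hlen with
    | x :: rs, hlen =>
    have hx : x ∈ maximalIdeal A := hmem x (by simp)
    rw [isRegular_cons_iff] at hreg
    have hD : HasDepth A (QuotSMulTop x M) n :=
      ⟨rs, by simpa using hlen, fun r hr => hmem r (by simp [hr]), hreg.2⟩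
    obtain ⟨-, u, hu⟩ := isAssociatedPrime_iff.mp hL
    have hmemL (a : A) : a ∈ L ↔ a • u = 0 := by
      rw [hu, Submodule.mem_colon_singleton, Submodule.mem_bot]
    have hu0 : u ≠ 0 := by
      rintro rfl
      exact hLp.ne_top ((Ideal.eq_top_iff_one _).mpr ((hmemL 1).mpr (by simp)))
    have hxL : x ∉ L := fun hxL => hu0 (hreg.1 (by simpa using (hmemL x).mp hxL))
    obtain ⟨v, hvL, hvx⟩ : ∃ v : M, (∀ a ∈ L, a • v = 0) ∧ v ∉ x • (⊤ : Submodule A M) := by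
      by_contra! hcon
      let U : Submodule A M := ⨅ a ∈ L, LinearMap.ker (LinearMap.lsmul A M a)
      have hU (w : M) : w ∈ U ↔ ∀ a ∈ L, a • w = 0 := by simp [U, Submodule.mem_iInf]
      have hbot : U = ⊥ := by
        refine Submodule.eq_bot_of_le_smul_of_le_jacobson_bot (Ideal.span {x}) U
          (IsNoetherian.noetherian U) ?_ ?_
        · intro w hw
          obtain ⟨z, -, hz⟩ :=
            (Submodule.mem_smul_pointwise_iff_exists w x ⊤).mp (hcon w ((hU w).mp hw))
          rw [Submodule.ideal_span_singleton_smul, ← hz]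
          refine Submodule.smul_mem_pointwise_smul _ _ _ ((hU z).mpr fun a ha => hreg.1 ?_)
          simp only [smul_zero]
          rw [smul_comm, hz]
          exact (hU w).mp hw a ha
        · rw [Ideal.span_singleton_le_iff_mem]
          exact IsLocalRing.maximalIdeal_le_jacobson _ hx
      have : u ∈ U := (hU u).mpr fun a ha => (hmemL a).mp ha
      rw [hbot] at this
      exact hu0 (by simpa using this)
    obtain ⟨L1, hL1, hle⟩ := exists_le_isAssociatedPrime_of_isNoetherianRing A
      (M := QuotSMulTop x M) ((x • (⊤ : Submodule A M)).mkQ v) (by simpa using hvx)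
    have hle' : Ideal.span {x} ⊔ L ≤ L1 := by
      refine le_trans (sup_le ?_ ?_) hle
      · rw [Ideal.span_singleton_le_iff_mem, Submodule.mem_colon_singleton, Submodule.mem_bot,
          ← map_smul, Submodule.mkQ_apply, Submodule.Quotient.mk_eq_zero]
        exact Submodule.smul_mem_pointwise_smul _ _ _ trivial
      · intro a ha
        rw [Submodule.mem_colon_singleton, Submodule.mem_bot, ← map_smul, hvL a ha, map_zero]
    have h1 := ih hD hL1
    have h2 := ringKrullDim_quotient_succ_le_of_nonZeroDivisor
      (r := Ideal.Quotient.mk L x) (mem_nonZeroDivisors_of_ne_zero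
        (by rwa [Ne, Ideal.Quotient.eq_zero_iff_mem]))
    have h3 : ringKrullDim (A ⧸ L1) ≤
        ringKrullDim ((A ⧸ L) ⧸ Ideal.span {Ideal.Quotient.mk L x}) := by
      refine ringKrullDim_le_of_surjective (Ideal.Quotient.lift _
        (Ideal.Quotient.factor (le_sup_right.trans hle')) ?_)
        (Ideal.Quotient.lift_surjective_of_surjective _ _
          (Ideal.Quotient.factor_surjective (le_sup_right.trans hle')))
      intro a ha
      obtain ⟨b, rfl⟩ := Ideal.mem_span_singleton'.mp ha
      rw [map_mul, Ideal.Quotient.factor_mk,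
        Ideal.Quotient.eq_zero_iff_mem.mpr
          (hle' (Ideal.mem_sup_left (Ideal.mem_span_singleton_self x))),
        mul_zero]
    calc ((n + 1 : ℕ) : WithBot ℕ∞) = n + 1 := by push_cast; rfl
      _ ≤ _ := (add_le_add_left (h1.trans h3) 1).trans h2

end Depth

section CohenMacaulay

open RingTheory.Sequence IsLocalRing Pointwise

theorem WithBot.le_of_add_natCast_le_add_natCast {x y : WithBot ℕ∞} {n : ℕ}
    (h : x + n ≤ y + n) : x ≤ y := by
  cases x with
  | bot => exact bot_le
  | coe x =>
  cases y with
  | bot =>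
    exact absurd h (by rw [WithBot.bot_add]; exact not_le_of_gt (WithBot.bot_lt_coe (x + n : ℕ∞)))
  | coe y =>
    have h' : x + n ≤ y + n := by exact_mod_cast h
    exact WithBot.coe_le_coe.mpr ((ENat.add_le_add_iff_right (ENat.natCast_ne_top n)).mp h')

/-- The members of a finite generating set of the maximal ideal of a local ring can be
exchanged against any element outside the square of the maximal ideal. -/
theorem exists_mem_span_insert_erase_eq_maximalIdeal {A : Type u} [CommRing A] [IsLocalRing A]
    [DecidableEq A] {s : Finset A} (hs : Ideal.span (s : Set A) = maximalIdeal A) {x : A}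
    (hx : x ∈ maximalIdeal A) (hx2 : x ∉ maximalIdeal A ^ 2) :
    ∃ y ∈ s, Ideal.span {x} ⊔ Ideal.span (s.erase y : Set A) = maximalIdeal A := by
  have hsm (y) (hy : y ∈ s) : y ∈ maximalIdeal A := hs ▸ Ideal.subset_span hy
  obtain ⟨a, -, ha⟩ := Submodule.mem_span_finset.mp (show x ∈ Ideal.span (s : Set A) from hs ▸ hx)
  obtain ⟨y, hy, hu⟩ : ∃ y ∈ s, IsUnit (a y) := by
    by_contra! hcon
    refine hx2 (ha ▸ Ideal.sum_mem _ fun y hy => ?_)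
    rw [pow_two]
    exact Ideal.mul_mem_mul ((mem_maximalIdeal _).mpr (hcon y hy)) (hsm y hy)
  refine ⟨y, hy, le_antisymm (sup_le ?_ (Ideal.span_le.mpr fun z hz => ?_)) ?_⟩
  · exact (Ideal.span_singleton_le_iff_mem _).mpr hx
  · exact hsm z (Finset.mem_of_mem_erase hz)
  · rw [← hs, Ideal.span_le]
    intro z hz
    by_cases hzy : z = y
    · subst hzy
      rw [← Finset.add_sum_erase _ _ hy] at ha
      have : a z • z ∈ Ideal.span {x} ⊔ Ideal.span (s.erase z : Set A) := by
        rw [← eq_sub_iff_add_eq] at ha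
        rw [ha]
        refine sub_mem (Ideal.mem_sup_left (Ideal.mem_span_singleton_self x))
          (Ideal.mem_sup_right (Ideal.sum_mem _ fun i hi => ?_))
        exact Ideal.mul_mem_left _ _ (Ideal.subset_span hi)
      exact (Ideal.unit_mul_mem_iff_mem _ hu).mp this
    · exact Ideal.mem_sup_right (Ideal.subset_span (Finset.mem_erase.mpr ⟨hzy, hz⟩))

theorem isDomain_of_isDomain_quotient_span_singleton {A : Type u} [CommRing A] [IsLocalRing A]
    [IsNoetherianRing A] {x : A} (hx : x ∈ maximalIdeal A) (hxm : ∀ q ∈ minimalPrimes A, x ∉ q)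
    [hd : IsDomain (A ⧸ Ideal.span {x})] : IsDomain A := by
  have hp : (Ideal.span {x}).IsPrime := (Ideal.Quotient.isDomain_iff_prime _).mp hd
  obtain ⟨q, hq, hle⟩ :=
    Ideal.exists_minimalPrimes_le (I := (⊥ : Ideal A)) (J := Ideal.span {x}) bot_le
  have hqp : q.IsPrime := hq.1.1
  have hbot : q = ⊥ := by
    refine Submodule.eq_bot_of_le_smul_of_le_jacobson_bot (Ideal.span {x}) q
      (IsNoetherian.noetherian q) ?_ ?_
    · intro w hw
      obtain ⟨a, rfl⟩ := Ideal.mem_span_singleton.mp (hle hw)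
      exact Submodule.smul_mem_smul (Ideal.mem_span_singleton_self x)
        ((hqp.mem_or_mem hw).resolve_left (hxm q hq))
    · rw [Ideal.span_singleton_le_iff_mem]
      exact IsLocalRing.maximalIdeal_le_jacobson _ hx
  have : (⊥ : Ideal A).IsPrime := hbot ▸ hqp
  exact IsDomain.of_bot_isPrime A

theorem exists_mem_maximalIdeal_notMem_sq_notMem_minimalPrimes {A : Type u} [CommRing A]
    [IsLocalRing A] [IsNoetherianRing A] (h : ringKrullDim A ≠ 0) :
    ∃ x ∈ maximalIdeal A, x ∉ maximalIdeal A ^ 2 ∧ ∀ q ∈ minimalPrimes A, x ∉ q := by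
  classical
  by_contra! hcon
  have hfin := minimalPrimes.finite_of_isNoetherianRing A
  let s : Finset (Ideal A) := insert (maximalIdeal A ^ 2) hfin.toFinset
  have hsub : (maximalIdeal A : Set A) ⊆ ⋃ i ∈ (s : Set (Ideal A)), (id i : Ideal A) := by
    intro x hx
    by_cases hx2 : x ∈ maximalIdeal A ^ 2
    · exact Set.mem_biUnion (x := maximalIdeal A ^ 2) (by simp [s]) hx2
    · obtain ⟨q, hq, hxq⟩ := hcon x hx hx2
      exact Set.mem_biUnion (x := q) (by simp [s, hq]) hxq
  obtain ⟨q, hq, hle⟩ := (Ideal.subset_union_prime (maximalIdeal A ^ 2) (maximalIdeal A ^ 2)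
    (fun i hi hne _ => by
      rcases Finset.mem_insert.mp hi with hi | hi
      · exact absurd hi hne
      · exact (hfin.mem_toFinset.mp hi).1.1)).mp hsub
  rcases Finset.mem_insert.mp hq with rfl | hq
  · exact (maximalIdeal_sq_lt_of_ringKrullDim_ne_zero h).not_ge hle
  · have hq := hfin.mem_toFinset.mp hq
    have hqp : q.IsPrime := hq.1.1
    have : maximalIdeal A = q := (maximalIdeal.isMaximal A).eq_of_le hqp.ne_top hle
    refine h ?_
    rw [← maximalIdeal_height_eq_ringKrullDim, this, Ideal.height_eq_zero_iff.mpr hq]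
    rfl

theorem isDomain_and_hasDepth_of_span_eq_maximalIdeal (d : ℕ) :
    ∀ (A : Type u) [CommRing A] [IsLocalRing A] [IsNoetherianRing A] (s : Finset A)
    (_ : Ideal.span (s : Set A) = maximalIdeal A) (_ : s.card ≤ d) (_ : d ≤ ringKrullDim A),
    IsDomain A ∧ HasDepth A A d := by
  classical
  induction d with
  | zero =>
    intro A _ _ _ s hs hd _
    have h0 : s = ∅ := by simpa using hd
    have hbot : maximalIdeal A = ⊥ := by rw [← hs, h0]; simp
    have := (isField_iff_maximalIdeal_eq).mpr hbot
    exact ⟨this.isDomain, [], rfl, by simp, IsRegular.nil A A⟩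
  | succ d ih =>
    intro A _ _ _ s hs hd hdim
    obtain ⟨x, hx, hx2, hxq⟩ := exists_mem_maximalIdeal_notMem_sq_notMem_minimalPrimes (A := A)
      (fun h => by rw [h] at hdim; norm_cast at hdim)
    obtain ⟨y, hy, hspan⟩ := exists_mem_span_insert_erase_eq_maximalIdeal hs hx hx2
    have hnt : Nontrivial (A ⧸ Ideal.span {x}) := Ideal.Quotient.nontrivial_iff.mpr fun h =>
      (maximalIdeal.isMaximal A).ne_top
        (top_le_iff.mp (h ▸ (Ideal.span_singleton_le_iff_mem _).mpr hx))
    have hloc : IsLocalRing (A ⧸ Ideal.span {x}) :=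
      IsLocalRing.of_surjective' _ Ideal.Quotient.mk_surjective
    have hmap : (maximalIdeal A).map (Ideal.Quotient.mk (Ideal.span {x})) =
        maximalIdeal (A ⧸ Ideal.span {x}) := by
      have := IsLocalHom.of_surjective (Ideal.Quotient.mk (Ideal.span {x}))
        Ideal.Quotient.mk_surjective
      exact IsLocalRing.map_maximalIdeal_of_surjective _ Ideal.Quotient.mk_surjective
    have hdim' : (d : WithBot ℕ∞) ≤ ringKrullDim (A ⧸ Ideal.span {x}) := by
      have h1 := (maximalIdeal A).height_le_ringKrullDim_quotient_add_one hx
      rw [maximalIdeal_height_eq_ringKrullDim] at h1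
      have h2 := hdim.trans h1
      push_cast at h2
      exact WithBot.le_of_add_natCast_le_add_natCast (n := 1) (by exact_mod_cast h2)
    obtain ⟨hdom, rs, hlen, hmem, hreg⟩ := ih (A ⧸ Ideal.span {x})
      ((s.erase y).image (Ideal.Quotient.mk (Ideal.span {x}))) (by
        rw [Finset.coe_image, ← Ideal.map_span, ← hmap, ← hspan, Ideal.map_sup,
          Ideal.map_quotient_self, bot_sup_eq])
      (Finset.card_image_le.trans (by rw [Finset.card_erase_of_mem hy]; omega)) hdim'
    have hA := isDomain_of_isDomain_quotient_span_singleton hx hxq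
    refine ⟨hA, ?_⟩
    obtain ⟨rs', rfl⟩ :=
      List.map_surjective_iff.mpr (Ideal.Quotient.mk_surjective (I := Ideal.span {x})) rs
    have hx0 : x ≠ 0 := fun h => hx2 (h ▸ zero_mem _)
    refine ⟨x :: rs', by simpa using hlen, ?_, ?_⟩
    · intro r hr
      rcases List.mem_cons.mp hr with rfl | hr
      · exact hx
      · have h1 := hmem _ (List.mem_map_of_mem hr)
        rw [← hmap, Ideal.mem_quotient_iff_mem
          ((Ideal.span_singleton_le_iff_mem _).mpr hx)] at h1
        exact h1
    · refine (isRegular_cons_iff' A x rs').mpr ⟨IsSMulRegular.of_ne_zero hx0, ?_⟩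
      have e : (A ⧸ Ideal.span {x}) ≃ₗ[A] QuotSMulTop x A :=
        Submodule.quotEquivOfEq _ _ (by
          ext z
          simp [Ideal.mem_span_singleton, Submodule.mem_smul_pointwise_iff_exists,
            dvd_iff_exists_eq_mul_right, eq_comm])
      refine (e.toAddEquiv.isRegular_congr ?_).mp hreg
      refine List.forall₂_same.mpr fun r hr z => ?_
      obtain ⟨r, rfl⟩ := Ideal.Quotient.mk_surjective r
      exact e.map_smul r z

theorem IsRegularLocalRing.isDomain_and_hasDepth (A : Type u) [CommRing A] [IsRegularLocalRing A]
    {d : ℕ} (hd : ringKrullDim A = d) : IsDomain A ∧ HasDepth A A d := by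
  have hfg : (maximalIdeal A).FG := IsNoetherian.noetherian _
  have hfin : (Submodule.generators (maximalIdeal A)).Finite := Submodule.FG.finite_generators hfg
  refine isDomain_and_hasDepth_of_span_eq_maximalIdeal d A hfin.toFinset ?_ ?_ hd.ge
  · rw [hfin.coe_toFinset]
    exact Submodule.span_generators _
  · have h1 := IsRegularLocalRing.spanFinrank_maximalIdeal (R := A)
    rw [hd] at h1
    rw [← Set.ncard_eq_toFinset_card _ hfin, Submodule.FG.generators_ncard hfg]
    exact_mod_cast h1.le

end CohenMacaulay

section CompleteIntersection

open RingTheory.Sequence IsLocalRing Pointwise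

/-- Killing first an ideal and then an element amounts to killing their sum. -/
def quotSMulTopQuotientEquiv {A : Type u} [CommRing A] (J : Ideal A) (f : A) :
    QuotSMulTop f (A ⧸ J) ≃ₗ[A] A ⧸ (J ⊔ Ideal.span {f}) := by
  let φ : A →ₗ[A] QuotSMulTop f (A ⧸ J) := (f • (⊤ : Submodule A (A ⧸ J))).mkQ ∘ₗ J.mkQ
  refine ((Submodule.quotEquivOfEq _ _ ?_).trans
    (φ.quotKerEquivOfSurjective ((Submodule.mkQ_surjective _).comp (Submodule.mkQ_surjective _)))).symm
  ext a
  rw [LinearMap.mem_ker, LinearMap.comp_apply, Submodule.mkQ_apply, Submodule.Quotient.mk_eq_zero,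
    Submodule.mem_smul_pointwise_iff_exists, Submodule.mem_sup]
  constructor
  · rintro ⟨j, hj, z, hz, rfl⟩
    obtain ⟨w, rfl⟩ := Ideal.mem_span_singleton.mp hz
    refine ⟨J.mkQ w, trivial, ?_⟩
    rw [← map_smul, Submodule.mkQ_apply, Submodule.mkQ_apply, Submodule.Quotient.eq, smul_eq_mul]
    simpa using hj
  · rintro ⟨z, -, hz⟩
    obtain ⟨w, rfl⟩ := Submodule.mkQ_surjective _ z
    rw [← map_smul, Submodule.mkQ_apply, Submodule.mkQ_apply, Submodule.Quotient.eq, smul_eq_mul] at hz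
    exact ⟨a - f * w, by simpa using neg_mem hz, f * w,
      Ideal.mul_mem_right _ _ (Ideal.mem_span_singleton_self f), by ring⟩

theorem HasDepth.congr {A : Type u} [CommRing A] [IsLocalRing A] {M M' : Type u}
    [AddCommGroup M] [Module A M] [AddCommGroup M'] [Module A M'] {n : ℕ} (e : M ≃ₗ[A] M')
    (h : HasDepth A M n) : HasDepth A M' n := by
  obtain ⟨rs, hlen, hmem, hreg⟩ := h
  exact ⟨rs, hlen, hmem, (e.isRegular_congr rs).mp hreg⟩

theorem exists_isAssociatedPrime_of_not_isSMulRegular {A : Type u} [CommRing A] [IsNoetherianRing A]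
    {M : Type u} [AddCommGroup M] [Module A M] {f : A} (h : ¬ IsSMulRegular M f) :
    ∃ Q : Ideal A, IsAssociatedPrime Q M ∧ f ∈ Q := by
  rw [isSMulRegular_iff_right_eq_zero_of_smul] at h
  push Not at h
  obtain ⟨u, hu, hu0⟩ := h
  obtain ⟨Q, hQ, hle⟩ := exists_le_isAssociatedPrime_of_isNoetherianRing A u hu0
  refine ⟨Q, hQ, hle ?_⟩
  rwa [Submodule.mem_colon_singleton, Submodule.mem_bot]

theorem HasDepth.quotient_sup_ofList {A : Type u} [CommRing A] [IsLocalRing A] [IsNoetherianRing A] :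
    ∀ (fs : List A) (_ : ∀ f ∈ fs, f ∈ maximalIdeal A) (J : Ideal A) (e : ℕ)
    (_ : HasDepth A (A ⧸ J) (e + fs.length)) (_ : ringKrullDim (A ⧸ (J ⊔ Ideal.ofList fs)) ≤ e),
    HasDepth A (A ⧸ (J ⊔ Ideal.ofList fs)) e := by
  classical
  intro fs
  induction fs with
  | nil =>
    intro _ J e h _
    have : J ⊔ Ideal.ofList ([] : List A) = J := by simp
    rw [this]
    exact h
  | cons f fs ih =>
    intro hfs J e h hdim
    have hf := hfs f (by simp)
    rw [Ideal.ofList_cons, ← sup_assoc] at hdim ⊢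
    have hreg : IsSMulRegular (A ⧸ J) f := by
      by_contra hreg
      obtain ⟨Q, hQ, hfQ⟩ := exists_isAssociatedPrime_of_not_isSMulRegular hreg
      have hJQ : J ≤ Q := by
        have := hQ.annihilator_le
        rwa [Submodule.annihilator_top, Ideal.annihilator_quotient] at this
      have hle : J ⊔ Ideal.span {f} ≤ Q :=
        sup_le hJQ ((Ideal.span_singleton_le_iff_mem _).mpr hfQ)
      have h1 := h.le_ringKrullDim hQ
      have h2 : ringKrullDim (A ⧸ Q) ≤ ringKrullDim (A ⧸ (J ⊔ Ideal.span {f})) :=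
        ringKrullDim_le_of_surjective _ (Ideal.Quotient.factor_surjective hle)
      set J' := J ⊔ Ideal.span {f}
      have hQp := hQ.isPrime
      have : IsLocalRing (A ⧸ J') :=
        have : Nontrivial (A ⧸ J') := Ideal.Quotient.nontrivial_iff.mpr fun h =>
          hQp.ne_top (top_le_iff.mp (h ▸ hle))
        IsLocalRing.of_surjective' _ Ideal.Quotient.mk_surjective
      let s : Finset (A ⧸ J') := (fs.map (Ideal.Quotient.mk J')).toFinset
      have hs : Ideal.span (s : Set (A ⧸ J')) = (Ideal.ofList fs).map (Ideal.Quotient.mk J') := by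
        rw [Ideal.map_ofList]
        simp [s, Ideal.ofList]
      have h3 := ringKrullDim_le_ringKrullDim_quotient_add_card s (by
        rw [IsLocalRing.ringJacobson_eq_maximalIdeal]
        intro x hx
        obtain ⟨r, hr, rfl⟩ : ∃ r ∈ fs, Ideal.Quotient.mk J' r = x := by simpa [s] using hx
        have := IsLocalHom.of_surjective (Ideal.Quotient.mk J') Ideal.Quotient.mk_surjective
        exact map_nonunit _ r (hfs r (by simp [hr])))
      have h4 : ringKrullDim ((A ⧸ J') ⧸ Ideal.span (s : Set (A ⧸ J'))) =
          ringKrullDim (A ⧸ (J' ⊔ Ideal.ofList fs)) := by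
        rw [hs]
        exact ringKrullDim_eq_of_ringEquiv (DoubleQuot.quotQuotEquivQuotSup J' (Ideal.ofList fs))
      have h5 : s.card ≤ fs.length := (List.toFinset_card_le _).trans (by simp)
      rw [h4] at h3
      have h6 : ((e + (f :: fs).length : ℕ) : WithBot ℕ∞) ≤ ((e + fs.length : ℕ) : WithBot ℕ∞) := by
        refine (h1.trans (h2.trans h3)).trans ?_
        push_cast
        exact add_le_add hdim (by exact_mod_cast h5)
      have h7 : e + (f :: fs).length ≤ e + fs.length := by exact_mod_cast h6
      simp at h7
    refine ih (fun r hr => hfs r (by simp [hr])) _ e ?_ hdim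
    exact (HasDepth.quotSMulTop (n := e + fs.length) h hf hreg).congr (quotSMulTopQuotientEquiv J f)

/-- In a regular local ring modulo a prime complete intersection ideal, a hypersurface having
the closed point as an associated point forces the dimension of the quotient to be at most one. -/
theorem IsRegularLocalRing.le_length_add_one_of_isAssociatedPrime {A : Type u} [CommRing A]
    [IsRegularLocalRing A] {d e : ℕ} (hd : ringKrullDim A = d) (fs : List A)
    (hfs : ∀ f ∈ fs, f ∈ maximalIdeal A) (hde : d = e + fs.length)
    (hdim : ringKrullDim (A ⧸ Ideal.ofList fs) ≤ e)
    {b : A} (hb : b ∈ maximalIdeal A) (hreg : IsSMulRegular (A ⧸ Ideal.ofList fs) b)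
    (hass : IsAssociatedPrime (maximalIdeal A) (A ⧸ (Ideal.ofList fs ⊔ Ideal.span {b}))) :
    e ≤ 1 := by
  obtain ⟨-, hdep⟩ := IsRegularLocalRing.isDomain_and_hasDepth A hd
  rw [hde] at hdep
  have h1 : HasDepth A (A ⧸ Ideal.ofList fs) e := by
    have e1 : A ≃ₗ[A] A ⧸ (⊥ : Ideal A) := (Submodule.quotEquivOfEqBot ⊥ rfl).symm
    have := HasDepth.quotient_sup_ofList fs hfs ⊥ e (hdep.congr e1) (by rwa [bot_sup_eq])
    rwa [bot_sup_eq] at this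
  match e, h1 with
  | 0, _ => simp
  | e + 1, h1 =>
    have h2 := ((h1.quotSMulTop hb hreg).congr (quotSMulTopQuotientEquiv _ b)).le_ringKrullDim hass
    let := Ideal.Quotient.field (maximalIdeal A)
    rw [ringKrullDim_eq_zero_of_field] at h2
    have : e ≤ 0 := by exact_mod_cast h2
    omega

end CompleteIntersection

section JacobianCriterion

open IsLocalRing

theorem Derivation.apply_mem_of_mem_sq {R T : Type*} [CommRing R] [CommRing T] [Algebra R T]
    (D : Derivation R T T) {q : Ideal T} {x : T} (hx : x ∈ q ^ 2) : D x ∈ q := by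
  rw [pow_two] at hx
  refine Submodule.mul_induction_on hx (fun a ha b hb => ?_) fun a b ha hb => ?_
  · rw [D.leibniz]
    exact add_mem (Ideal.mul_mem_right _ _ ha) (Ideal.mul_mem_right _ _ hb)
  · rw [map_add]
    exact add_mem ha hb

/-- The Jacobian criterion: elements of a prime ideal with linearly independent differentials have
linearly independent classes in the cotangent space of the localization. -/
theorem linearIndependent_toCotangent_of_derivation {R T : Type*} [CommRing R] [CommRing T]
    [IsDomain T] [Algebra R T] {q : Ideal T} [q.IsPrime] {L : Type*} [Field L] (ρ : T →+* L)
    (hρ : RingHom.ker ρ = q) {τ ι : Type*} [Fintype ι] (D : τ → Derivation R T T) (G : ι → T)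
    (hG : ∀ j, algebraMap T (Localization.AtPrime q) (G j) ∈
      maximalIdeal (Localization.AtPrime q))
    (h : LinearIndependent L fun j i => ρ (D i (G j))) :
    LinearIndependent (ResidueField (Localization.AtPrime q)) fun j =>
      ((maximalIdeal (Localization.AtPrime q)).toCotangent ⟨_, hG j⟩ :
        CotangentSpace (Localization.AtPrime q)) := by
  have hGq (j) : G j ∈ q := (IsLocalization.AtPrime.to_map_mem_maximal_iff _ q _).mp (hG j)
  rw [Fintype.linearIndependent_iff] at h ⊢
  intro g hg
  choose a ha using fun j => residue_surjective (g j)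
  obtain ⟨t, ht⟩ := IsLocalization.exist_integer_multiples_of_finite q.primeCompl a
  choose s hs using ht
  have h1 : ∑ j, a j * algebraMap T (Localization.AtPrime q) (G j) ∈
      maximalIdeal (Localization.AtPrime q) ^ 2 := by
    have h2 : (maximalIdeal (Localization.AtPrime q)).toCotangent
        (∑ j, a j • (⟨_, hG j⟩ : maximalIdeal (Localization.AtPrime q))) = 0 := by
      rw [map_sum, ← hg]
      refine Finset.sum_congr rfl fun j _ => ?_
      rw [map_smul, ← ha j]
      rfl
    rw [Ideal.toCotangent_eq_zero] at h2
    simpa using h2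
  have h2 : algebraMap T (Localization.AtPrime q) (∑ j, s j * G j) ∈
      maximalIdeal (Localization.AtPrime q) ^ 2 := by
    convert Ideal.mul_mem_left _ (algebraMap T (Localization.AtPrime q) t) h1 using 1
    rw [map_sum, Finset.mul_sum]
    refine Finset.sum_congr rfl fun j _ => ?_
    rw [map_mul, hs j, Algebra.smul_def, mul_assoc]
  rw [← Localization.AtPrime.map_eq_maximalIdeal, ← Ideal.map_pow,
    IsLocalization.mem_map_algebraMap_iff q.primeCompl] at h2
  obtain ⟨⟨x, t'⟩, hx⟩ := h2
  rw [← map_mul] at hx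
  have hinj : Function.Injective (algebraMap T (Localization.AtPrime q)) :=
    IsLocalization.injective _ q.primeCompl_le_nonZeroDivisors
  have h3 : (∑ j, s j * G j) * t' ∈ q ^ 2 := hinj hx ▸ x.2
  have hρ0 (x) (hx : x ∈ q) : ρ x = 0 := by rwa [← hρ, RingHom.mem_ker] at hx
  have hρt : ρ t' ≠ 0 := fun h => t'.2 (by rwa [← RingHom.mem_ker, hρ] at h)
  have h4 (j) : ρ (s j) = 0 := by
    refine h (fun j => ρ (s j)) ?_ j
    ext i
    have h5 := hρ0 _ ((D i).apply_mem_of_mem_sq h3)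
    rw [(D i).leibniz, smul_eq_mul, smul_eq_mul, map_add, map_mul, map_mul,
      hρ0 _ (Ideal.sum_mem _ fun j _ => Ideal.mul_mem_left _ _ (hGq j)), zero_mul, zero_add,
      mul_eq_zero, or_iff_right hρt, map_sum, map_sum] at h5
    simp only [Finset.sum_apply, Pi.smul_apply, smul_eq_mul, Pi.zero_apply]
    rw [← h5]
    refine Finset.sum_congr rfl fun j _ => ?_
    rw [(D i).leibniz, smul_eq_mul, smul_eq_mul, map_add, map_mul, map_mul, hρ0 _ (hGq j),
      zero_mul, add_zero]
  intro j
  rw [← ha j, residue_eq_zero_iff]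
  have h6 : s j ∈ q := by rw [← hρ]; exact h4 j
  have h7 := (IsLocalization.AtPrime.to_map_mem_maximal_iff (Localization.AtPrime q) q _).mpr h6
  rw [hs j, Algebra.smul_def] at h7
  refine ((maximalIdeal.isMaximal _).isPrime.mem_or_mem h7).resolve_left fun h8 => ?_
  exact t.2 ((IsLocalization.AtPrime.to_map_mem_maximal_iff (Localization.AtPrime q) q _).mp h8)

theorem finrank_cotangentSpace_localization_eq_height {T : Type*} [CommRing T] [IsRegularRing T]
    (q : Ideal T) [q.IsPrime] :
    (Module.finrank (ResidueField (Localization.AtPrime q))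
      (CotangentSpace (Localization.AtPrime q)) : ℕ∞) = q.height := by
  have h1 := (IsRegularLocalRing.iff_finrank_cotangentSpace (Localization.AtPrime q)).mp
    inferInstance
  rw [IsLocalization.AtPrime.ringKrullDim_eq_height q (Localization.AtPrime q)] at h1
  exact_mod_cast h1

theorem card_le_height_of_derivation {R T : Type*} [CommRing R] [CommRing T]
    [IsDomain T] [IsRegularRing T] [Algebra R T] {q : Ideal T} [q.IsPrime] {L : Type*} [Field L]
    (ρ : T →+* L) (hρ : RingHom.ker ρ = q) {τ ι : Type*} [Fintype ι] (D : τ → Derivation R T T)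
    (G : ι → T) (hG : ∀ j, G j ∈ q) (h : LinearIndependent L fun j i => ρ (D i (G j))) :
    (Fintype.card ι : ℕ∞) ≤ q.height := by
  rw [← finrank_cotangentSpace_localization_eq_height q]
  exact_mod_cast (linearIndependent_toCotangent_of_derivation ρ hρ D G (fun j =>
    (IsLocalization.AtPrime.to_map_mem_maximal_iff _ q _).mpr (hG j)) h).fintype_card_le_finrank

/-- If the height exceeds the number of independent equations by at most one, then one more
element generates the maximal ideal of the localization. -/
theorem exists_maximalIdeal_eq_span_sup_of_derivation {R T : Type*} [CommRing R] [CommRing T]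
    [IsDomain T] [IsRegularRing T] [Algebra R T] {q : Ideal T} [q.IsPrime] {L : Type*} [Field L]
    (ρ : T →+* L) (hρ : RingHom.ker ρ = q) {τ ι : Type*} [Fintype ι] (D : τ → Derivation R T T)
    (G : ι → T) (hG : ∀ j, G j ∈ q) (h : LinearIndependent L fun j i => ρ (D i (G j)))
    (hht : q.height ≤ Fintype.card ι + 1) :
    ∃ z : Localization.AtPrime q, maximalIdeal (Localization.AtPrime q) =
      (Ideal.span (Set.range G)).map (algebraMap T (Localization.AtPrime q)) ⊔ Ideal.span {z} := by
  set A := Localization.AtPrime q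
  have hG' (j) : algebraMap T A (G j) ∈ maximalIdeal A :=
    (IsLocalization.AtPrime.to_map_mem_maximal_iff _ q _).mpr (hG j)
  have hli := linearIndependent_toCotangent_of_derivation ρ hρ D G hG' h
  set v : ι → CotangentSpace A := fun j => (maximalIdeal A).toCotangent ⟨_, hG' j⟩
  set W := Submodule.span (ResidueField A) (Set.range v)
  have hfin : Module.finrank (ResidueField A) (CotangentSpace A ⧸ W) ≤ 1 := by
    have h1 : (Module.finrank (ResidueField A) (CotangentSpace A) : ℕ∞) ≤ Fintype.card ι + 1 :=
      (finrank_cotangentSpace_localization_eq_height q).le.trans hht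
    have h2 : Module.finrank (ResidueField A) (CotangentSpace A) ≤ Fintype.card ι + 1 := by
      exact_mod_cast h1
    have h3 := W.finrank_quotient_add_finrank
    have h4 : Module.finrank (ResidueField A) W = Fintype.card ι := finrank_span_eq_card hli
    omega
  obtain ⟨w, hw⟩ := finrank_le_one_iff.mp hfin
  obtain ⟨w, rfl⟩ := W.mkQ_surjective w
  obtain ⟨⟨z, hz⟩, rfl⟩ := (maximalIdeal A).toCotangent_surjective w
  refine ⟨z, le_antisymm ?_ (sup_le ?_ ((Ideal.span_singleton_le_iff_mem _).mpr hz))⟩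
  · set I := (Ideal.span (Set.range G)).map (algebraMap T A) ⊔ Ideal.span {z}
    refine Submodule.le_of_le_smul_of_le_jacobson_bot (I := maximalIdeal A)
      (IsNoetherian.noetherian _) (maximalIdeal_le_jacobson _) fun x hx => ?_
    obtain ⟨c, hc⟩ := hw (W.mkQ ((maximalIdeal A).toCotangent ⟨x, hx⟩))
    obtain ⟨c, rfl⟩ := residue_surjective c
    rw [← map_smul, ← sub_eq_zero, ← map_sub, Submodule.mkQ_apply,
      Submodule.Quotient.mk_eq_zero] at hc
    obtain ⟨g, hg⟩ := (Submodule.mem_span_range_iff_exists_fun _).mp hc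
    choose a ha using fun j => residue_surjective (g j)
    have h1 : (maximalIdeal A).toCotangent (∑ j, a j • (⟨_, hG' j⟩ : maximalIdeal A)) =
        (maximalIdeal A).toCotangent (c • ⟨z, hz⟩ - ⟨x, hx⟩) := by
      rw [map_sum, map_sub, map_smul]
      refine Eq.trans (Finset.sum_congr rfl fun j _ => ?_) hg
      rw [map_smul, ← ha j]
      rfl
    rw [Ideal.toCotangent_eq] at h1
    have h2 : (∑ j, a j * algebraMap T A (G j)) - (c * z - x) ∈ maximalIdeal A ^ 2 := by
      simpa using h1
    have h3 : ∑ j, a j * algebraMap T A (G j) ∈ I := Ideal.mem_sup_left <| Ideal.sum_mem _ fun j _ =>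
      Ideal.mul_mem_left _ _ (Ideal.mem_map_of_mem _ (Ideal.subset_span ⟨j, rfl⟩))
    have h4 : c * z ∈ I := Ideal.mem_sup_right
      (Ideal.mul_mem_left _ _ (Ideal.mem_span_singleton_self z))
    have : x = (c * z - ∑ j, a j * algebraMap T A (G j)) +
      ((∑ j, a j * algebraMap T A (G j)) - (c * z - x)) := by ring
    rw [this]
    refine Submodule.add_mem_sup (sub_mem h4 h3) ?_
    rwa [smul_eq_mul, ← pow_two]
  · rw [Ideal.map_span, Ideal.span_le]
    rintro - ⟨-, ⟨j, rfl⟩, rfl⟩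
    exact hG' j

end JacobianCriterion

theorem ringKrullDim_le_of_isIntegral {A B : Type*} [CommRing A] [CommRing B] [Algebra A B]
    [FaithfulSMul A B] [Algebra.IsIntegral A B] : ringKrullDim A ≤ ringKrullDim B := by
  refine iSup_le fun l => ?_
  obtain ⟨⟨P, hP, hPl⟩⟩ := Ideal.nonempty_primesOver (S := B) l.head.asIdeal
  obtain ⟨L, hL, -⟩ := Ideal.exists_ltSeries_of_hasGoingUp l P
  rw [← hL]
  exact le_iSup (fun L : LTSeries (PrimeSpectrum B) => (L.length : WithBot ℕ∞)) L

theorem IsTranscendenceBasis.card_le_ringKrullDim {k R K : Type u} [Field k] [CommRing R]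
    [IsDomain R] [Algebra k R] [Algebra.FiniteType k R] [Field K] [Algebra R K] [IsFractionRing R K]
    [Algebra k K] [IsScalarTower k R K] {s : Finset K}
    (hs : IsTranscendenceBasis k ((↑) : s → K)) : (s.card : WithBot ℕ∞) ≤ ringKrullDim R := by
  obtain ⟨t, g, hg, hgi⟩ := exists_integral_inj_algHom_of_fg k R
  let := g.toRingHom.toAlgebra
  have htower : IsScalarTower k (MvPolynomial (Fin t) k) R :=
    IsScalarTower.of_algebraMap_eq fun x => (g.commutes x).symm
  have : FaithfulSMul (MvPolynomial (Fin t) k) R := (faithfulSMul_iff_algebraMap_injective _ _).mpr hg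
  have : Algebra.IsIntegral (MvPolynomial (Fin t) k) R := ⟨hgi⟩
  have : Algebra.IsAlgebraic R K := IsLocalization.isAlgebraic K (nonZeroDivisors R)
  have h1 := ((IsTranscendenceBasis.mvPolynomial (Fin t) k).algebraMap_comp (A := R)).algebraMap_comp
    (A := K)
  have h2 := h1.lift_cardinalMk_eq hs
  have h3 : t = s.card := by simpa using h2
  rw [← h3]
  have h4 := ringKrullDim_le_of_isIntegral (A := MvPolynomial (Fin t) k) (B := R)
  rw [MvPolynomial.ringKrullDim_of_isNoetherianRing, ringKrullDim_eq_zero_of_field, zero_add] at h4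
  simpa using h4

theorem Derivation.eq_zero_of_isSeparable {k K : Type*} [Field k] [Field K] [Algebra k K]
    (s : Set K) [Algebra.IsSeparable (IntermediateField.adjoin k s) K]
    (D : Derivation k K K) (h : ∀ x ∈ s, D x = 0) : D = 0 := by
  have h1 (x) (hx : x ∈ IntermediateField.adjoin k s) : D x = 0 := by
    induction hx using IntermediateField.adjoin_induction with
    | mem x hx => exact h x hx
    | algebraMap x => exact D.map_algebraMap x
    | add x y _ _ hx hy => rw [map_add, hx, hy, add_zero]
    | inv x _ hx => rw [D.leibniz_inv, hx, smul_zero]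
    | mul x y _ _ hx hy => rw [D.leibniz, hx, hy, smul_zero, smul_zero, add_zero]
  let D' : Derivation (IntermediateField.adjoin k s) K K := Derivation.mk'
    { toFun := D
      map_add' := map_add D
      map_smul' := fun c x => by
        rw [Algebra.smul_def, D.leibniz]
        have : D (algebraMap (IntermediateField.adjoin k s) K c) = 0 := h1 _ c.2
        rw [this, smul_zero, add_zero]
        rfl } D.leibniz
  have : Algebra.FormallyUnramified (IntermediateField.adjoin k s) K :=
    Algebra.FormallyUnramified.of_isSeparable _ _
  have h2 : D' = 0 := by
    rw [← D'.liftKaehlerDifferential_comp, Subsingleton.elim D'.liftKaehlerDifferential 0]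
    ext; simp
  ext x
  exact DFunLike.congr_fun h2 x

theorem finrank_derivation_le_ringKrullDim {k R K : Type u} [Field k] [PerfectField k] [CommRing R]
    [IsDomain R] [Algebra k R] [Algebra.FiniteType k R] [Field K] [Algebra R K] [IsFractionRing R K]
    [Algebra k K] [IsScalarTower k R K] :
    Module.Finite K (Derivation k K K) ∧
      (Module.finrank K (Derivation k K K) : WithBot ℕ∞) ≤ ringKrullDim R := by
  have : Algebra.EssFiniteType R K := Algebra.EssFiniteType.of_isLocalization K (nonZeroDivisors R)
  have : Algebra.EssFiniteType k K := Algebra.EssFiniteType.comp k R K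
  obtain ⟨s, hs, hsep⟩ := exists_isTranscendenceBasis_and_isSeparable_of_perfectField (k := k) (K := K)
  let ev : Derivation k K K →ₗ[K] (s → K) :=
    { toFun := fun D x => D x
      map_add' := fun _ _ => rfl
      map_smul' := fun _ _ => rfl }
  have hev : Function.Injective ev := by
    rw [injective_iff_map_eq_zero]
    intro D hD
    exact D.eq_zero_of_isSeparable (s : Set K) fun x hx => congrFun hD ⟨x, hx⟩
  refine ⟨Module.Finite.of_injective ev hev, le_trans ?_ (hs.card_le_ringKrullDim (R := R))⟩
  have := LinearMap.finrank_le_finrank_of_injective hev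
  rw [Module.finrank_fintype_fun_eq_card, Fintype.card_coe] at this
  exact_mod_cast this

/-- Derivations into the field of fractions extend to the field of fractions. -/
theorem Derivation.exists_extend_isFractionRing {k R K : Type*} [CommRing k] [CommRing R]
    [IsDomain R] [Algebra k R] [Field K] [Algebra R K] [IsFractionRing R K]
    [Algebra k K] [IsScalarTower k R K] (D : Derivation k R K) :
    ∃ D' : Derivation k K K, ∀ x, D' (algebraMap R K x) = D x := by
  let g := IsLocalizedModule.lift (nonZeroDivisors R) (KaehlerDifferential.map k k R K)
    D.liftKaehlerDifferential (fun x => by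
      rw [Module.End.isUnit_iff]
      have hx : algebraMap R K x ≠ 0 := by
        simp
      refine ⟨fun a b hab => ?_, fun b => ⟨(algebraMap R K x)⁻¹ * b, ?_⟩⟩
      · simpa [Algebra.smul_def, hx] using hab
      · simp [Algebra.smul_def, hx])
  refine ⟨(g.extendScalarsOfIsLocalization (nonZeroDivisors R) K).compDer (KaehlerDifferential.D k K),
    fun x => ?_⟩
  have : g (KaehlerDifferential.map k k R K (KaehlerDifferential.D k R x)) = D x := by
    rw [IsLocalizedModule.lift_apply, D.liftKaehlerDifferential_comp_D]
  simpa using this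

theorem Derivation.exists_descend_of_surjective {k S R M : Type*} [CommRing k] [CommRing S]
    [CommRing R] [Algebra k S] [Algebra k R] [Algebra S R] [IsScalarTower k S R] [AddCommGroup M]
    [Module k M] [Module S M] [Module R M] [IsScalarTower S R M]
    (hsurj : Function.Surjective (algebraMap S R)) (D : Derivation k S M)
    (hD : ∀ x, algebraMap S R x = 0 → D x = 0) :
    ∃ D' : Derivation k R M, ∀ x, D' (algebraMap S R x) = D x := by
  have key (x y : S) (h : algebraMap S R x = algebraMap S R y) : D x = D y := by
    rw [← sub_eq_zero, ← map_sub, hD _ (by rw [map_sub, h, sub_self])]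
  choose s hs using hsurj
  refine ⟨Derivation.mk'
    { toFun := fun x => D (s x)
      map_add' := fun x y => by rw [← map_add]; exact key _ _ (by simp [hs])
      map_smul' := fun c x => by
        rw [RingHom.id_apply, ← map_smul]
        exact key _ _ (by rw [hs, Algebra.smul_def, Algebra.smul_def, map_mul, hs,
          ← IsScalarTower.algebraMap_apply]) } fun x y => ?_, fun x => key _ _ (hs _)⟩
  change D (s (x * y)) = x • D (s y) + y • D (s x)
  rw [← hs x, ← hs y, algebraMap_smul, algebraMap_smul, hs, hs, ← D.leibniz]
  exact key _ _ (by simp [hs])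

section JacobianMatrix

open MvPolynomial

theorem MvPolynomial.derivation_eq_sum_pderiv {R σ M : Type*} [CommRing R] [Fintype σ]
    [AddCommGroup M] [Module R M] [Module (MvPolynomial σ R) M]
    [IsScalarTower R (MvPolynomial σ R) M] (D : Derivation R (MvPolynomial σ R) M) (p : MvPolynomial σ R) :
    D p = ∑ i, pderiv i p • D (X i) := by
  classical
  induction p using MvPolynomial.induction_on with
  | C a => simp
  | add p q hp hq => rw [map_add, hp, hq, ← Finset.sum_add_distrib]; simp only [map_add, add_smul]
  | mul_X p i hp =>
    simp only [Derivation.leibniz, hp, add_smul, Finset.sum_add_distrib, smul_eq_mul, mul_smul,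
      ← Finset.smul_sum]
    congr 1
    rw [Finset.sum_eq_single i]
    · simp
    · intro j _ hj
      rw [pderiv_X_of_ne hj.symm, zero_smul]
    · simp

/-- The Jacobian matrix of a reduced and irreducible complete intersection has full rank at the
generic point. -/
theorem linearIndependent_pderiv_of_ringKrullDim_le {k R K : Type u} {σ : Type} [Field k]
    [PerfectField k] [Fintype σ] {ι : Type*} [Fintype ι] (f : ι → MvPolynomial σ k)
    [CommRing R] [IsDomain R] [Algebra k R] [Algebra (MvPolynomial σ k) R]
    [IsScalarTower k (MvPolynomial σ k) R]
    (hsurj : Function.Surjective (algebraMap (MvPolynomial σ k) R))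
    (hkerR : RingHom.ker (algebraMap (MvPolynomial σ k) R) = Ideal.span (Set.range f))
    [Field K] [Algebra R K] [IsFractionRing R K]
    [Algebra k K] [IsScalarTower k R K] {n : ℕ}
    (hn : Fintype.card ι + n = Fintype.card σ) (hdim : ringKrullDim R ≤ n) :
    LinearIndependent K fun j i => algebraMap R K (algebraMap (MvPolynomial σ k) R
      (MvPolynomial.pderiv i (f j))) := by
  classical
  let : Algebra (MvPolynomial σ k) K :=
    ((algebraMap R K).comp (algebraMap (MvPolynomial σ k) R)).toAlgebra
  have : IsScalarTower (MvPolynomial σ k) R K := IsScalarTower.of_algebraMap_eq fun _ => rfl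
  have : IsScalarTower k (MvPolynomial σ k) K := IsScalarTower.of_algebraMap_eq fun x => by
    rw [IsScalarTower.algebraMap_apply k R K, IsScalarTower.algebraMap_apply k (MvPolynomial σ k) R]
    rfl
  have : Algebra.FiniteType k R := Algebra.FiniteType.of_surjective
    (IsScalarTower.toAlgHom k (MvPolynomial σ k) R) hsurj
  obtain ⟨hfin, hder⟩ := finrank_derivation_le_ringKrullDim (k := k) (R := R) (K := K)
  have hder' : Module.finrank K (Derivation k K K) ≤ n := by exact_mod_cast hder.trans hdim
  let J : Matrix ι σ K := Matrix.of fun j i =>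
    algebraMap R K (algebraMap (MvPolynomial σ k) R (MvPolynomial.pderiv i (f j)))
  let ev : Derivation k K K →ₗ[K] (σ → K) :=
    { toFun := fun D i => D (algebraMap R K (algebraMap (MvPolynomial σ k) R (MvPolynomial.X i)))
      map_add' := fun _ _ => rfl
      map_smul' := fun _ _ => rfl }
  have hker : LinearMap.ker J.mulVecLin ≤ LinearMap.range ev := by
    intro v hv
    have hv (j) : ∑ i, algebraMap (MvPolynomial σ k) K (MvPolynomial.pderiv i (f j)) * v i = 0 :=
      congrFun hv j
    let d : Derivation k (MvPolynomial σ k) K := MvPolynomial.mkDerivation k v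
    have hdX (i) : d (X i) = v i := MvPolynomial.mkDerivation_X _ _ _
    have hdf (j) : d (f j) = 0 := by
      rw [MvPolynomial.derivation_eq_sum_pderiv, ← hv j]
      refine Finset.sum_congr rfl fun i _ => ?_
      rw [hdX, Algebra.smul_def]
    have hmk (x : MvPolynomial σ k) (hx : algebraMap (MvPolynomial σ k) R x = 0) (y : K) :
        x • y = 0 := by
      rw [Algebra.smul_def, IsScalarTower.algebraMap_apply (MvPolynomial σ k) R K, hx, map_zero,
        zero_mul]
    have hd (x) (hx : algebraMap (MvPolynomial σ k) R x = 0) : d x = 0 := by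
      rw [← RingHom.mem_ker, hkerR] at hx
      induction hx using Submodule.span_induction with
      | mem x hx =>
        obtain ⟨j, rfl⟩ := hx
        exact hdf j
      | zero => exact map_zero d
      | add x y _ _ hx hy => rw [map_add, hx, hy, add_zero]
      | smul a x hx h =>
        rw [smul_eq_mul, d.leibniz, h, smul_zero, zero_add, hmk x (hkerR.ge hx)]
    obtain ⟨D₁, hD₁⟩ := d.exists_descend_of_surjective (R := R) hsurj hd
    obtain ⟨D₂, hD₂⟩ := D₁.exists_extend_isFractionRing (K := K)
    refine ⟨D₂, ?_⟩
    ext i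
    change D₂ (algebraMap R K (algebraMap (MvPolynomial σ k) R (MvPolynomial.X i))) = v i
    rw [hD₂, hD₁, hdX]
  have h1 : Module.finrank K (LinearMap.ker J.mulVecLin) ≤ n :=
    (Submodule.finrank_mono hker).trans ((LinearMap.finrank_range_le ev).trans hder')
  have h2 := J.mulVecLin.finrank_range_add_finrank_ker
  rw [Module.finrank_fintype_fun_eq_card] at h2
  have h3 : J.rank = Module.finrank K (LinearMap.range J.mulVecLin) := rfl
  have h4 := J.rank_eq_finrank_span_row
  change LinearIndependent K J.row
  rw [linearIndependent_iff_card_le_finrank_span, Set.finrank]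
  omega

end JacobianMatrix

theorem Matrix.exists_mul_eq_one_of_linearIndependent_row {K ι τ : Type*} [Field K] [Fintype ι]
    [DecidableEq ι] [Fintype τ] (A : Matrix ι τ K) (h : LinearIndependent K A.row) :
    ∃ B : Matrix τ ι K, A * B = 1 := by
  classical
  rw [← Matrix.vecMul_injective_iff] at h
  obtain ⟨g, hg⟩ := A.vecMulLinear.exists_leftInverse_of_injective (LinearMap.ker_eq_bot.mpr h)
  refine ⟨(LinearMap.toMatrix' g).transpose, ?_⟩
  refine Matrix.ext_of_single_vecMul fun i => ?_
  rw [← Matrix.vecMul_vecMul, Matrix.vecMul_transpose, LinearMap.toMatrix'_mulVec, Matrix.vecMul_one]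
  exact LinearMap.congr_fun hg _

theorem LinearIndependent.map_ringHom {K L ι τ : Type*} [Field K] [Field L] [Fintype ι]
    [Fintype τ] (g : K →+* L) {v : ι → τ → K} (h : LinearIndependent K v) :
    LinearIndependent L fun j i => g (v j i) := by
  classical
  obtain ⟨B, hB⟩ := Matrix.exists_mul_eq_one_of_linearIndependent_row (Matrix.of v) h
  have hB' : (Matrix.of v).map g * B.map g = 1 := by
    rw [← Matrix.map_mul, hB, Matrix.map_one _ (map_zero g) (map_one g)]
  refine (Matrix.vecMul_injective_iff (M := (Matrix.of v).map g)).mp fun a b hab => ?_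
  have := congrArg (Matrix.vecMul · (B.map g)) hab
  simpa [Matrix.vecMul_vecMul, hB'] using this

theorem LinearIndependent.of_map_ringHom {K L ι τ : Type*} [Field K] [Field L] [Fintype ι]
    (g : K →+* L) {v : ι → τ → K} (h : LinearIndependent L fun j i => g (v j i)) :
    LinearIndependent K v := by
  rw [Fintype.linearIndependent_iff] at h ⊢
  intro c hc i
  refine g.injective ((h (fun j => g (c j)) ?_ i).trans (map_zero g).symm)
  ext t
  have := congrArg g (congrFun hc t)
  simpa using this

/-- Linear independence of the rows of a matrix at a point of the spectrum does not depend on the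
field through which the point is represented. -/
theorem LinearIndependent.of_ker_eq {T L L' ι τ : Type*} [CommRing T] [Field L] [Field L']
    [Fintype ι] [Fintype τ] {ρ : T →+* L} {ρ' : T →+* L'} (hker : RingHom.ker ρ = RingHom.ker ρ')
    {v : ι → τ → T} (h : LinearIndependent L fun j i => ρ (v j i)) :
    LinearIndependent L' fun j i => ρ' (v j i) := by
  have : (RingHom.ker ρ).IsPrime := RingHom.ker_isPrime ρ
  let K := FractionRing (T ⧸ RingHom.ker ρ)
  have hinj : Function.Injective ρ.kerLift := ρ.kerLift_injective
  have hinj' : Function.Injective (Ideal.Quotient.lift (RingHom.ker ρ) ρ' fun a ha => by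
      rwa [hker] at ha) := RingHom.lift_injective_of_ker_le_ideal _ _ hker.ge
  have h1 : LinearIndependent L fun j i => (IsFractionRing.lift (K := K) hinj)
      (algebraMap (T ⧸ RingHom.ker ρ) K (Ideal.Quotient.mk _ (v j i))) := by
    simp only [IsFractionRing.lift_algebraMap]
    exact h
  have h2 := h1.of_map_ringHom.map_ringHom (IsFractionRing.lift (K := K) hinj')
  simp only [IsFractionRing.lift_algebraMap] at h2
  exact h2

section AssociatedPrimes

open IsLocalRing

theorem Ideal.ringKrullDim_quotient_add_height_le {A : Type*} [CommRing A] (J : Ideal A) {c d : ℕ}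
    (hc : (c : ℕ∞) ≤ J.height) (hd : ringKrullDim A = (c + d : ℕ)) :
    ringKrullDim (A ⧸ J) ≤ d := by
  refine iSup_le fun l => ?_
  have hinj := PrimeSpectrum.comap_injective_of_surjective (Ideal.Quotient.mk J)
    Ideal.Quotient.mk_surjective
  let l' : LTSeries (PrimeSpectrum A) := l.map (PrimeSpectrum.comap (Ideal.Quotient.mk J))
    (Monotone.strictMono_of_injective (fun _ _ hab => Ideal.comap_mono hab) hinj)
  have h1 : (l'.length : ℕ∞) ≤ Order.coheight l'.head := Order.length_le_coheight_head
  have h2 : J ≤ l'.head.asIdeal := by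
    intro x hx
    change Ideal.Quotient.mk J x ∈ l.head.asIdeal
    rw [Ideal.Quotient.eq_zero_iff_mem.mpr hx]
    exact zero_mem _
  have h3 : (c : ℕ∞) ≤ Order.height l'.head := by
    rw [← PrimeSpectrum.height_eq_orderHeight]
    exact hc.trans (Ideal.height_mono h2)
  have : Nonempty (PrimeSpectrum A) := ⟨l'.head⟩
  have h4 : Order.height l'.head + Order.coheight l'.head ≤ (c + d : ℕ) := by
    rw [ringKrullDim, Order.krullDim_eq_iSup_height_add_coheight_of_nonempty] at hd
    have hd' : (⨆ a : PrimeSpectrum A, Order.height a + Order.coheight a) = (c + d : ℕ) := by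
      exact_mod_cast hd
    rw [← hd']
    exact le_iSup (fun a : PrimeSpectrum A => Order.height a + Order.coheight a) l'.head
  have h5 := (add_le_add h3 h1).trans h4
  have h6 : l.length ≤ d := by
    have : c + l'.length ≤ c + d := by exact_mod_cast h5
    exact Nat.le_of_add_le_add_left this
  exact_mod_cast h6

/-- In a regular domain, the associated primes of a hypersurface in an integral complete
intersection of codimension `c` have height at most `c + 1`. -/
theorem Ideal.height_le_card_add_one_of_eq_colon {T : Type u} [CommRing T] [IsDomain T]
    [IsRegularRing T] {ι : Type*} [Fintype ι] (f : ι → T) [hI : (Ideal.span (Set.range f)).IsPrime]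
    (hIht : (Fintype.card ι : ℕ∞) ≤ (Ideal.span (Set.range f)).height)
    {P : Ideal T} [P.IsPrime] (hIP : Ideal.span (Set.range f) ≤ P) {a b : T}
    (hb : b ∉ Ideal.span (Set.range f)) (hbP : b ∈ P)
    (ha : ∀ s, s ∈ P ↔ s * a ∈ Ideal.span (Set.range f) ⊔ Ideal.span {b}) :
    P.height ≤ Fintype.card ι + 1 := by
  classical
  set I := Ideal.span (Set.range f) with hIdef
  set A := Localization.AtPrime P
  have hdisj : Disjoint (P.primeCompl : Set T) (I : Set T) :=
    Set.disjoint_left.mpr fun x hx hxI => hx (hIP hxI)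
  let fs : List A := Finset.univ.toList.map fun j => algebraMap T A (f j)
  have hfs : Ideal.ofList fs = I.map (algebraMap T A) := by
    rw [Ideal.map_span]
    refine congrArg Ideal.span (Set.ext fun x => ?_)
    simp [fs]
  have hlen : fs.length = Fintype.card ι := by simp [fs]
  have hreg : IsRegularLocalRing A := inferInstance
  have hhA : ringKrullDim A = P.height := IsLocalization.AtPrime.ringKrullDim_eq_height P A
  have hfin : P.height ≠ ⊤ := Ideal.height_ne_top (Ideal.IsPrime.ne_top inferInstance)
  obtain ⟨d, hd⟩ := ENat.ne_top_iff_exists.mp hfin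
  have hcd : Fintype.card ι ≤ d := by
    have := hIht.trans (Ideal.height_mono hIP)
    rw [← hd] at this
    exact_mod_cast this
  obtain ⟨e, rfl⟩ := Nat.exists_eq_add_of_le hcd
  have hdA : ringKrullDim A = (Fintype.card ι + e : ℕ) := by rw [hhA, ← hd]; rfl
  have hprime : (I.map (algebraMap T A)).IsPrime :=
    IsLocalization.isPrime_of_isPrime_disjoint P.primeCompl A I hI hdisj
  have hht : (Fintype.card ι : ℕ∞) ≤ (I.map (algebraMap T A)).height := by
    rwa [IsLocalization.height_map_of_disjoint P.primeCompl I hdisj]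
  have hmem (J : Ideal T) (x : T) : algebraMap T A x ∈ J.map (algebraMap T A) ↔
      ∃ s ∈ P.primeCompl, s * x ∈ J :=
    IsLocalization.algebraMap_mem_map_algebraMap_iff P.primeCompl A J x
  have hbI : algebraMap T A b ∉ I.map (algebraMap T A) := by
    rw [hmem]
    rintro ⟨s, hs, hsb⟩
    exact (hI.mem_or_mem hsb).elim (fun h => hs (hIP h)) hb
  have hsup : Ideal.ofList fs ⊔ Ideal.span {algebraMap T A b} =
      (I ⊔ Ideal.span {b}).map (algebraMap T A) := by
    rw [hfs, Ideal.map_sup, Ideal.map_span _ {b}, Set.image_singleton]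
  have key : e ≤ 1 := by
    refine IsRegularLocalRing.le_length_add_one_of_isAssociatedPrime (A := A) hdA fs ?_
      (by rw [hlen, add_comm]) ?_ (b := algebraMap T A b) ?_ ?_ ?_
    · simp only [fs, List.mem_map]
      rintro _ ⟨j, -, rfl⟩
      exact (IsLocalization.AtPrime.to_map_mem_maximal_iff A P _).mpr
        (hIP (Ideal.subset_span ⟨j, rfl⟩))
    · rw [hfs]
      exact Ideal.ringKrullDim_quotient_add_height_le _ hht hdA
    · exact (IsLocalization.AtPrime.to_map_mem_maximal_iff A P _).mpr hbP
    · rw [hfs, isSMulRegular_iff_right_eq_zero_of_smul]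
      intro x hx
      obtain ⟨x, rfl⟩ := Ideal.Quotient.mk_surjective x
      change Ideal.Quotient.mk _ (algebraMap T A b * x) = 0 at hx
      rw [Ideal.Quotient.eq_zero_iff_mem] at hx
      exact Ideal.Quotient.eq_zero_iff_mem.mpr ((hprime.mem_or_mem hx).resolve_left hbI)
    · rw [hsup, isAssociatedPrime_iff]
      refine ⟨inferInstance, Ideal.Quotient.mk _ (algebraMap T A a), ?_⟩
      ext x
      obtain ⟨x, s, rfl⟩ := IsLocalization.exists_mk'_eq P.primeCompl x
      rw [Submodule.mem_colon_singleton, Submodule.mem_bot]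
      change _ ↔ Ideal.Quotient.mk _ (IsLocalization.mk' A x s * algebraMap T A a) = 0
      rw [Ideal.Quotient.eq_zero_iff_mem, ← IsLocalization.mk'_one (M := P.primeCompl) A a,
        ← IsLocalization.mk'_mul,
        IsLocalization.mk'_mem_map_algebraMap_iff,
        IsLocalization.AtPrime.mk'_mem_maximal_iff A P,
        ha]
      refine ⟨fun h => ⟨1, one_mem _, by rwa [one_mul]⟩, ?_⟩
      rintro ⟨t, ht, h⟩
      rw [← mul_assoc, ← ha] at h
      exact (ha x).mp ((Ideal.IsPrime.mem_or_mem inferInstance h).resolve_left ht)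
  rw [← hd]
  exact_mod_cast Nat.add_le_add_left key _

end AssociatedPrimes

section JetEquations

variable {k σ : Type*} [CommRing k] {m : ℕ}

theorem jetSub_X (i : σ) : jetSub k σ m (MvPolynomial.X i) =
    ∑ j : Fin (m + 1), Polynomial.C (MvPolynomial.X (i, j)) * Polynomial.X ^ (j : ℕ) :=
  MvPolynomial.aeval_X _ _

theorem jetSub_C (a : k) : jetSub k σ m (MvPolynomial.C a) = Polynomial.C (MvPolynomial.C a) :=
  (jetSub k σ m).commutes a

theorem coeff_jetSub_X (i : σ) (l : Fin (m + 1)) :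
    (jetSub k σ m (MvPolynomial.X i)).coeff l = MvPolynomial.X (i, l) := by
  rw [jetSub_X, Polynomial.finsetSum_coeff, Finset.sum_eq_single l]
  · simp
  · intro j _ hj
    rw [Polynomial.coeff_C_mul_X_pow, if_neg fun h => hj (Fin.ext h.symm)]
  · simp

theorem coeff_jetSub_X_of_lt (i : σ) {l : ℕ} (hl : m < l) :
    (jetSub k σ m (MvPolynomial.X i)).coeff l = 0 := by
  rw [jetSub_X, Polynomial.finsetSum_coeff]
  refine Finset.sum_eq_zero fun j _ => ?_
  rw [Polynomial.coeff_C_mul_X_pow, if_neg]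
  have := j.isLt
  omega

theorem coeff_zero_jetSub (f : MvPolynomial σ k) :
    (jetSub k σ m f).coeff 0 = MvPolynomial.rename (fun i => (i, (0 : Fin (m + 1)))) f := by
  induction f using MvPolynomial.induction_on with
  | C a => rw [jetSub_C, Polynomial.coeff_C_zero, MvPolynomial.rename_C]
  | add p q hp hq => rw [map_add, Polynomial.coeff_add, hp, hq, map_add]
  | mul_X p i hp =>
    rw [map_mul, Polynomial.mul_coeff_zero, hp, map_mul, MvPolynomial.rename_X]
    congr 1
    exact coeff_jetSub_X i 0

theorem coeff_one_jetSub [Fintype σ] (f : MvPolynomial σ k) :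
    (jetSub k σ (m + 1) f).coeff 1 = ∑ i, MvPolynomial.rename (fun i => (i, (0 : Fin (m + 2))))
      (MvPolynomial.pderiv i f) * MvPolynomial.X (i, 1) := by
  classical
  induction f using MvPolynomial.induction_on with
  | C a => simp
  | add p q hp hq =>
    rw [map_add, Polynomial.coeff_add, hp, hq, ← Finset.sum_add_distrib]
    simp only [map_add, add_mul]
  | mul_X p i hp =>
    have h1 := coeff_jetSub_X (k := k) (m := m + 1) i 1
    rw [Fin.val_one] at h1
    have h0 := coeff_jetSub_X (k := k) (m := m + 1) i 0
    rw [Fin.val_zero] at h0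
    rw [map_mul, Polynomial.mul_coeff_one, h1, h0, hp, coeff_zero_jetSub]
    simp only [Derivation.leibniz, map_add, add_mul, Finset.sum_add_distrib, smul_eq_mul, map_mul,
      MvPolynomial.rename_X]
    congr 1
    · rw [Finset.sum_eq_single i]
      · simp
      · intro j _ hj
        rw [MvPolynomial.pderiv_X_of_ne hj.symm]
        simp
      · simp
    · rw [Finset.sum_mul]
      exact Finset.sum_congr rfl fun j _ => by ring

theorem pderiv_coeff_jetSub (i : σ) (s : Fin (m + 1)) (f : MvPolynomial σ k) (l : ℕ) :
    MvPolynomial.pderiv (i, s) ((jetSub k σ m f).coeff l) =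
      (Polynomial.X ^ (s : ℕ) * jetSub k σ m (MvPolynomial.pderiv i f)).coeff l := by
  classical
  induction f using MvPolynomial.induction_on generalizing l with
  | C a =>
    rw [jetSub_C, Polynomial.coeff_C]
    split_ifs <;> simp
  | add p q hp hq => simp only [map_add, Polynomial.coeff_add, hp, hq, mul_add]
  | mul_X p i' hp =>
    have hX (l : ℕ) : MvPolynomial.pderiv (i, s) ((jetSub k σ m (MvPolynomial.X i')).coeff l) =
        (Polynomial.X ^ (s : ℕ) *
          jetSub k σ m (MvPolynomial.pderiv i (MvPolynomial.X i'))).coeff l := by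
      have h : Polynomial.X ^ (s : ℕ) * jetSub k σ m (MvPolynomial.pderiv i (MvPolynomial.X i')) =
          if i' = i then Polynomial.X ^ (s : ℕ) else 0 := by
        split_ifs with h
        · rw [h, MvPolynomial.pderiv_X_self, map_one, mul_one]
        · rw [MvPolynomial.pderiv_X_of_ne h, map_zero, mul_zero]
      rw [h]
      by_cases hl : m < l
      · rw [coeff_jetSub_X_of_lt i' hl, map_zero]
        split_ifs
        · rw [Polynomial.coeff_X_pow, if_neg]
          have := s.isLt
          omega
        · simp
      · obtain ⟨l, rfl⟩ : ∃ l' : Fin (m + 1), (l' : ℕ) = l := ⟨⟨l, by omega⟩, rfl⟩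
        rw [coeff_jetSub_X, MvPolynomial.pderiv_X, Pi.single_apply]
        split_ifs with h1 h2 h2 <;> simp_all [Polynomial.coeff_X_pow, Fin.ext_iff, eq_comm]
    rw [map_mul, Polynomial.coeff_mul, map_sum]
    simp only [Derivation.leibniz, hp, hX, Finset.sum_add_distrib, smul_eq_mul]
    rw [← Polynomial.coeff_mul, Finset.sum_congr rfl fun x _ => mul_comm _ _,
      ← Polynomial.coeff_mul, map_add, map_mul, map_mul, mul_add, Polynomial.coeff_add,
      mul_left_comm _ (jetSub k σ m p), mul_left_comm _ (jetSub k σ m (MvPolynomial.X i')),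
      mul_comm (jetSub k σ m (MvPolynomial.X i'))]

/-- The zero section of the jet scheme, sending a point to the constant jet at that point. -/
def constantJet (k σ : Type*) [CommRing k] (m : ℕ) :
    MvPolynomial (σ × Fin (m + 1)) k →ₐ[k] MvPolynomial σ k :=
  MvPolynomial.aeval fun p => if p.2 = 0 then MvPolynomial.X p.1 else 0

theorem constantJet_X (p : σ × Fin (m + 1)) : constantJet k σ m (MvPolynomial.X p) =
    if p.2 = 0 then MvPolynomial.X p.1 else 0 :=
  MvPolynomial.aeval_X _ _

theorem constantJet_rename (f : MvPolynomial σ k) :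
    constantJet k σ m (MvPolynomial.rename (fun i => (i, (0 : Fin (m + 1)))) f) = f := by
  rw [constantJet, MvPolynomial.aeval_rename]
  exact (MvPolynomial.aeval_unique (AlgHom.id k _) ▸ rfl : MvPolynomial.aeval MvPolynomial.X f = f)

theorem map_constantJet_jetSub (f : MvPolynomial σ k) :
    (jetSub k σ m f).map (constantJet k σ m : _ →+* _) = Polynomial.C f := by
  induction f using MvPolynomial.induction_on with
  | C a => rw [jetSub_C, Polynomial.map_C]; congr 1; exact (constantJet k σ m).commutes a
  | add p q hp hq => rw [map_add, Polynomial.map_add, hp, hq, map_add]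
  | mul_X p i hp =>
    rw [map_mul, Polynomial.map_mul, hp, map_mul]
    congr 1
    ext1 l
    rw [Polynomial.coeff_map, Polynomial.coeff_C]
    by_cases hl : m < l
    · rw [coeff_jetSub_X_of_lt i hl, map_zero, if_neg (by omega)]
    · obtain ⟨l, rfl⟩ : ∃ l' : Fin (m + 1), (l' : ℕ) = l := ⟨⟨l, by omega⟩, rfl⟩
      rw [coeff_jetSub_X]
      change constantJet k σ m _ = _
      rw [constantJet_X]
      simp only [← Fin.val_eq_zero_iff]

theorem constantJet_coeff_jetSub (f : MvPolynomial σ k) (l : ℕ) :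
    constantJet k σ m ((jetSub k σ m f).coeff l) = if l = 0 then f else 0 := by
  rw [← Polynomial.coeff_C, ← map_constantJet_jetSub, Polynomial.coeff_map]
  rfl

theorem coeff_jetSub_mem_jetIdeal {F : Set (MvPolynomial σ k)} {f : MvPolynomial σ k} (hf : f ∈ F)
    {l : ℕ} (hl : l ≤ m) : (jetSub k σ m f).coeff l ∈ jetIdeal k σ m F :=
  Ideal.subset_span ⟨f, hf, l, hl, rfl⟩

theorem constantJet_mem_of_mem_jetIdeal {F : Set (MvPolynomial σ k)}
    {g : MvPolynomial (σ × Fin (m + 1)) k} (hg : g ∈ jetIdeal k σ m F) :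
    constantJet k σ m g ∈ Ideal.span F := by
  have h : jetIdeal k σ m F ≤ (Ideal.span F).comap (constantJet k σ m) := by
    refine Ideal.span_le.mpr ?_
    rintro _ ⟨f, hf, l, -, rfl⟩
    change constantJet k σ m _ ∈ Ideal.span F
    rw [constantJet_coeff_jetSub]
    split_ifs
    · exact Ideal.subset_span hf
    · exact zero_mem _
  exact h hg

theorem comap_rename_radical_jetIdeal {F : Set (MvPolynomial σ k)} (hF : (Ideal.span F).IsPrime) :
    (jetIdeal k σ m F).radical.comap (MvPolynomial.rename fun i => (i, (0 : Fin (m + 1)))) =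
      Ideal.span F := by
  refine le_antisymm (fun g hg => ?_) (Ideal.span_le.mpr fun f hf => ?_)
  · obtain ⟨r, hr⟩ := hg
    have := constantJet_mem_of_mem_jetIdeal hr
    rw [← map_pow, constantJet_rename] at this
    exact hF.mem_of_pow_mem r this
  · refine Ideal.le_radical ?_
    change MvPolynomial.rename _ f ∈ _
    rw [← coeff_zero_jetSub]
    exact coeff_jetSub_mem_jetIdeal hf (Nat.zero_le m)

end JetEquations

/-- A prime of the jet scheme lying over a point where the Jacobian matrix has full rank has height
at least the number of equations of the jet scheme. -/
theorem card_mul_le_height_of_jetIdeal_le {k σ ι L : Type*} [Field k] [Finite σ] [Fintype ι]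
    {m : ℕ} (f : ι → MvPolynomial σ k) {q : Ideal (MvPolynomial (σ × Fin (m + 1)) k)} [q.IsPrime]
    (hq : jetIdeal k σ m (Set.range f) ≤ q) [Field L]
    (ρ : MvPolynomial (σ × Fin (m + 1)) k →+* L) (hρ : RingHom.ker ρ = q)
    (h : LinearIndependent L fun j i => ρ (MvPolynomial.rename (fun i => (i, (0 : Fin (m + 1))))
      (MvPolynomial.pderiv i (f j)))) :
    ((Fintype.card ι * (m + 1) : ℕ) : ℕ∞) ≤ q.height := by
  have hcard : Fintype.card (ι × Fin (m + 1)) = Fintype.card ι * (m + 1) := by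
    rw [Fintype.card_prod, Fintype.card_fin]
  rw [← hcard]
  refine card_le_height_of_derivation (R := k) ρ hρ (fun p : σ × Fin (m + 1) =>
    MvPolynomial.pderiv p) (fun p : ι × Fin (m + 1) => (jetSub k σ m (f p.1)).coeff p.2)
    (fun p => hq (coeff_jetSub_mem_jetIdeal (Set.mem_range_self p.1)
      (Nat.le_of_lt_succ p.2.isLt))) ?_
  rw [Fintype.linearIndependent_iff] at h ⊢
  intro c hc
  have hc' (i : σ) (s : Fin (m + 1)) : ∑ p : ι × Fin (m + 1), c p *
      ρ ((Polynomial.X ^ (s : ℕ) *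
        jetSub k σ m (MvPolynomial.pderiv i (f p.1))).coeff p.2) = 0 := by
    refine Eq.trans ?_ (congrFun hc (i, s))
    rw [Finset.sum_apply]
    refine Finset.sum_congr rfl fun p _ => ?_
    rw [← pderiv_coeff_jetSub]
    rfl
  suffices H : ∀ n : ℕ, ∀ p : ι × Fin (m + 1), m < p.2 + n → c p = 0 from
    fun p => H (m + 1) p (by omega)
  intro n
  induction n with
  | zero =>
    intro p hp
    have := p.2.isLt
    omega
  | succ n ih =>
    rintro ⟨j, s⟩ hs
    refine h (fun j => c (j, s)) ?_ j
    ext i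
    rw [Pi.zero_apply, ← hc' i s, Fintype.sum_prod_type, Finset.sum_apply]
    refine Finset.sum_congr rfl fun j _ => ?_
    rw [Finset.sum_eq_single s]
    · have := Polynomial.coeff_X_pow_mul (jetSub k σ m (MvPolynomial.pderiv i (f j))) s 0
      rw [zero_add] at this
      rw [this, coeff_zero_jetSub]
      rfl
    · intro t _ hts
      rcases lt_or_gt_of_ne hts with hlt | hlt
      · rw [Polynomial.coeff_X_pow_mul', if_neg (by rw [not_le]; exact hlt), map_zero, mul_zero]
      · rw [ih (j, t) ?_, zero_mul]
        have : (s : ℕ) < t := hlt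
        change m < (t : ℕ) + n
        have hs : m < (s : ℕ) + (n + 1) := hs
        omega
    · simp

/-- The height of a prime ideal of a polynomial ring lying over `P` is at most the height of `P`
plus the height of its fibre. -/
theorem MvPolynomial.height_comap_map_le {S κ τ : Type*} [CommRing S] [IsNoetherianRing S]
    [Finite τ] [Field κ] (P : Ideal S) [P.IsPrime] [Algebra (S ⧸ P) κ] [IsFractionRing (S ⧸ P) κ]
    (Q : Ideal (MvPolynomial τ κ)) [hQ : Q.IsPrime] :
    (Q.comap (MvPolynomial.map ((algebraMap (S ⧸ P) κ).comp (Ideal.Quotient.mk P)))).height ≤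
      P.height + Q.height := by
  set ρ := (algebraMap (S ⧸ P) κ).comp (Ideal.Quotient.mk P) with hρ
  have hinj : Function.Injective (algebraMap (S ⧸ P) κ) := IsFractionRing.injective _ _
  have hover : (Q.comap (MvPolynomial.map ρ)).LiesOver P := by
    refine ⟨le_antisymm (fun s hs => ?_) fun s hs => ?_⟩
    · change MvPolynomial.map ρ (MvPolynomial.C s) ∈ Q
      rw [MvPolynomial.map_C, hρ, RingHom.comp_apply, Ideal.Quotient.eq_zero_iff_mem.mpr hs,
        map_zero, map_zero]
      exact zero_mem _
    · change MvPolynomial.map ρ (MvPolynomial.C s) ∈ Q at hs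
      rw [MvPolynomial.map_C] at hs
      by_contra h
      have h1 : ρ s ≠ 0 := fun h0 => h <| Ideal.Quotient.eq_zero_iff_mem.mp <|
        hinj (h0.trans (map_zero _).symm)
      exact hQ.ne_top (Ideal.eq_top_of_isUnit_mem _ hs (h1.isUnit.map MvPolynomial.C))
  refine (Ideal.height_le_height_add_of_liesOver P _).trans (add_le_add_right (le_of_eq ?_) _)
  let g : MvPolynomial τ S →+* MvPolynomial τ (S ⧸ P) := MvPolynomial.map (Ideal.Quotient.mk P)
  have hg : Function.Surjective g := MvPolynomial.map_surjective _ Ideal.Quotient.mk_surjective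
  have hkg : P.map (algebraMap S (MvPolynomial τ S)) = RingHom.ker g := by
    rw [MvPolynomial.ker_map, Ideal.mk_ker]
    rfl
  let e : MvPolynomial τ S ⧸ P.map (algebraMap S (MvPolynomial τ S)) ≃+* MvPolynomial τ (S ⧸ P) :=
    (Ideal.quotEquivOfEq hkg).trans (RingHom.quotientKerEquivOfSurjective hg)
  let : Algebra (MvPolynomial τ (S ⧸ P)) (MvPolynomial τ κ) := MvPolynomial.algebraMvPolynomial
  have : IsLocalization (Submonoid.map MvPolynomial.C (nonZeroDivisors (S ⧸ P)))
    (MvPolynomial τ κ) := MvPolynomial.isLocalization _ κ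
  rw [← IsLocalization.height_under (R := MvPolynomial τ (S ⧸ P))
    (Submonoid.map MvPolynomial.C (nonZeroDivisors (S ⧸ P))) Q,
    ← RingEquiv.height_comap e (Q.under (MvPolynomial τ (S ⧸ P)))]
  have h1 : Q.comap (MvPolynomial.map ρ) =
      ((Q.under (MvPolynomial τ (S ⧸ P))).comap e).comap (Ideal.Quotient.mk _) := by
    change _ = Q.comap ((algebraMap (MvPolynomial τ (S ⧸ P)) (MvPolynomial τ κ)).comp g)
    congr 1
    exact MvPolynomial.ringHom_ext (by simp [hρ, g]) (by simp [g])
  rw [h1, Ideal.map_comap_of_surjective _ Ideal.Quotient.mk_surjective]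

/-- The coordinate ring of the jet scheme of affine space as a polynomial ring over the coordinate
ring of affine space. -/
def jetSplit (k σ : Type*) [CommRing k] (m : ℕ) :
    MvPolynomial (σ × Fin (m + 2)) k ≃ₐ[k] MvPolynomial (σ × Fin (m + 1)) (MvPolynomial σ k) :=
  (MvPolynomial.renameEquiv k
    ((Equiv.prodCongrRight fun _ =>
        (finSuccEquiv (m + 1)).trans (Equiv.optionEquivSumPUnit.{0} _)).trans
      ((Equiv.prodSumDistrib σ (Fin (m + 1)) PUnit.{1}).trans
        (Equiv.sumCongr (Equiv.refl _) (Equiv.prodPUnit σ))))).trans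
    (MvPolynomial.sumAlgEquiv k (σ × Fin (m + 1)) σ)

section JetSplit

variable {k σ : Type*} [CommRing k] {m : ℕ}

theorem jetSplit_X_zero (i : σ) :
    jetSplit k σ m (MvPolynomial.X (i, 0)) = MvPolynomial.C (MvPolynomial.X i) := by
  simp [jetSplit, MvPolynomial.sumAlgEquiv_X_inr]

theorem jetSplit_X_succ (i : σ) (l : Fin (m + 1)) :
    jetSplit k σ m (MvPolynomial.X (i, l.succ)) = MvPolynomial.X (i, l) := by
  simp [jetSplit, MvPolynomial.sumAlgEquiv_X_inl]

theorem jetSplit_rename (f : MvPolynomial σ k) :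
    jetSplit k σ m (MvPolynomial.rename (fun i => (i, 0)) f) = MvPolynomial.C f := by
  have : (jetSplit k σ m).toAlgHom.comp (MvPolynomial.rename fun i => (i, 0)) =
      IsScalarTower.toAlgHom k (MvPolynomial σ k) (MvPolynomial (σ × Fin (m + 1)) _) := by
    refine MvPolynomial.algHom_ext fun i => ?_
    simp [jetSplit_X_zero, MvPolynomial.algebraMap_eq]
  exact DFunLike.congr_fun this f

theorem constantCoeff_jetSplit (g : MvPolynomial (σ × Fin (m + 2)) k) :
    MvPolynomial.constantCoeff (jetSplit k σ m g) = constantJet k σ (m + 1) g := by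
  induction g using MvPolynomial.induction_on with
  | C a =>
    rw [← MvPolynomial.algebraMap_eq, AlgEquiv.commutes, AlgHom.commutes,
      IsScalarTower.algebraMap_apply k (MvPolynomial σ k), MvPolynomial.algebraMap_eq,
      MvPolynomial.constantCoeff_C]
  | add p q hp hq => simp only [map_add, hp, hq]
  | mul_X p i hp =>
    obtain ⟨i, l⟩ := i
    rw [map_mul, map_mul, map_mul, hp]
    congr 1
    refine Fin.cases ?_ (fun l => ?_) l
    · rw [jetSplit_X_zero, MvPolynomial.constantCoeff_C, constantJet_X, if_pos rfl]
    · rw [jetSplit_X_succ, MvPolynomial.constantCoeff_X, constantJet_X, if_neg l.succ_ne_zero]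

/-- The ideal of the fibre of a jet scheme over a point where the Jacobian matrix is degenerate
is generated by fewer elements than the expected number. -/
theorem exists_map_jetIdeal_eq_span {κ ι : Type*} [Field κ] [Fintype ι] [Finite σ]
    (f : ι → MvPolynomial σ k) (ρ : MvPolynomial σ k →+* κ) (hf : ∀ j, ρ (f j) = 0)
    (h : ¬ LinearIndependent κ fun j i => ρ (MvPolynomial.pderiv i (f j))) :
    ∃ s : Finset (MvPolynomial (σ × Fin (m + 1)) κ),
      s.card + 1 ≤ Fintype.card ι * (m + 1) ∧
      (jetIdeal k σ (m + 1) (Set.range f)).map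
        ((MvPolynomial.map ρ).comp (jetSplit k σ m).toRingEquiv.toRingHom) =
          Ideal.span (s : Set (MvPolynomial (σ × Fin (m + 1)) κ)) := by
  classical
  have := Fintype.ofFinite σ
  set φ := (MvPolynomial.map (σ := σ × Fin (m + 1)) ρ).comp
    (jetSplit k σ m).toRingEquiv.toRingHom with hφ
  obtain ⟨g, hg, j₀, hj₀⟩ := Fintype.not_linearIndependent_iff.mp h
  let w : ι × Fin (m + 1) → MvPolynomial (σ × Fin (m + 1)) κ :=
    fun p => φ ((jetSub k σ (m + 1) (f p.1)).coeff (p.2.succ : Fin (m + 2)))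
  let s : Finset (ι × Fin (m + 1)) := Finset.univ.erase (j₀, 0)
  have hmem {p} (hp : p ≠ (j₀, 0)) : w p ∈ Ideal.span ((s.image w : Finset _) : Set _) :=
    Ideal.subset_span <| Finset.mem_coe.mpr <| Finset.mem_image_of_mem _ <|
      Finset.mem_erase.mpr ⟨hp, Finset.mem_univ _⟩
  have hφ0 (a : MvPolynomial σ k) :
      φ (MvPolynomial.rename (fun i => (i, 0)) a) = MvPolynomial.C (ρ a) := by
    change MvPolynomial.map ρ (jetSplit k σ m _) = _
    rw [jetSplit_rename, MvPolynomial.map_C]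
  have hw (j : ι) : w (j, 0) =
      ∑ i, MvPolynomial.C (ρ (MvPolynomial.pderiv i (f j))) * MvPolynomial.X (i, 0) := by
    change φ ((jetSub k σ (m + 1) (f j)).coeff 1) = _
    rw [coeff_one_jetSub, map_sum]
    refine Finset.sum_congr rfl fun i _ => ?_
    rw [map_mul, hφ0]
    congr 1
    change MvPolynomial.map ρ (jetSplit k σ m (MvPolynomial.X (i, Fin.succ 0))) = _
    rw [jetSplit_X_succ, MvPolynomial.map_X]
  have hdep : ∑ j, MvPolynomial.C (g j) * w (j, 0) = 0 := by
    simp only [hw, Finset.mul_sum]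
    rw [Finset.sum_comm]
    refine Finset.sum_eq_zero fun i _ => ?_
    simp only [← mul_assoc, ← map_mul]
    rw [← Finset.sum_mul, ← map_sum]
    have : ∑ j, g j * ρ (MvPolynomial.pderiv i (f j)) = 0 := by
      simpa using congrFun hg i
    rw [this, map_zero, zero_mul]
  refine ⟨s.image w, ?_, le_antisymm ?_ ?_⟩
  · refine (Nat.add_le_add_right Finset.card_image_le 1).trans ?_
    rw [Finset.card_erase_add_one (Finset.mem_univ _), Finset.card_univ, Fintype.card_prod,
      Fintype.card_fin]
  · rw [jetIdeal, Ideal.map_span, Ideal.span_le]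
    rintro _ ⟨_, ⟨_, ⟨j, rfl⟩, l, hl, rfl⟩, rfl⟩
    obtain - | l := l
    · rw [coeff_zero_jetSub, hφ0, hf, map_zero]
      exact zero_mem _
    · by_cases hjl : (j, (⟨l, by omega⟩ : Fin (m + 1))) = (j₀, 0)
      · obtain ⟨rfl, hl0⟩ := Prod.mk.inj hjl
        have hunit : IsUnit (MvPolynomial.C (σ := σ × Fin (m + 1)) (g j)) :=
          hj₀.isUnit.map _
        obtain rfl : l = 0 := by simpa using hl0
        change w (j, 0) ∈ _
        rw [← Finset.add_sum_erase _ _ (Finset.mem_univ j)] at hdep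
        rw [SetLike.mem_coe, ← Ideal.unit_mul_mem_iff_mem _ hunit, eq_neg_of_add_eq_zero_left hdep]
        refine neg_mem (sum_mem fun j' hj' => Ideal.mul_mem_left _ _ (hmem fun h => ?_))
        exact Finset.ne_of_mem_erase hj' (congrArg Prod.fst h)
      · change w (j, ⟨l, by omega⟩) ∈ Ideal.span _
        exact hmem hjl
  · rw [Ideal.span_le]
    intro x hx
    obtain ⟨p, -, rfl⟩ := Finset.mem_image.mp (Finset.mem_coe.mp hx)
    exact Ideal.mem_map_of_mem _ (coeff_jetSub_mem_jetIdeal (Set.mem_range_self _)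
      (Nat.le_of_lt_succ p.2.succ.isLt))

end JetSplit

/-- If a jet scheme of an integral complete intersection is irreducible, then the Jacobian matrix has
full rank at the points of codimension at most one. -/
theorem linearIndependent_pderiv_of_isPrime_radical_jetIdeal {k σ ι K κ : Type*} [Field k]
    [Finite σ] [Fintype ι] {m : ℕ} (f : ι → MvPolynomial σ k)
    (hI : (Ideal.span (Set.range f)).IsPrime)
    (hJ : (jetIdeal k σ (m + 1) (Set.range f)).radical.IsPrime)
    [Field K] (ρ₀ : MvPolynomial σ k →+* K) (hρ₀ : RingHom.ker ρ₀ = Ideal.span (Set.range f))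
    (h₀ : LinearIndependent K fun j i => ρ₀ (MvPolynomial.pderiv i (f j)))
    {P : Ideal (MvPolynomial σ k)} [hP : P.IsPrime] (hIP : Ideal.span (Set.range f) ≤ P)
    (hht : P.height ≤ Fintype.card ι + 1)
    [Field κ] (ρ : MvPolynomial σ k →+* κ) (hρ : RingHom.ker ρ = P) :
    LinearIndependent κ fun j i => ρ (MvPolynomial.pderiv i (f j)) := by
  have := Fintype.ofFinite σ
  suffices H : LinearIndependent (FractionRing (MvPolynomial σ k ⧸ P)) fun j i =>
      ((algebraMap (MvPolynomial σ k ⧸ P) (FractionRing (MvPolynomial σ k ⧸ P))).comp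
        (Ideal.Quotient.mk P)) (MvPolynomial.pderiv i (f j)) by
    refine LinearIndependent.of_ker_eq ?_ H
    rw [hρ, RingHom.ker_comp_of_injective _ (IsFractionRing.injective _ _), Ideal.mk_ker]
  set ρ' := (algebraMap (MvPolynomial σ k ⧸ P) (FractionRing (MvPolynomial σ k ⧸ P))).comp
        (Ideal.Quotient.mk P) with hρ'
  have hker : RingHom.ker ρ' = P := by
    rw [RingHom.ker_comp_of_injective _ (IsFractionRing.injective _ _), Ideal.mk_ker]
  by_contra hdep
  obtain ⟨s, hs, hspan⟩ := exists_map_jetIdeal_eq_span (m := m) f ρ' (fun j => by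
    rw [← RingHom.mem_ker, hker]; exact hIP (Ideal.subset_span (Set.mem_range_self j))) hdep
  have hne : Ideal.span (s : Set (MvPolynomial (σ × Fin (m + 1))
      (FractionRing (MvPolynomial σ k ⧸ P)))) ≠ ⊤ := by
    refine ne_top_of_le_ne_top (RingHom.ker_ne_top (MvPolynomial.constantCoeff
      (σ := σ × Fin (m + 1)) (R := FractionRing (MvPolynomial σ k ⧸ P)))) ?_
    rw [← hspan, Ideal.map_le_iff_le_comap]
    intro g hg
    rw [Ideal.mem_comap, RingHom.mem_ker, RingHom.comp_apply, MvPolynomial.constantCoeff_map]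
    have : constantJet k σ (m + 1) g ∈ P := hIP (constantJet_mem_of_mem_jetIdeal hg)
    rw [← hker, RingHom.mem_ker, ← constantCoeff_jetSplit] at this
    exact this
  obtain ⟨Q, hQ⟩ := Ideal.nonempty_minimalPrimes hne
  have := hQ.1.1
  have hQht := Ideal.height_le_card_of_mem_minimalPrimes_span_finset hQ
  set q := (jetIdeal k σ (m + 1) (Set.range f)).radical with hq
  let e : MvPolynomial (σ × Fin (m + 2)) k ≃+* MvPolynomial (σ × Fin (m + 1)) (MvPolynomial σ k) :=
    jetSplit k σ m
  let Q' := (Q.comap (MvPolynomial.map ρ')).comap e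
  have hQ' : Q'.IsPrime := inferInstance
  have hQ'ht : Q'.height ≤ P.height + Q.height := by
    rw [RingEquiv.height_comap]
    exact MvPolynomial.height_comap_map_le P Q
  have hqQ : q ≤ Q' := by
    rw [hq, hQ'.radical_le_iff]
    change _ ≤ (Q.comap (MvPolynomial.map ρ')).comap (jetSplit k σ m).toRingEquiv.toRingHom
    rw [Ideal.comap_comap, ← Ideal.map_le_iff_le_comap, hspan]
    exact hQ.1.2
  let r : MvPolynomial σ k →+* MvPolynomial (σ × Fin (m + 2)) k :=
    (MvPolynomial.rename (R := k) fun i : σ => (i, (0 : Fin (m + 2)))).toRingHom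
  have hqr : q.comap r = Ideal.span (Set.range f) := comap_rename_radical_jetIdeal hI
  have hne : q ≠ Q' := by
    intro h
    refine hdep (LinearIndependent.of_ker_eq ?_ h₀)
    rw [hρ₀, hker]
    refine le_antisymm hIP fun a ha => ?_
    rw [← hqr, h]
    change MvPolynomial.map ρ' (jetSplit k σ m (MvPolynomial.rename _ a)) ∈ Q
    have ha' : ρ' a = 0 := by rwa [← RingHom.mem_ker, hker]
    rw [jetSplit_rename, MvPolynomial.map_C, ha', map_zero]
    exact zero_mem _
  have hlt := Ideal.height_add_one_le_of_lt_of_isPrime (lt_of_le_of_ne hqQ hne)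
  let ρq := (algebraMap (MvPolynomial (σ × Fin (m + 2)) k ⧸ q)
    (FractionRing (MvPolynomial (σ × Fin (m + 2)) k ⧸ q))).comp (Ideal.Quotient.mk q)
  have hρq : RingHom.ker ρq = q := by
    rw [RingHom.ker_comp_of_injective _ (IsFractionRing.injective _ _), Ideal.mk_ker]
  have hqht := card_mul_le_height_of_jetIdeal_le f Ideal.le_radical ρq hρq
    (LinearIndependent.of_ker_eq (ρ' := ρq.comp r)
      (by rw [hρ₀, ← RingHom.comap_ker, hρq, hqr]) h₀)
  have h1 : ((Fintype.card ι * (m + 2) : ℕ) : ℕ∞) + 1 ≤ Fintype.card ι + 1 + s.card :=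
    (add_le_add_left hqht 1).trans <| hlt.trans <| hQ'ht.trans (add_le_add hht hQht)
  have h2 : Fintype.card ι * (m + 2) + 1 ≤ Fintype.card ι + 1 + s.card := by exact_mod_cast h1
  have : Fintype.card ι * (m + 2) = Fintype.card ι * (m + 1) + Fintype.card ι := by ring
  omega

/-- A Noetherian domain is integrally closed if its localizations at the associated primes of
principal ideals have principal maximal ideals. -/
theorem IsIntegrallyClosed.of_isPrincipal_maximalIdeal {R : Type*} [CommRing R]
    [IsNoetherianRing R] [IsDomain R]
    (h : ∀ (P : Ideal R) [P.IsPrime] (a b : R), b ≠ 0 → b ∈ P →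
      (∀ s, s ∈ P ↔ s * a ∈ Ideal.span {b}) →
      (IsLocalRing.maximalIdeal (Localization.AtPrime P)).IsPrincipal) :
    IsIntegrallyClosed R := by
  refine (isIntegrallyClosed_iff (FractionRing R)).mpr fun {x} hx => ?_
  obtain ⟨a, b, hb, rfl⟩ := IsFractionRing.div_surjective (A := R) x
  have hb0 : b ≠ 0 := nonZeroDivisors.ne_zero hb
  have hbK : algebraMap R (FractionRing R) b ≠ 0 := by
    simpa using hb0
  by_contra hab
  have hab' : Ideal.Quotient.mk (Ideal.span {b}) a ≠ 0 := by
    rw [Ne, Ideal.Quotient.eq_zero_iff_mem, Ideal.mem_span_singleton']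
    rintro ⟨c, rfl⟩
    exact hab ⟨c, by rw [map_mul, mul_div_cancel_right₀ _ hbK]⟩
  obtain ⟨P, hP, hPle⟩ := exists_le_isAssociatedPrime_of_isNoetherianRing R _ hab'
  obtain ⟨hPp, a', ha'⟩ := isAssociatedPrime_iff.mp hP
  obtain ⟨a', rfl⟩ := Ideal.Quotient.mk_surjective a'
  have hmem (s c : R) : s ∈ (⊥ : Submodule R (R ⧸ Ideal.span {b})).colon
      {Ideal.Quotient.mk (Ideal.span {b}) c} ↔ s * c ∈ Ideal.span {b} := by
    rw [Submodule.mem_colon_singleton, Submodule.mem_bot, ← Ideal.Quotient.eq_zero_iff_mem,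
      map_mul]
    rfl
  have hprin := h P a' b hb0
    (hPle ((hmem b a).mpr (Ideal.mul_mem_right _ _ (Ideal.mem_span_singleton_self b))))
    fun s => by rw [ha', hmem]
  have : IsPrincipalIdealRing (Localization.AtPrime P) :=
    ((tfae_of_isNoetherianRing_of_isLocalRing_of_isDomain (Localization.AtPrime P)).out 4 0).mp
      hprin
  have hclosed : IsIntegrallyClosed (Localization.AtPrime P) := inferInstance
  obtain ⟨y, hy⟩ := (isIntegrallyClosed_iff (FractionRing R)).mp hclosed
    (hx.tower_top (A := Localization.AtPrime P))
  obtain ⟨r, s, rfl⟩ := IsLocalization.exists_mk'_eq P.primeCompl y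
  have h1 := congrArg (algebraMap (Localization.AtPrime P) (FractionRing R))
    (IsLocalization.mk'_spec (Localization.AtPrime P) r s)
  rw [map_mul, hy, ← IsScalarTower.algebraMap_apply, ← IsScalarTower.algebraMap_apply,
    div_mul_eq_mul_div, div_eq_iff hbK, ← map_mul, ← map_mul] at h1
  have h2 := IsFractionRing.injective R (FractionRing R) h1
  refine s.2 (hPle ((hmem _ _).mpr ?_))
  rw [mul_comm, h2]
  exact Ideal.mul_mem_left _ _ (Ideal.mem_span_singleton_self b)

/-- If the maximal ideal of the localization of `T` is generated by `I` and one more element, then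
the maximal ideal of the localization of `T ⧸ I` is principal. -/
theorem IsLocalRing.isPrincipal_maximalIdeal_localization_quotient {T : Type*} [CommRing T]
    {I : Ideal T} (P : Ideal (T ⧸ I)) [P.IsPrime]
    (z : Localization.AtPrime (P.comap (Ideal.Quotient.mk I)))
    (hz : IsLocalRing.maximalIdeal (Localization.AtPrime (P.comap (Ideal.Quotient.mk I))) =
      I.map (algebraMap T _) ⊔ Ideal.span {z}) :
    (IsLocalRing.maximalIdeal (Localization.AtPrime P)).IsPrincipal := by
  let φ := Localization.localRingHom _ P (Ideal.Quotient.mk I) rfl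
  have hφ : φ.comp (algebraMap T _) = (algebraMap _ _).comp (Ideal.Quotient.mk I) :=
    RingHom.ext fun x => Localization.localRingHom_to_map _ P _ rfl x
  refine ⟨φ z, ?_⟩
  have h1 := congrArg (Ideal.map φ) hz
  rw [← Localization.AtPrime.map_eq_maximalIdeal, Ideal.map_sup, Ideal.map_map, Ideal.map_map, hφ,
    ← Ideal.map_map, ← Ideal.map_map, Ideal.map_quotient_self, Ideal.map_bot, bot_sup_eq,
    Ideal.map_comap_of_surjective _ Ideal.Quotient.mk_surjective,
    Localization.AtPrime.map_eq_maximalIdeal, Ideal.map_span, Set.image_singleton] at h1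
  exact h1

/- STATEMENT 6: If `X` is an l.c.i. variety (cut out in `𝔸^N` by `N - n` equations) over an
algebraically closed field and `X_m` is irreducible for some `m ≥ 1`, then `X` is normal,
i.e. its (domain) coordinate ring is integrally closed. -/
theorem stmt6 (k : Type*) [Field k] [IsAlgClosed k] (N n : ℕ) (hn : n ≤ N)
    (F : Fin (N - n) → MvPolynomial (Fin N) k)
    (hdom : IsDomain (MvPolynomial (Fin N) k ⧸ Ideal.span (Set.range F)))
    (hdim : ringKrullDim (MvPolynomial (Fin N) k ⧸ Ideal.span (Set.range F)) = n)
    (m : ℕ) (hm : 1 ≤ m)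
    (hirr : (jetIdeal k (Fin N) m (Set.range F)).radical.IsPrime) :
    IsIntegrallyClosed (MvPolynomial (Fin N) k ⧸ Ideal.span (Set.range F)) := by
  obtain ⟨m, rfl⟩ := Nat.exists_eq_add_of_le' hm
  have hI : (Ideal.span (Set.range F)).IsPrime := (Ideal.Quotient.isDomain_iff_prime _).mp hdom
  set I := Ideal.span (Set.range F) with hIdef
  set R := MvPolynomial (Fin N) k ⧸ I
  have hker : RingHom.ker (algebraMap (MvPolynomial (Fin N) k) R) = I := Ideal.mk_ker
  have hind := linearIndependent_pderiv_of_ringKrullDim_le F (R := R) (K := FractionRing R)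
    Ideal.Quotient.mk_surjective hker (n := n) (by simp; omega) hdim.le
  have hker' : RingHom.ker ((algebraMap R (FractionRing R)).comp
      (algebraMap (MvPolynomial (Fin N) k) R)) = I := by
    rw [RingHom.ker_comp_of_injective _ (IsFractionRing.injective _ _), hker]
  have hF (j) : F j ∈ I := Ideal.subset_span (Set.mem_range_self j)
  have hht := card_le_height_of_derivation (R := k) _ hker' (fun i => MvPolynomial.pderiv i) F hF
    hind
  refine IsIntegrallyClosed.of_isPrincipal_maximalIdeal fun P hP a b hb hbP hab => ?_
  obtain ⟨a, rfl⟩ := Ideal.Quotient.mk_surjective a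
  obtain ⟨b, rfl⟩ := Ideal.Quotient.mk_surjective b
  set P' := P.comap (Ideal.Quotient.mk I) with hP'
  have hIP : I ≤ P' := fun x hx => by
    rw [hP', Ideal.mem_comap, Ideal.Quotient.eq_zero_iff_mem.mpr hx]
    exact zero_mem _
  have hPht : P'.height ≤ Fintype.card (Fin (N - n)) + 1 := by
    refine Ideal.height_le_card_add_one_of_eq_colon F (a := a) (b := b) hht hIP
      (fun h => hb (Ideal.Quotient.eq_zero_iff_mem.mpr h)) hbP fun s => ?_
    rw [hP', Ideal.mem_comap, hab, ← map_mul, ← Set.image_singleton, ← Ideal.map_span,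
      ← Ideal.mem_comap, Ideal.comap_map_of_surjective _ Ideal.Quotient.mk_surjective,
      ← RingHom.ker_eq_comap_bot, Ideal.mk_ker, sup_comm]
  let ρ := (algebraMap (MvPolynomial (Fin N) k ⧸ P')
    (FractionRing (MvPolynomial (Fin N) k ⧸ P'))).comp (Ideal.Quotient.mk P')
  have hρ : RingHom.ker ρ = P' := by
    rw [RingHom.ker_comp_of_injective _ (IsFractionRing.injective _ _), Ideal.mk_ker]
  obtain ⟨z, hz⟩ := exists_maximalIdeal_eq_span_sup_of_derivation (R := k) ρ hρ
    (fun i => MvPolynomial.pderiv i) F (fun j => hIP (hF j))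
    (linearIndependent_pderiv_of_isPrime_radical_jetIdeal F hI hirr _ hker' hind hIP hPht ρ hρ) hPht
  exact IsLocalRing.isPrincipal_maximalIdeal_localization_quotient P z hz
end
end

section
/- An integral curve X over an algebraically closed field is nonsingular if and only if X_m is irreducible for some (equivalently, every) m ≥ 1. -/
noncomputable section

section Jets

open Polynomial

variable {k : Type*} [CommRing k] {σ : Type*} {m : ℕ}

/-- The ring `R[t]/(t^(m+1))`. -/
abbrev TruncPoly (R : Type*) [CommRing R] (m : ℕ) : Type _ :=
  R[X] ⧸ Ideal.span {(X : R[X]) ^ (m + 1)}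

lemma TruncPoly.mk_eq_mk_iff {R : Type*} [CommRing R] {p q : R[X]} :
    (Ideal.Quotient.mk (Ideal.span {(X : R[X]) ^ (m + 1)}) p = Ideal.Quotient.mk _ q) ↔
      ∀ j ≤ m, p.coeff j = q.coeff j := by
  rw [Ideal.Quotient.eq, Ideal.mem_span_singleton, X_pow_dvd_iff]
  simp only [Nat.lt_succ_iff, coeff_sub, sub_eq_zero]

/-- The homomorphism to `R[t]/(t^(m+1))` corresponding to an `R`-point of the jet scheme of
affine space. -/
def jetHom {R : Type*} [CommRing R] [Algebra k R]
    (ψ : MvPolynomial (σ × Fin (m + 1)) k →ₐ[k] R) : MvPolynomial σ k →ₐ[k] TruncPoly R m :=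
  (Ideal.Quotient.mkₐ k _).comp ((Polynomial.mapAlgHom ψ).comp (jetSub k σ m))

variable {R : Type*} [CommRing R] [Algebra k R]

lemma jetHom_apply (ψ : MvPolynomial (σ × Fin (m + 1)) k →ₐ[k] R) (f : MvPolynomial σ k) :
    jetHom ψ f = Ideal.Quotient.mk _ ((jetSub k σ m f).map (ψ : _ →+* R)) := rfl

lemma jetHom_eq_mk_iff (ψ : MvPolynomial (σ × Fin (m + 1)) k →ₐ[k] R) (f : MvPolynomial σ k)
    (q : R[X]) :
    jetHom ψ f = Ideal.Quotient.mk _ q ↔ ∀ j ≤ m, ψ ((jetSub k σ m f).coeff j) = q.coeff j := by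
  rw [jetHom_apply, TruncPoly.mk_eq_mk_iff]
  simp

lemma jetSub_X_coeff (i : σ) (j : Fin (m + 1)) :
    (jetSub k σ m (MvPolynomial.X i)).coeff j = MvPolynomial.X (i, j) := by
  simp only [jetSub, MvPolynomial.aeval_X, finsetSum_coeff, coeff_C_mul, coeff_X_pow]
  simp [Fin.val_inj]

lemma jetSub_coeff_zero (f : MvPolynomial σ k) :
    (jetSub k σ m f).coeff 0 = MvPolynomial.rename (fun i => (i, 0)) f := by
  have : ((Polynomial.aeval (0 : MvPolynomial (σ × Fin (m + 1)) k)).restrictScalars k).comp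
      (jetSub k σ m) = MvPolynomial.rename (fun i => (i, (0 : Fin (m + 1)))) := by
    ext i : 1
    have := jetSub_X_coeff (k := k) i (0 : Fin (m + 1))
    simpa [Polynomial.coeff_zero_eq_eval_zero] using this
  rw [← this]
  simp [Polynomial.coeff_zero_eq_eval_zero]

lemma jetHom_injective {ψ ψ' : MvPolynomial (σ × Fin (m + 1)) k →ₐ[k] R}
    (h : jetHom ψ = jetHom ψ') : ψ = ψ' := by
  ext ⟨i, j⟩
  have h1 := (jetHom_eq_mk_iff ψ (MvPolynomial.X i) _).mp
    ((DFunLike.congr_fun h (MvPolynomial.X i)).trans (jetHom_apply _ _)) j (by omega)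
  simpa [jetSub_X_coeff] using h1

lemma exists_jetHom_eq (φ : MvPolynomial σ k →ₐ[k] TruncPoly R m) :
    ∃ ψ : MvPolynomial (σ × Fin (m + 1)) k →ₐ[k] R, jetHom ψ = φ := by
  choose q hq using fun i => Ideal.Quotient.mk_surjective (φ (MvPolynomial.X i))
  refine ⟨MvPolynomial.aeval fun ij => (q ij.1).coeff ij.2, ?_⟩
  ext i
  rw [← hq, jetHom_eq_mk_iff]
  intro j hj
  have := jetSub_X_coeff (k := k) i (⟨j, by omega⟩ : Fin (m + 1))
  simp only at this
  rw [this]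
  simp

lemma jetIdeal_le_ker_iff (F : Set (MvPolynomial σ k))
    (ψ : MvPolynomial (σ × Fin (m + 1)) k →ₐ[k] R) :
    jetIdeal k σ m F ≤ RingHom.ker ψ ↔ Ideal.span F ≤ RingHom.ker (jetHom ψ) := by
  rw [jetIdeal, Ideal.span_le, Ideal.span_le]
  have h (f) : jetHom ψ f = 0 ↔ ∀ j ≤ m, ψ ((jetSub k σ m f).coeff j) = 0 := by
    simpa using jetHom_eq_mk_iff ψ f 0
  constructor
  · intro H f hf
    exact (h f).mpr fun j hj => H ⟨f, hf, j, hj, rfl⟩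
  · rintro H _ ⟨f, hf, j, hj, rfl⟩
    exact (h f).mp (H hf) j hj

/-- Base change of truncated polynomial rings. -/
def TruncPoly.map {R' : Type*} [CommRing R'] [Algebra k R'] (m : ℕ) (g : R →ₐ[k] R') :
    TruncPoly R m →ₐ[k] TruncPoly R' m :=
  Ideal.Quotient.liftₐ _ ((Ideal.Quotient.mkₐ k _).comp (Polynomial.mapAlgHom g)) <| by
    intro a ha
    obtain ⟨b, rfl⟩ := Ideal.mem_span_singleton.mp ha
    simp only [AlgHom.coe_comp, Function.comp_apply, Ideal.Quotient.mkₐ_eq_mk]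
    rw [Ideal.Quotient.eq_zero_iff_mem]
    exact Ideal.mem_span_singleton.mpr ⟨mapAlgHom g b, by simp⟩

lemma TruncPoly.map_mk {R' : Type*} [CommRing R'] [Algebra k R'] (g : R →ₐ[k] R') (p : R[X]) :
    TruncPoly.map m g (Ideal.Quotient.mk _ p) = Ideal.Quotient.mk _ (p.map (g : R →+* R')) := rfl

lemma jetHom_comp {R' : Type*} [CommRing R'] [Algebra k R'] (g : R →ₐ[k] R')
    (ψ : MvPolynomial (σ × Fin (m + 1)) k →ₐ[k] R) :
    jetHom (g.comp ψ) = (TruncPoly.map m g).comp (jetHom ψ) := by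
  ext f
  rw [AlgHom.comp_apply, jetHom_apply ψ, TruncPoly.map_mk, jetHom_apply, Polynomial.map_map]
  rfl

end Jets

lemma IsAlgClosed.exists_algebraMap_eq_of_isAlgebraic {k A : Type*} [Field k] [IsAlgClosed k]
    [CommRing A] [IsDomain A] [Algebra k A] {y : A} (hy : IsAlgebraic k y) :
    ∃ e : k, algebraMap k A e = y := by
  have hi := hy.isIntegral
  have h : (minpoly k y).degree = 1 :=
    IsAlgClosed.degree_eq_one_of_irreducible k (minpoly.irreducible hi)
  have h0 := minpoly.aeval k y
  have hq : (minpoly k y).leadingCoeff = 1 := minpoly.monic hi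
  rw [Polynomial.eq_X_add_C_of_degree_eq_one h, hq] at h0
  refine ⟨-(minpoly k y).coeff 0, ?_⟩
  simp only [map_one, one_mul, map_add, Polynomial.aeval_X, Polynomial.aeval_C] at h0
  rw [map_neg]
  linear_combination -h0

lemma Ideal.eq_bot_of_le_sq_of_ne_top {A : Type*} [CommRing A] [IsDomain A] [IsNoetherianRing A]
    {M : Ideal A} (hM : M ≠ ⊤) (h : M ≤ M ^ 2) : M = ⊥ := by
  obtain ⟨r, hr1, hr⟩ := Submodule.exists_sub_one_mem_and_smul_eq_zero_of_fg_of_le_smul M M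
    (IsNoetherian.noetherian M) (by rwa [smul_eq_mul, ← pow_two])
  by_contra hbot
  obtain ⟨a, ha, ha0⟩ := Submodule.exists_mem_ne_zero_of_ne_bot hbot
  have hr0 : r = 0 := (mul_eq_zero.mp (hr a ha)).resolve_right ha0
  subst hr0
  exact hM ((Ideal.eq_top_iff_one M).mpr (by simpa using M.neg_mem hr1))

open Algebra in
/-- A one-generator criterion for smoothness of an algebra over an algebraically closed field. -/
lemma Algebra.smooth_of_forall_isMaximal_exists_sub_mem_sq {k A : Type*} [Field k]
    [IsAlgClosed k] [CommRing A] [IsDomain A] [Algebra k A] [Algebra.FiniteType k A]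
    (hA : ¬ IsField A)
    (H : ∀ M : Ideal A, M.IsMaximal →
      ∃ y : A, ∀ a, ∃ c d : k, a - algebraMap k A c - d • y ∈ M ^ 2) :
    Algebra.Smooth k A := by
  have hN : IsNoetherianRing A := Algebra.FiniteType.isNoetherianRing k A
  have hP : Algebra.FinitePresentation k A :=
    Algebra.FinitePresentation.of_finiteType.mp inferInstance
  refine ⟨?_, hP⟩
  rw [← smoothLocus_eq_univ_iff]
  suffices h : ∀ M : Ideal A, ∀ hM : M.IsMaximal, (⟨M, hM.isPrime⟩ : PrimeSpectrum A) ∈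
      smoothLocus k A by
    have ho : IsOpen (smoothLocus k A) := isOpen_smoothLocus
    rw [Set.eq_univ_iff_forall]
    intro p
    obtain ⟨M, hM, hpM⟩ := Ideal.exists_le_maximal p.asIdeal p.2.ne_top
    exact ((PrimeSpectrum.le_iff_specializes p ⟨M, hM.isPrime⟩).mp hpM).mem_open ho (h M hM)
  intro M hM
  obtain ⟨y, hy⟩ := H M hM
  have hMbot : M ≠ ⊥ := Ring.ne_bot_of_isMaximal_of_not_isField hM hA
  have hyt : Transcendental k y := by
    intro hy'
    obtain ⟨e, he⟩ := IsAlgClosed.exists_algebraMap_eq_of_isAlgebraic hy'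
    refine hMbot (Ideal.eq_bot_of_le_sq_of_ne_top hM.ne_top fun a ha => ?_)
    obtain ⟨c, d, hcd⟩ := hy a
    have h1 : a - algebraMap k A c - d • y = a - algebraMap k A (c + d * e) := by
      rw [← he, Algebra.smul_def, map_add, map_mul]; ring
    rw [h1] at hcd
    have h2 : algebraMap k A (c + d * e) ∈ M := by
      have := M.sub_mem ha (Ideal.pow_le_self two_ne_zero hcd)
      rwa [sub_sub_cancel] at this
    by_cases h3 : c + d * e = 0
    · simpa [h3] using hcd
    · exact absurd (Ideal.eq_top_of_isUnit_mem _ h2 ((IsUnit.mk0 _ h3).map _)) hM.ne_top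
  let : Algebra (Polynomial k) A := (Polynomial.aeval y : Polynomial k →ₐ[k] A).toAlgebra
  have hmap (p : Polynomial k) : algebraMap (Polynomial k) A p = Polynomial.aeval y p := rfl
  have : IsScalarTower k (Polynomial k) A := .of_algebraMap_eq fun c => by
    change _ = Polynomial.aeval y (Polynomial.C c); simp
  have : Module.IsTorsionFree (Polynomial k) A :=
    Module.isTorsionFree_iff_algebraMap_injective.mpr (transcendental_iff_injective.mp hyt)
  have : Module.Flat (Polynomial k) A := inferInstance
  have : Algebra.FiniteType (Polynomial k) A := .of_restrictScalars_finiteType k _ _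
  have : Algebra.FinitePresentation (Polynomial k) A :=
    Algebra.FinitePresentation.of_finiteType.mp inferInstance
  have hD (a : A) : KaehlerDifferential.D (Polynomial k) A a ∈
      M • (⊤ : Submodule A (Ω[A⁄Polynomial k])) := by
    obtain ⟨c, d, hcd⟩ := hy a
    have key : ∀ s ∈ M ^ 2, KaehlerDifferential.D (Polynomial k) A s ∈
        M • (⊤ : Submodule A (Ω[A⁄Polynomial k])) := by
      intro s hs
      rw [pow_two] at hs
      refine Submodule.mul_induction_on hs (fun u hu v hv => ?_) fun u v hu hv => ?_
      · rw [Derivation.leibniz]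
        exact add_mem (Submodule.smul_mem_smul hu trivial) (Submodule.smul_mem_smul hv trivial)
      · rw [map_add]
        exact add_mem hu hv
    have h := key _ hcd
    have h1 : algebraMap k A c + d • y =
        algebraMap (Polynomial k) A (Polynomial.C c + Polynomial.C d * Polynomial.X) := by
      rw [hmap]; simp [Algebra.smul_def]
    rwa [sub_sub, h1, map_sub, Derivation.map_algebraMap, sub_zero] at h
  have htop : (⊤ : Submodule A (Ω[A⁄Polynomial k])) ≤ M • ⊤ := by
    rw [← KaehlerDifferential.span_range_derivation, Submodule.span_le]
    rintro _ ⟨a, rfl⟩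
    rw [KaehlerDifferential.span_range_derivation]
    exact hD a
  have hu : IsUnramifiedAt (Polynomial k) M := by
    change (⟨M, hM.isPrime⟩ : PrimeSpectrum A) ∈ unramifiedLocus (Polynomial k) A
    rw [unramifiedLocus_eq_compl_support, Set.mem_compl_iff, Module.support_eq_zeroLocus]
    obtain ⟨r, hr1, hr⟩ := Submodule.exists_sub_one_mem_and_smul_eq_zero_of_fg_of_le_smul M _
      Module.Finite.fg_top htop
    intro hmem
    have hrM : r ∈ M := hmem (Module.mem_annihilator.mpr fun n => hr n trivial)
    exact hM.ne_top ((Ideal.eq_top_iff_one M).mpr (by simpa using M.sub_mem hrM hr1))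
  have := IsEtaleAt.of_isUnramifiedAt_of_flat (R := Polynomial k) M
  change FormallySmooth k (Localization.AtPrime M)
  exact FormallySmooth.comp k (Polynomial k) _

section Jets

open Polynomial

lemma pow_le_ker_jetHom {k σ R : Type*} [CommRing k] [CommRing R] [Algebra k R] {m : ℕ}
    {I : Ideal (MvPolynomial σ k)} (ψ : MvPolynomial (σ × Fin (m + 1)) k →ₐ[k] R)
    (hψ : ∀ f ∈ I, ψ ((jetSub k σ m f).coeff 0) = 0) :
    I ^ (m + 1) ≤ RingHom.ker (jetHom ψ) := by
  have h1 : I ≤ (Ideal.span {(X : R[X])}).comap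
      ((Polynomial.mapAlgHom ψ).comp (jetSub k σ m)) := by
    intro f hf
    rw [Ideal.mem_comap, Ideal.mem_span_singleton, X_dvd_iff]
    simpa using hψ f hf
  intro f hf
  have h2 := (Ideal.le_comap_pow _ _) (Ideal.pow_right_mono h1 (m + 1) hf)
  rw [Ideal.mem_comap, Ideal.span_singleton_pow] at h2
  exact Ideal.Quotient.eq_zero_iff_mem.mpr h2

lemma Algebra.FormallySmooth.exists_section_quotient_pow {k P A : Type*} [CommRing k]
    [CommRing P] [Algebra k P] [CommRing A] [Algebra k A] [Algebra.FormallySmooth k A]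
    (π : P →ₐ[k] A) (hπ : Function.Surjective π) (n : ℕ) :
    ∃ s : A →ₐ[k] P ⧸ (RingHom.ker π) ^ (n + 1),
      ∀ a g, s a = Ideal.Quotient.mk _ g → π g = a := by
  let fac : (P ⧸ (RingHom.ker π) ^ (n + 1)) →ₐ[k] A :=
    Ideal.Quotient.liftₐ _ π fun f hf => Ideal.pow_le_self (Nat.succ_ne_zero n) hf
  have hfac : Function.Surjective fac := fun a => by
    obtain ⟨f, rfl⟩ := hπ a
    exact ⟨Ideal.Quotient.mk _ f, rfl⟩
  have hnil : IsNilpotent (RingHom.ker (fac : (P ⧸ (RingHom.ker π) ^ (n + 1)) →+* A)) := by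
    refine ⟨n + 1, ?_⟩
    have : RingHom.ker (fac : (P ⧸ (RingHom.ker π) ^ (n + 1)) →+* A) =
        (RingHom.ker π).map (Ideal.Quotient.mk ((RingHom.ker π) ^ (n + 1))) :=
      Ideal.ker_quotient_lift (π : P →+* A)
        (fun f hf => Ideal.pow_le_self (Nat.succ_ne_zero n) hf)
    rw [this, ← Ideal.map_pow, Ideal.map_quotient_self]
    rfl
  refine ⟨Algebra.FormallySmooth.liftOfSurjective (AlgHom.id k A) fac hfac hnil, fun a g h => ?_⟩
  have := Algebra.FormallySmooth.liftOfSurjective_apply (AlgHom.id k A) fac hfac hnil a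
  rw [h] at this
  exact this

/-- A retraction criterion for the primality of the jet ideal of a formally smooth algebra. -/
lemma jetIdeal_isPrime_of_retraction {k σ A R : Type*} [Field k] [CommRing A]
    [Algebra k A] [Algebra.FormallySmooth k A] [CommRing R] [IsDomain R] [Algebra k R]
    (F : Set (MvPolynomial σ k))
    (π : MvPolynomial σ k →ₐ[k] A) (hπ : Function.Surjective π)
    (hF : RingHom.ker π = Ideal.span F) (m : ℕ)
    (Ψ : MvPolynomial (σ × Fin (m + 1)) k →ₐ[k] R)
    (hΨ : ∀ f ∈ Ideal.span F, Ψ ((jetSub k σ m f).coeff 0) = 0)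
    (β : R →ₐ[k] MvPolynomial (σ × Fin (m + 1)) k ⧸ jetIdeal k σ m F)
    (hβΨ : β.comp Ψ = Ideal.Quotient.mkₐ k (jetIdeal k σ m F)) :
    (jetIdeal k σ m F).IsPrime := by
  set u := Ideal.Quotient.mkₐ k (jetIdeal k σ m F)
  obtain ⟨s, hs⟩ := Algebra.FormallySmooth.exists_section_quotient_pow π hπ m
  let φ : MvPolynomial σ k →ₐ[k] TruncPoly R m :=
    (Ideal.Quotient.liftₐ ((RingHom.ker π) ^ (m + 1)) (jetHom Ψ)
      (pow_le_ker_jetHom Ψ (by rwa [hF]))).comp (s.comp π)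
  have hφ (f : MvPolynomial σ k) : ∃ g, φ f = jetHom Ψ g ∧ π g = π f := by
    obtain ⟨g, hg⟩ := Ideal.Quotient.mk_surjective (s (π f))
    refine ⟨g, ?_, hs _ _ hg.symm⟩
    simp only [φ, AlgHom.comp_apply, ← hg]
    rfl
  obtain ⟨α, hα⟩ := exists_jetHom_eq φ
  have hαJ : jetIdeal k σ m F ≤ RingHom.ker α := by
    rw [jetIdeal_le_ker_iff, hα, ← hF]
    intro f hf
    simp [φ, RingHom.mem_ker.mp hf]
  have hu : Ideal.span F ≤ RingHom.ker (jetHom u) :=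
    (jetIdeal_le_ker_iff F u).mp (Ideal.mk_ker (I := jetIdeal k σ m F)).ge
  have hβα : β.comp α = u := by
    apply jetHom_injective
    rw [jetHom_comp, hα]
    apply MvPolynomial.algHom_ext
    intro i
    obtain ⟨g, hg, hgπ⟩ := hφ (MvPolynomial.X i)
    rw [AlgHom.comp_apply, hg, ← AlgHom.comp_apply, ← jetHom_comp, hβΨ, ← sub_eq_zero, ← map_sub]
    refine hu ?_
    rw [← hF, RingHom.mem_ker, map_sub, hgπ, sub_self]
  have hker : jetIdeal k σ m F = RingHom.ker α := by
    refine le_antisymm hαJ fun g hg => ?_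
    have : u g = 0 := by rw [← hβα, AlgHom.comp_apply, RingHom.mem_ker.mp hg, map_zero]
    exact Ideal.Quotient.eq_zero_iff_mem.mp this
  rw [hker]
  exact RingHom.ker_isPrime _

/-- The jet ideal of a formally smooth affine domain is prime. -/
lemma jetIdeal_isPrime_of_formallySmooth {k σ A : Type*} [Field k] [CommRing A] [IsDomain A]
    [Algebra k A] [Algebra.FormallySmooth k A] (F : Set (MvPolynomial σ k))
    (π : MvPolynomial σ k →ₐ[k] A) (hπ : Function.Surjective π)
    (hF : RingHom.ker π = Ideal.span F) (m : ℕ) :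
    (jetIdeal k σ m F).IsPrime := by
  let Ψ : MvPolynomial (σ × Fin (m + 1)) k →ₐ[k] MvPolynomial (σ × Fin (m + 1)) A :=
    MvPolynomial.aeval fun ij =>
      if ij.2 = 0 then MvPolynomial.C (π (MvPolynomial.X ij.1)) else MvPolynomial.X ij
  have hΨ0 (f : MvPolynomial σ k) :
      Ψ ((jetSub k σ m f).coeff 0) = MvPolynomial.C (π f) := by
    have : (Ψ.comp (MvPolynomial.rename fun i => (i, 0))) =
        (IsScalarTower.toAlgHom k A (MvPolynomial (σ × Fin (m + 1)) A)).comp π := by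
      ext i : 1
      simp [Ψ, MvPolynomial.algebraMap_eq]
    rw [jetSub_coeff_zero]
    exact DFunLike.congr_fun this f
  set u := Ideal.Quotient.mkₐ k (jetIdeal k σ m F) with hu'
  have hu : Ideal.span F ≤ RingHom.ker (jetHom u) :=
    (jetIdeal_le_ker_iff F u).mp (Ideal.mk_ker (I := jetIdeal k σ m F)).ge
  let ι : A →ₐ[k] MvPolynomial (σ × Fin (m + 1)) k ⧸ jetIdeal k σ m F :=
    AlgHom.liftOfSurjective π hπ (u.comp (MvPolynomial.rename fun i => (i, 0))) <| by
      intro f hf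
      have := (jetHom_eq_mk_iff u f 0).mp (by
        rw [map_zero]; exact hu (hF ▸ hf)) 0 (Nat.zero_le m)
      rwa [jetSub_coeff_zero] at this
  have hι (f) : ι (π f) = u (MvPolynomial.rename (fun i => (i, 0)) f) := by
    exact AlgHom.liftOfSurjective_apply _ _ _ _ _
  refine jetIdeal_isPrime_of_retraction F π hπ hF m Ψ (fun f hf => ?_)
    (MvPolynomial.aevalTower ι fun ij => u (MvPolynomial.X ij)) ?_
  · rw [hΨ0, show π f = 0 from RingHom.mem_ker.mp (hF ▸ hf), map_zero]
  · apply MvPolynomial.algHom_ext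
    rintro ⟨i, j⟩
    by_cases hj : j = 0
    · subst hj
      simp [Ψ, hι, hu']
    · simp [Ψ, hj, hu']

end Jets

lemma Algebra.IsIntegral.ringKrullDim_eq {C B : Type*} [CommRing C] [CommRing B] [IsDomain C]
    [IsDomain B] [Algebra C B] [Algebra.IsIntegral C B]
    (h : Function.Injective (algebraMap C B)) : ringKrullDim B = ringKrullDim C := by
  apply le_antisymm
  · refine Order.krullDim_le_of_strictMono (PrimeSpectrum.comap (algebraMap C B)) fun I J hIJ => ?_
    exact Ideal.IsIntegral.comap_lt_comap (R := C) (I := I.asIdeal) (J := J.asIdeal) hIJ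
  · refine iSup_le fun l => ?_
    obtain ⟨Q, -, hQ, hQl⟩ := Ideal.exists_ideal_over_prime_of_isIntegral_of_isPrime
      l.head.asIdeal (⊥ : Ideal B) (by
        rw [← RingHom.ker_eq_comap_bot, (RingHom.injective_iff_ker_eq_bot _).mp h]
        exact bot_le)
    have : Q.LiesOver l.head.asIdeal := ⟨hQl.symm⟩
    obtain ⟨L, hL, -⟩ := Ideal.exists_ltSeries_of_hasGoingUp l Q
    rw [← hL]
    exact Order.LTSeries.length_le_krullDim L

lemma exists_isTranscendenceBasis_fin_ringKrullDim_eq (k B : Type*) [Field k] [CommRing B]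
    [IsDomain B] [Algebra k B] [Algebra.FiniteType k B] :
    ∃ (s : ℕ) (x : Fin s → B), IsTranscendenceBasis k x ∧ ringKrullDim B = s := by
  obtain ⟨s, g, hg, hgi⟩ := exists_integral_inj_algHom_of_fg k B
  let : Algebra (MvPolynomial (Fin s) k) B := g.toAlgebra
  have hinj : Function.Injective (algebraMap (MvPolynomial (Fin s) k) B) := hg
  have : Algebra.IsIntegral (MvPolynomial (Fin s) k) B := ⟨hgi⟩
  have : IsScalarTower k (MvPolynomial (Fin s) k) B :=
    .of_algebraMap_eq fun c => (g.commutes c).symm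
  have : FaithfulSMul (MvPolynomial (Fin s) k) B :=
    (faithfulSMul_iff_algebraMap_injective _ _).mpr hinj
  refine ⟨s, _, (IsTranscendenceBasis.mvPolynomial (Fin s) k).algebraMap_comp (A := B), ?_⟩
  rw [Algebra.IsIntegral.ringKrullDim_eq hinj, MvPolynomial.ringKrullDim_of_isNoetherianRing]
  simp

/-- The dimension of an affine domain is at most the number of elements needed to generate
its fraction field up to an algebraic extension. -/
lemma ringKrullDim_le_ncard_of_isAlgebraic {k B : Type*} [Field k] [CommRing B]
    [IsDomain B] [Algebra k B] [Algebra.FiniteType k B] {E : Type*} [Field E] [Algebra k E]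
    [Algebra B E] [IsScalarTower k B E] [IsFractionRing B E] (s : Set E) (hs : s.Finite)
    [Algebra.IsAlgebraic (IntermediateField.adjoin k s) E] :
    ringKrullDim B ≤ s.ncard := by
  obtain ⟨n, x, hx, hB⟩ := exists_isTranscendenceBasis_fin_ringKrullDim_eq k B
  have : Algebra.IsAlgebraic B E := IsLocalization.isAlgebraic E (nonZeroDivisors B)
  have hxE := hx.algebraMap_comp (A := E)
  have h1 := hxE.lift_cardinalMk_eq_trdeg
  have : Algebra.IsAlgebraic (Algebra.adjoin k s) E :=
    IntermediateField.isAlgebraic_adjoin_iff_top.mp inferInstance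
  have h2 := Algebra.IsAlgebraic.trdeg_le_cardinalMk k s
  have : Finite s := hs
  rw [← Nat.cast_card (α := s), Nat.card_coe_set_eq] at h2
  rw [hB]
  simp only [Cardinal.mk_fin, Cardinal.lift_natCast, Cardinal.lift_uzero] at h1
  rw [← h1] at h2
  exact_mod_cast h2

section SeparableLift

open Polynomial

/-- The constant coefficient of a truncated polynomial. -/
def TruncPoly.constCoeff (R : Type*) [CommRing R] (m : ℕ) : TruncPoly R m →+* R :=
  Ideal.Quotient.lift _ (Polynomial.constantCoeff) <| by
    intro a ha
    obtain ⟨b, rfl⟩ := Ideal.mem_span_singleton.mp ha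
    simp

lemma TruncPoly.constCoeff_mk {R : Type*} [CommRing R] {m : ℕ} (p : R[X]) :
    TruncPoly.constCoeff R m (Ideal.Quotient.mk _ p) = p.coeff 0 := rfl

lemma TruncPoly.isNilpotent_of_constCoeff_eq_zero {R : Type*} [CommRing R] {m : ℕ}
    {u : TruncPoly R m} (h : TruncPoly.constCoeff R m u = 0) : IsNilpotent u := by
  obtain ⟨p, rfl⟩ := Ideal.Quotient.mk_surjective u
  obtain ⟨q, rfl⟩ := X_dvd_iff.mpr h
  refine ⟨m + 1, Ideal.Quotient.eq_zero_iff_mem.mpr ?_⟩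
  dsimp only
  rw [mul_pow]
  exact Ideal.mul_mem_right _ _ (Ideal.mem_span_singleton_self _)

lemma TruncPoly.isUnit_of_isUnit_constCoeff {R : Type*} [CommRing R] {m : ℕ} {u : TruncPoly R m}
    (h : IsUnit (TruncPoly.constCoeff R m u)) : IsUnit u := by
  have h1 : IsUnit (Ideal.Quotient.mk (Ideal.span {(X : R[X]) ^ (m + 1)})
      (C (TruncPoly.constCoeff R m u))) := (h.map C).map _
  have h2 : IsNilpotent (u - Ideal.Quotient.mk _ (C (TruncPoly.constCoeff R m u))) := by
    apply TruncPoly.isNilpotent_of_constCoeff_eq_zero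
    rw [map_sub, TruncPoly.constCoeff_mk, coeff_C_zero, sub_self]
  simpa using h2.isUnit_add_left_of_commute h1 (Commute.all _ _)

lemma TruncPoly.constCoeff_map {k R R' : Type*} [CommRing k] [CommRing R] [CommRing R']
    [Algebra k R] [Algebra k R'] {m : ℕ} (g : R →ₐ[k] R') (u : TruncPoly R m) :
    TruncPoly.constCoeff R' m (TruncPoly.map m g u) = g (TruncPoly.constCoeff R m u) := by
  obtain ⟨p, rfl⟩ := Ideal.Quotient.mk_surjective u
  rw [TruncPoly.map_mk, TruncPoly.constCoeff_mk, TruncPoly.constCoeff_mk, coeff_map]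
  rfl

lemma Polynomial.mem_range_of_isNilpotent_sub {S T : Type*} [CommRing S] [CommRing T]
    (i : S →+* T) (hnil : ∀ u, IsNilpotent (i u) → IsNilpotent u)
    (hunit : ∀ u, IsUnit (i u) → IsUnit u) {Q : S[X]} {z : T} (hz : eval₂ i z Q = 0)
    (hz' : IsUnit (eval₂ i z Q.derivative)) (W : S) (hW : IsNilpotent (i W - z)) :
    z ∈ i.range := by
  have hQ (y : T) (Q : S[X]) : aeval y (Q.map i) = eval₂ i y Q := by
    rw [coe_aeval_eq_eval, eval_map]
  have hW' (Q : S[X]) : i (aeval W Q) = aeval (i W) (Q.map i) := by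
    rw [hQ, coe_aeval_eq_eval, eval₂_at_apply]
  have hz1 : aeval z (Q.map i) = 0 := by rw [hQ, hz]
  have hz2 : IsUnit (aeval z (Q.map i).derivative) := by rwa [derivative_map, hQ]
  obtain ⟨r, ⟨hr1, hr2⟩, -⟩ := existsUnique_nilpotent_sub_and_aeval_eq_zero (P := Q) (x := W)
    (hnil _ <| by
      have := isNilpotent_aeval_sub_of_isNilpotent_sub (Q.map i) hW
      rwa [hz1, sub_zero, ← hW'] at this)
    (hunit _ <| by
      rw [hW', ← derivative_map]
      exact isUnit_aeval_of_isUnit_aeval_of_isNilpotent_sub hz2 hW)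
  obtain ⟨r', -, hr'⟩ := existsUnique_nilpotent_sub_and_aeval_eq_zero
    (P := Q.map i) (x := z) (by rw [hz1]; exact IsNilpotent.zero) hz2
  refine ⟨r, (hr' (i r) ⟨?_, ?_⟩).trans (hr' z ⟨?_, hz1⟩).symm⟩
  · have : z - i r = (i W - i r) - (i W - z) := by ring
    rw [this, ← map_sub]
    exact (Commute.all _ _).isNilpotent_sub (hr1.map i) hW
  · rw [hQ, eval₂_at_apply, ← coe_aeval_eq_eval, hr2, map_zero]
  · rw [sub_self]; exact IsNilpotent.zero

lemma TruncPoly.inv_mem_range_map {k L E K : Type*} [Field k] [Field L] [Field E] [Field K]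
    [Algebra k L] [Algebra k E] [Algebra k K] {m : ℕ} (g : K →ₐ[k] E)
    (Θ : L →ₐ[k] TruncPoly E m) {y : L}
    (hy : Θ y ∈ (TruncPoly.map m g).range) : Θ y⁻¹ ∈ (TruncPoly.map m g).range := by
  obtain ⟨u, hu : TruncPoly.map m g u = Θ y⟩ := hy
  by_cases hy : y = 0
  · simp [hy]
  have h1 : Θ y * Θ y⁻¹ = 1 := by rw [← map_mul, mul_inv_cancel₀ hy, map_one]
  have h2 : IsUnit u := by
    apply TruncPoly.isUnit_of_isUnit_constCoeff
    rw [isUnit_iff_ne_zero]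
    intro h0
    have h3 := congr_arg (TruncPoly.constCoeff E m) h1
    rw [map_mul, ← hu, TruncPoly.constCoeff_map, h0, map_zero, zero_mul,
      map_one] at h3
    exact zero_ne_one h3
  obtain ⟨v, hv⟩ := h2.exists_right_inv
  have h4 : Θ y * TruncPoly.map m g v = 1 := by
    rw [← hu, ← map_mul, hv, map_one]
  refine ⟨v, ?_⟩
  change TruncPoly.map m g v = _
  calc TruncPoly.map m g v = (Θ y * Θ y⁻¹) * TruncPoly.map m g v := by rw [h1, one_mul]
    _ = Θ y⁻¹ * (Θ y * TruncPoly.map m g v) := by ring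
    _ = Θ y⁻¹ := by rw [h4, mul_one]

/-- A homomorphism from a separable extension of `k(s)` to truncated power series over `E` is
defined over a relatively algebraically closed subfield of `E` as soon as it is so on `s`. -/
lemma TruncPoly.mem_range_map_val_of_isSeparable {k L E : Type*} [Field k] [Field L] [Field E]
    [Algebra k L] [Algebra k E] (K : IntermediateField k E)
    (hK : ∀ e : E, IsAlgebraic K e → e ∈ K) {m : ℕ} (Θ : L →ₐ[k] TruncPoly E m) (s : Set L)
    [Algebra.IsSeparable (IntermediateField.adjoin k s) L]
    (hs : ∀ x ∈ s, Θ x ∈ (TruncPoly.map m K.val).range) (x : L) :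
    Θ x ∈ (TruncPoly.map m K.val).range := by
  have hM (y) (hy : y ∈ IntermediateField.adjoin k s) : Θ y ∈ (TruncPoly.map m K.val).range := by
    induction hy using IntermediateField.adjoin_induction with
    | mem y hy => exact hs y hy
    | algebraMap c => rw [AlgHom.commutes]; exact Subalgebra.algebraMap_mem _ c
    | add y z _ _ hy hz => rw [map_add]; exact add_mem hy hz
    | inv y _ hy => exact TruncPoly.inv_mem_range_map _ _ hy
    | mul y z _ _ hy hz => rw [map_mul]; exact mul_mem hy hz
  have hsep := Algebra.IsSeparable.isSeparable (IntermediateField.adjoin k s) x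
  set P := (minpoly (IntermediateField.adjoin k s) x).map
    (algebraMap (IntermediateField.adjoin k s) L) with hP
  have hPx : P.eval x = 0 := by rw [eval_map_algebraMap]; exact minpoly.aeval _ _
  have hP'x : P.derivative.eval x ≠ 0 := by
    rw [derivative_map, eval_map_algebraMap]
    exact hsep.aeval_derivative_ne_zero (minpoly.aeval _ _)
  obtain ⟨i, hi⟩ : ∃ i : TruncPoly K m →+* TruncPoly E m, i = TruncPoly.map m K.val := ⟨_, rfl⟩
  obtain ⟨θ, hθ⟩ : ∃ θ : L →+* TruncPoly E m, θ = Θ := ⟨_, rfl⟩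
  have hi0 (u) : TruncPoly.constCoeff E m (i u) = algebraMap K E (TruncPoly.constCoeff K m u) := by
    rw [hi]; exact TruncPoly.constCoeff_map _ _
  have hθM (n : ℕ) : θ (P.coeff n) ∈ i.range := by
    rw [hP, coeff_map, hi, hθ]
    exact hM _ ((minpoly (IntermediateField.adjoin k s) x).coeff n).2
  suffices h : θ x ∈ i.range by rw [hi, hθ] at h; exact h
  clear_value P
  clear hi hθ hM hs hsep hP
  obtain ⟨Q, hQ⟩ := (mem_lifts _).mp <| (lifts_iff_coeff_lifts (f := i) (P.map θ)).mpr fun n => by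
    rw [coeff_map]; exact hθM n
  have hQz : eval₂ i (θ x) Q = 0 := by
    rw [eval₂_eq_eval_map, hQ, eval_map, eval₂_at_apply, hPx, map_zero]
  have hQ'z : eval₂ i (θ x) Q.derivative = θ (P.derivative.eval x) := by
    rw [eval₂_eq_eval_map, ← derivative_map, hQ, derivative_map, eval_map, eval₂_at_apply]
  have hunit : IsUnit (eval₂ i (θ x) Q.derivative) := by
    rw [hQ'z]; exact (isUnit_iff_ne_zero.mpr hP'x).map θ
  have hcomp : (TruncPoly.constCoeff E m).comp i =
      (algebraMap K E).comp (TruncPoly.constCoeff K m) := RingHom.ext hi0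
  have hq (Q : (TruncPoly K m)[X]) : aeval (TruncPoly.constCoeff E m (θ x))
      (Q.map (TruncPoly.constCoeff K m)) = TruncPoly.constCoeff E m (eval₂ i (θ x) Q) := by
    rw [hom_eval₂, hcomp, aeval_def, eval₂_map]
  have hz0 : TruncPoly.constCoeff E m (θ x) ∈ K := by
    refine hK _ ⟨Q.map (TruncPoly.constCoeff K m), fun h0 => ?_, ?_⟩
    · refine (hunit.map (TruncPoly.constCoeff E m)).ne_zero ?_
      rw [← hq, ← derivative_map, h0, derivative_zero, map_zero]
    · rw [hq, hQz, map_zero]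
  refine Polynomial.mem_range_of_isNilpotent_sub i (fun u hu => ?_) (fun u hu => ?_) hQz hunit
    (Ideal.Quotient.mk _ (C ⟨_, hz0⟩)) ?_
  · apply TruncPoly.isNilpotent_of_constCoeff_eq_zero
    have := (hu.map (TruncPoly.constCoeff E m)).eq_zero
    rwa [hi0, map_eq_zero] at this
  · apply TruncPoly.isUnit_of_isUnit_constCoeff
    have := hu.map (TruncPoly.constCoeff E m)
    rwa [hi0, isUnit_iff_ne_zero, _root_.map_ne_zero, ← isUnit_iff_ne_zero] at this
  · apply TruncPoly.isNilpotent_of_constCoeff_eq_zero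
    rw [map_sub, hi0, TruncPoly.constCoeff_mk, coeff_C_zero]
    exact sub_self _

end SeparableLift

section JetDimension

open Polynomial

lemma TruncPoly.mk_mem_range_map_val_iff {k E : Type*} [Field k] [Field E] [Algebra k E]
    (K : IntermediateField k E) {m : ℕ} (p : E[X]) :
    (Ideal.Quotient.mk _ p : TruncPoly E m) ∈ (TruncPoly.map m K.val).range ↔
      ∀ j ≤ m, p.coeff j ∈ K := by
  constructor
  · rintro ⟨u, hu⟩ j hj
    obtain ⟨q, rfl⟩ := Ideal.Quotient.mk_surjective u
    have := TruncPoly.mk_eq_mk_iff.mp hu j hj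
    rw [← this]
    change (q.map (K.val : K →+* E)).coeff j ∈ K
    rw [coeff_map]
    exact (q.coeff j).2
  · intro h
    refine ⟨Ideal.Quotient.mk _ (∑ j : Fin (m + 1),
      monomial (j : ℕ) (⟨p.coeff j, h j (by omega)⟩ : K)), ?_⟩
    refine TruncPoly.mk_eq_mk_iff.mpr fun j hj => ?_
    change (Polynomial.map (K.val : K →+* E) _).coeff j = _
    rw [coeff_map, finsetSum_coeff,
      Finset.sum_eq_single (⟨j, by omega⟩ : Fin (m + 1))]
    · simp
    · intro b _ hb
      rw [coeff_monomial, if_neg (fun h => hb (Fin.ext h))]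
    · simp

/-- The universal jet extends to the function field. -/
lemma exists_fractionRing_jet {k σ A E : Type*} [Field k] [CommRing A] [IsDomain A] [Algebra k A]
    [Field E] [Algebra k E] {m : ℕ} (F : Set (MvPolynomial σ k)) (π : MvPolynomial σ k →ₐ[k] A)
    (hπ : Function.Surjective π) (hF : RingHom.ker π = Ideal.span F)
    (ψ : MvPolynomial (σ × Fin (m + 1)) k →ₐ[k] E) (hψ : jetIdeal k σ m F ≤ RingHom.ker ψ)
    (hψ0 : ∀ f, ψ ((jetSub k σ m f).coeff 0) = 0 → π f = 0) :
    ∃ Θ : FractionRing A →ₐ[k] TruncPoly E m,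
      ∀ f, Θ (algebraMap A (FractionRing A) (π f)) = jetHom ψ f := by
  let θ : A →ₐ[k] TruncPoly E m :=
    AlgHom.liftOfSurjective π hπ (jetHom ψ) (hF ▸ (jetIdeal_le_ker_iff F ψ).mp hψ)
  have hθ (f) : θ (π f) = jetHom ψ f := AlgHom.liftOfSurjective_apply _ _ _ _ _
  have hunit (a : nonZeroDivisors A) : IsUnit (θ a) := by
    obtain ⟨f, hf⟩ := hπ a
    apply TruncPoly.isUnit_of_isUnit_constCoeff
    rw [← hf, hθ, jetHom_apply, TruncPoly.constCoeff_mk, coeff_map, isUnit_iff_ne_zero]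
    intro h0
    exact nonZeroDivisors.coe_ne_zero a (by rw [← hf]; exact hψ0 f h0)
  refine ⟨IsLocalization.liftAlgHom (M := nonZeroDivisors A) (f := θ) hunit, fun f => ?_⟩
  rw [IsLocalization.liftAlgHom_apply, IsLocalization.lift_eq]
  exact hθ f

lemma ringKrullDim_le_of_jetIdeal_le_ker {k σ A B : Type*} [Field k] [PerfectField k]
    [CommRing A] [IsDomain A] [Algebra k A] [Algebra.FiniteType k A] [CommRing B] [IsDomain B]
    [Algebra k B] [Algebra.FiniteType k B] {m d : ℕ} (F : Set (MvPolynomial σ k))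
    (π : MvPolynomial σ k →ₐ[k] A) (hπ : Function.Surjective π)
    (hF : RingHom.ker π = Ideal.span F) (hd : ringKrullDim A = d)
    (ψ : MvPolynomial (σ × Fin (m + 1)) k →ₐ[k] B) (hψs : Function.Surjective ψ)
    (hψ : jetIdeal k σ m F ≤ RingHom.ker ψ)
    (hψ0 : ∀ f, ψ ((jetSub k σ m f).coeff 0) = 0 → π f = 0) :
    ringKrullDim B ≤ (d * (m + 1) : ℕ) := by
  let E := FractionRing B
  let L := FractionRing A
  let ι := IsScalarTower.toAlgHom k B E
  have hι : Function.Injective ι := IsFractionRing.injective B E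
  obtain ⟨Θ, hΘ⟩ := exists_fractionRing_jet F π hπ hF (ι.comp ψ)
    (fun g hg => by
      rw [RingHom.mem_ker, AlgHom.comp_apply, RingHom.mem_ker.mp (hψ hg), map_zero])
    (fun f hf => hψ0 f (hι (by rw [map_zero]; exact hf)))
  have : Algebra.EssFiniteType A L := .of_isLocalization _ (nonZeroDivisors A)
  have : Algebra.EssFiniteType k L := .comp k A L
  obtain ⟨s, hs, hsep⟩ := exists_isTranscendenceBasis_and_isSeparable_of_perfectField k L
  have hcard : s.card = d := by
    obtain ⟨n, x, hx, hA⟩ := exists_isTranscendenceBasis_fin_ringKrullDim_eq k A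
    have : Algebra.IsAlgebraic A L := IsLocalization.isAlgebraic L (nonZeroDivisors A)
    have h1 := hs.lift_cardinalMk_eq (hx.algebraMap_comp (A := L))
    have h2 : n = d := by rw [hA] at hd; exact_mod_cast hd
    simp only [Cardinal.mk_fin, Cardinal.mk_coe_finset, Cardinal.lift_natCast,
      Nat.cast_inj] at h1
    omega
  choose p hp using fun x : L => Ideal.Quotient.mk_surjective (Θ x)
  let c : s × Fin (m + 1) → E := fun xj => (p xj.1).coeff xj.2
  set K0 := IntermediateField.adjoin k (Set.range c)
  let K : IntermediateField k E := (algebraicClosure K0 E).restrictScalars k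
  have hK : ∀ e : E, IsAlgebraic K e → e ∈ K := by
    intro e he
    have h1 : IsAlgebraic (algebraicClosure K0 E) e := he
    exact mem_algebraicClosure_iff.mpr (h1.restrictScalars K0)
  have hmem := TruncPoly.mem_range_map_val_of_isSeparable K hK Θ (s : Set L) (by
    intro x hx
    rw [← hp, TruncPoly.mk_mem_range_map_val_iff]
    intro j hj
    have h1 : (p x).coeff j ∈ K0 :=
      IntermediateField.subset_adjoin _ _ ⟨(⟨x, hx⟩, ⟨j, by omega⟩), rfl⟩
    exact (algebraicClosure K0 E).algebraMap_mem ⟨_, h1⟩)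
  have hX (g) : ι (ψ g) ∈ K := by
    have h1 : (ι.comp ψ).range ≤ K.toSubalgebra := by
      rw [← Algebra.map_top, ← MvPolynomial.adjoin_range_X, AlgHom.map_adjoin, Algebra.adjoin_le_iff]
      rintro _ ⟨_, ⟨⟨i, j⟩, rfl⟩, rfl⟩
      have h2 := hmem (algebraMap A L (π (MvPolynomial.X i)))
      rw [hΘ, jetHom_apply, TruncPoly.mk_mem_range_map_val_iff] at h2
      have h3 := h2 j (by omega)
      rw [coeff_map, jetSub_X_coeff] at h3
      exact h3
    exact h1 ⟨g, rfl⟩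
  have htop (e : E) : e ∈ K := by
    obtain ⟨b, t, -, rfl⟩ := IsFractionRing.div_surjective (A := B) e
    obtain ⟨b, rfl⟩ := hψs b
    obtain ⟨t, rfl⟩ := hψs t
    exact div_mem (hX b) (hX t)
  have : Algebra.IsAlgebraic K0 E := ⟨fun e => mem_algebraicClosure_iff.mp (htop e)⟩
  refine (ringKrullDim_le_ncard_of_isAlgebraic (k := k) (E := E) (Set.range c) (Set.finite_range c)).trans ?_
  norm_cast
  rw [← Set.image_univ]
  refine (Set.ncard_image_le Set.finite_univ).trans ?_
  rw [Set.ncard_univ, Nat.card_eq_fintype_card]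
  simp [hcard]

end JetDimension

section SingularJets

open Polynomial

lemma exists_algHom_eq_of_mul_eq {k A T : Type*} [CommRing k] [CommRing A] [Algebra k A]
    [CommRing T] [Algebra k T] (ε : A →ₐ[k] k) (ℓ h : A →ₗ[k] k) (δ : Fin 2 → A →ₗ[k] k)
    (hℓ : ∀ a b, ℓ (a * b) = ε a * ℓ b + ε b * ℓ a)
    (hh : ∀ a b, h (a * b) = ε a * h b + ε b * h a + ℓ a * ℓ b)
    (hδ : ∀ e a b, δ e (a * b) = ε a * δ e b + ε b * δ e a)
    (s : T) (d : Fin 2 → T) (hs : s ^ 3 = 0) (hsd : ∀ e, s * d e = 0)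
    (hdd : ∀ e e', d e * d e' = 0) :
    ∃ φ : A →ₐ[k] T, ∀ a, φ a = algebraMap k T (ε a) + ℓ a • s + h a • s ^ 2 +
      δ 0 a • d 0 + δ 1 a • d 1 := by
  have hℓ1 : ℓ 1 = 0 := by simpa using hℓ 1 1
  have hh1 : h 1 = 0 := by simpa [hℓ1] using hh 1 1
  have hδ1 (e) : δ e 1 = 0 := by simpa using hδ e 1 1
  refine ⟨AlgHom.ofLinearMap ((Algebra.linearMap k T).comp ε.toLinearMap + ℓ.smulRight s +
    h.smulRight (s ^ 2) + (δ 0).smulRight (d 0) + (δ 1).smulRight (d 1)) ?_ ?_, fun a => ?_⟩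
  · simp [hℓ1, hh1, hδ1]
  · intro a b
    simp only [LinearMap.add_apply, LinearMap.comp_apply, LinearMap.smulRight_apply,
      AlgHom.toLinearMap_apply, Algebra.linearMap_apply, hℓ, hh, hδ, Algebra.smul_def, map_add,
      map_mul]
    set α := algebraMap k T
    linear_combination
      (-(α (ℓ a) * α (h b) + α (h a) * α (ℓ b)) - α (h a) * α (h b) * s) * hs -
      (α (ℓ a) * α (δ 0 b) + α (ℓ b) * α (δ 0 a) +
        s * (α (h a) * α (δ 0 b) + α (h b) * α (δ 0 a))) * hsd 0 -
      (α (ℓ a) * α (δ 1 b) + α (ℓ b) * α (δ 1 a) +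
        s * (α (h a) * α (δ 1 b) + α (h b) * α (δ 1 a))) * hsd 1 -
      α (δ 0 a) * α (δ 0 b) * hdd 0 0 - α (δ 1 a) * α (δ 1 b) * hdd 1 1 -
      (α (δ 0 a) * α (δ 1 b) + α (δ 1 a) * α (δ 0 b)) * hdd 0 1
  · simp

/-- Jets `ε + ℓ c t^p + h c² t^(2p) + ∑ δ_e z_{e,i} t^(q+i)` supported at the point `ε`. -/
lemma exists_surjective_of_mul_eq {k σ A R : Type*} [Field k] [CommRing A] [Algebra k A]
    [CommRing R] [Algebra k R] {m : ℕ} (F : Set (MvPolynomial σ k))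
    (π : MvPolynomial σ k →ₐ[k] A) (hπ : Function.Surjective π)
    (hF : Ideal.span F ≤ RingHom.ker π)
    (ε : A →ₐ[k] k) (ℓ h : A →ₗ[k] k) (δ : Fin 2 → A →ₗ[k] k)
    (hℓ : ∀ a b, ℓ (a * b) = ε a * ℓ b + ε b * ℓ a)
    (hh : ∀ a b, h (a * b) = ε a * h b + ε b * h a + ℓ a * ℓ b)
    (hδ : ∀ e a b, δ e (a * b) = ε a * δ e b + ε b * δ e a)
    (hℓ0 : ℓ ≠ 0) (y : Fin 2 → A) (hy : ∀ e e', δ e (y e') = if e = e' then 1 else 0)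
    {p q n : ℕ} (hp : 1 ≤ p) (hq : q + n = m + 1) (hp3 : m + 1 ≤ 3 * p) (hpq : m + 1 ≤ p + q)
    (hq2 : p ≤ q) (c : R) (z : Fin 2 → Fin n → R) (hc : c = 0 ∨ p < q)
    (hgen : Algebra.adjoin k (insert c (Set.range fun x : Fin 2 × Fin n => z x.1 x.2)) = ⊤) :
    ∃ ψ : MvPolynomial (σ × Fin (m + 1)) k →ₐ[k] R, Function.Surjective ψ ∧
      jetIdeal k σ m F ≤ RingHom.ker ψ ∧
      ∀ f, ψ ((jetSub k σ m f).coeff 0) = algebraMap k R (ε (π f)) := by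
  let s : R[X] := X ^ p * C c
  let D : Fin 2 → R[X] := fun e => X ^ q * ∑ i : Fin n, monomial (i : ℕ) (z e i)
  have hzero (u : R[X]) (j : ℕ) (hj : m + 1 ≤ j) :
      (Ideal.Quotient.mk (Ideal.span {(X : R[X]) ^ (m + 1)}) (X ^ j * u)) = 0 := by
    rw [Ideal.Quotient.eq_zero_iff_dvd]
    exact (pow_dvd_pow _ hj).mul_right _
  obtain ⟨φ, hφ⟩ := exists_algHom_eq_of_mul_eq (T := TruncPoly R m) ε ℓ h δ hℓ hh hδ
    (Ideal.Quotient.mk _ s) (fun e => Ideal.Quotient.mk _ (D e))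
    (by
      rw [← map_pow, ← hzero (C c ^ 3) (3 * p) hp3]
      congr 1; ring)
    (fun e => by
      rw [← map_mul, ← hzero (C c * ∑ i : Fin n, monomial (i : ℕ) (z e i)) (p + q) hpq]
      congr 1; ring)
    (fun e e' => by
      rw [← map_mul, ← hzero ((∑ i : Fin n, monomial (i : ℕ) (z e i)) *
        ∑ i : Fin n, monomial (i : ℕ) (z e' i)) (q + q) (by omega)]
      congr 1; ring)
  obtain ⟨ψ, hψ⟩ := exists_jetHom_eq (φ.comp π)
  have hcoeff (f) (j : ℕ) (hj : j ≤ m) : ψ ((jetSub k σ m f).coeff j) =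
      (C (algebraMap k R (ε (π f))) + ℓ (π f) • s + h (π f) • s ^ 2 +
        δ 0 (π f) • D 0 + δ 1 (π f) • D 1).coeff j := by
    refine (jetHom_eq_mk_iff ψ f _).mp ?_ j hj
    rw [hψ, AlgHom.comp_apply, hφ]
    rfl
  have hs2 : s ^ 2 = X ^ (2 * p) * C (c ^ 2) := by simp only [s, C_pow]; ring
  have hDq (e) (i : Fin n) : (D e).coeff (q + i) = z e i := by
    simp only [D, add_comm q, coeff_X_pow_mul, finsetSum_coeff, coeff_monomial]
    rw [Finset.sum_eq_single i (fun b _ hb => if_neg fun h => hb (Fin.ext h)) (by simp),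
      if_pos rfl]
  have hDlt (e) (j : ℕ) (hj : j < q) : (D e).coeff j = 0 := by
    simp only [D, coeff_X_pow_mul', if_neg (not_le.mpr hj)]
  have hscoeff (j : ℕ) : s.coeff j = if j = p then c else 0 := by
    simp [s]
  have hs2coeff (j : ℕ) : (s ^ 2).coeff j = if j = 2 * p then c ^ 2 else 0 := by
    rw [hs2, coeff_mul_C, coeff_X_pow]
    simp
  refine ⟨ψ, ?_, ?_, fun f => ?_⟩
  · have hcmem : c ∈ ψ.range := by
      obtain rfl | hlt := hc
      · exact zero_mem _
      obtain ⟨a, ha⟩ : ∃ a, ℓ a ≠ 0 := by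
        by_contra! hcon
        exact hℓ0 (LinearMap.ext hcon)
      obtain ⟨f, rfl⟩ := hπ a
      have h1 := hcoeff f p (by omega)
      simp only [coeff_add, coeff_smul, hDlt _ p hlt, hscoeff, hs2coeff, coeff_C,
        if_neg (show p ≠ 2 * p by omega), if_neg (show p ≠ 0 by omega), if_pos, smul_zero,
        add_zero, zero_add] at h1
      have h2 : c = (ℓ (π f))⁻¹ • (ℓ (π f) • c) := by rw [inv_smul_smul₀ ha]
      rw [h2, ← h1]
      exact ψ.range.smul_mem ⟨_, rfl⟩ _
    have hzmem (e i) : z e i ∈ ψ.range := by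
      obtain ⟨f, hf⟩ := hπ (y e)
      have h1 := hcoeff f (q + i) (by omega)
      have h2 : z e i = ψ ((jetSub k σ m f).coeff (q + i)) -
          (ℓ (π f) • (if q + (i : ℕ) = p then c else 0) +
            h (π f) • (if q + (i : ℕ) = 2 * p then c ^ 2 else 0)) := by
        rw [h1, hf]
        simp only [coeff_add, coeff_smul, hDq, hscoeff, hs2coeff, coeff_C, hy,
          if_neg (show q + (i : ℕ) ≠ 0 by omega)]
        fin_cases e <;> simp
      rw [h2]
      refine sub_mem ⟨_, rfl⟩ (add_mem (ψ.range.smul_mem ?_ _) (ψ.range.smul_mem ?_ _))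
      · split_ifs
        exacts [hcmem, zero_mem _]
      · split_ifs
        exacts [pow_mem hcmem 2, zero_mem _]
    rw [← AlgHom.range_eq_top, eq_top_iff, ← hgen, Algebra.adjoin_le_iff, Set.insert_subset_iff]
    refine ⟨hcmem, ?_⟩
    rintro _ ⟨x, rfl⟩
    exact hzmem _ _
  · rw [jetIdeal_le_ker_iff, hψ]
    intro f hf
    rw [RingHom.mem_ker, AlgHom.comp_apply, RingHom.mem_ker.mp (hF hf), map_zero]
  · rw [hcoeff f 0 (Nat.zero_le _)]
    simp [coeff_add, coeff_smul, hDlt _ 0 (by omega), hscoeff, hs2coeff, show 0 ≠ p by omega,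
      show 0 ≠ 2 * p by omega]

lemma le_ringKrullDim_of_surjective {k σ A R : Type*} [Field k] [CommRing A] [IsDomain A]
    [Algebra k A] [CommRing R] [IsReduced R] [Algebra k R] {m : ℕ} (F : Set (MvPolynomial σ k))
    (π : MvPolynomial σ k →ₐ[k] A) (hπ : Function.Surjective π)
    (hJ : (jetIdeal k σ m F).radical.IsPrime)
    (hJ0 : ∀ f, (jetSub k σ m f).coeff 0 ∈ (jetIdeal k σ m F).radical → π f = 0)
    (ε : A →ₐ[k] k) (a : A) (ha : a ≠ 0) (hεa : ε a = 0)
    (ψ : MvPolynomial (σ × Fin (m + 1)) k →ₐ[k] R) (hψs : Function.Surjective ψ)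
    (hψ : jetIdeal k σ m F ≤ RingHom.ker ψ)
    (hψ0 : ∀ f, ψ ((jetSub k σ m f).coeff 0) = algebraMap k R (ε (π f))) :
    ringKrullDim R + 1 ≤
      ringKrullDim (MvPolynomial (σ × Fin (m + 1)) k ⧸ (jetIdeal k σ m F).radical) := by
  have hψr : ∀ g ∈ (jetIdeal k σ m F).radical, (ψ : _ →+* R) g = 0 := by
    rintro g ⟨n, hn⟩
    exact IsReduced.eq_zero _ ⟨n, (map_pow _ _ _).symm.trans (hψ hn)⟩
  obtain ⟨f, rfl⟩ := hπ a
  refine ringKrullDim_succ_le_of_surjective (Ideal.Quotient.lift _ (ψ : _ →+* R) hψr)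
    (Ideal.Quotient.lift_surjective_of_surjective _ _ hψs)
    (r := Ideal.Quotient.mk _ ((jetSub k σ m f).coeff 0)) ?_ ?_
  · rw [mem_nonZeroDivisors_iff_ne_zero, Ne, Ideal.Quotient.eq_zero_iff_mem]
    exact fun h => ha (hJ0 f h)
  · rw [Ideal.Quotient.lift_mk]
    exact (hψ0 f).trans (by rw [hεa, map_zero])

lemma le_ringKrullDim_of_mul_eq {k σ A : Type*} [Field k] [CommRing A] [IsDomain A]
    [Algebra k A] {m : ℕ} (hm : 1 ≤ m) (F : Set (MvPolynomial σ k))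
    (π : MvPolynomial σ k →ₐ[k] A) (hπ : Function.Surjective π)
    (hF : Ideal.span F ≤ RingHom.ker π)
    (hJ : (jetIdeal k σ m F).radical.IsPrime)
    (hJ0 : ∀ f, (jetSub k σ m f).coeff 0 ∈ (jetIdeal k σ m F).radical → π f = 0)
    (ε : A →ₐ[k] k) (ℓ h : A →ₗ[k] k) (δ : Fin 2 → A →ₗ[k] k)
    (hℓ : ∀ a b, ℓ (a * b) = ε a * ℓ b + ε b * ℓ a)
    (hh : ∀ a b, h (a * b) = ε a * h b + ε b * h a + ℓ a * ℓ b)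
    (hδ : ∀ e a b, δ e (a * b) = ε a * δ e b + ε b * δ e a)
    (hℓ0 : ℓ ≠ 0) (y : Fin 2 → A) (hy : ∀ e e', δ e (y e') = if e = e' then 1 else 0)
    (a : A) (ha : a ≠ 0) (hεa : ε a = 0) :
    ((m + 2 : ℕ) : WithBot ℕ∞) ≤
      ringKrullDim (MvPolynomial (σ × Fin (m + 1)) k ⧸ (jetIdeal k σ m F).radical) := by
  have key (ι : Type) [Finite ι] (hι : Nat.card ι = m + 1)
      (H : ∃ ψ : MvPolynomial (σ × Fin (m + 1)) k →ₐ[k] MvPolynomial ι k, Function.Surjective ψ ∧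
        jetIdeal k σ m F ≤ RingHom.ker ψ ∧
        ∀ f, ψ ((jetSub k σ m f).coeff 0) = algebraMap k _ (ε (π f))) :
      ((m + 2 : ℕ) : WithBot ℕ∞) ≤
        ringKrullDim (MvPolynomial (σ × Fin (m + 1)) k ⧸ (jetIdeal k σ m F).radical) := by
    obtain ⟨ψ, hψs, hψ, hψ0⟩ := H
    refine le_trans (le_of_eq ?_)
      (le_ringKrullDim_of_surjective F π hπ hJ hJ0 ε a ha hεa ψ hψs hψ hψ0)
    rw [MvPolynomial.ringKrullDim_of_isNoetherianRing, ringKrullDim_eq_zero_of_field, hι]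
    norm_cast
    omega
  obtain ⟨p, rfl | rfl⟩ := Nat.even_or_odd' m
  · refine key (Option (Fin 2 × Fin p)) (by simp) (exists_surjective_of_mul_eq F π hπ hF ε ℓ h δ
      hℓ hh hδ hℓ0 y hy (p := p) (q := p + 1) (n := p) (by omega) (by omega) (by omega) (by omega)
      (by omega) (MvPolynomial.X none) (fun e i => MvPolynomial.X (some (e, i)))
      (Or.inr (by omega)) ?_)
    rw [eq_top_iff, ← MvPolynomial.adjoin_range_X]
    refine Algebra.adjoin_mono ?_
    rintro _ ⟨_ | x, rfl⟩
    exacts [Or.inl rfl, Or.inr ⟨x, rfl⟩]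
  · refine key (Fin 2 × Fin (p + 1)) (by simp; ring) (exists_surjective_of_mul_eq F π hπ hF ε ℓ h δ
      hℓ hh hδ hℓ0 y hy (p := p + 1) (q := p + 1) (n := p + 1) (by omega) (by omega) (by omega)
      (by omega) le_rfl 0 (fun e i => MvPolynomial.X (e, i)) (Or.inl rfl) ?_)
    rw [eq_top_iff, ← MvPolynomial.adjoin_range_X]
    exact Algebra.adjoin_mono (Set.subset_insert _ _)

end SingularJets

section TangentCone

lemma IsAlgClosed.exists_algHom_of_ne_top {k C : Type*} [Field k] [IsAlgClosed k] [CommRing C]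
    [Algebra k C] [Algebra.FiniteType k C] {I : Ideal C} (hI : I ≠ ⊤) :
    ∃ χ : C →ₐ[k] k, I ≤ RingHom.ker χ := by
  obtain ⟨P, hP, hIP⟩ := I.exists_le_maximal hI
  let := Ideal.Quotient.field P
  have : Module.Finite k (C ⧸ P) := finite_of_finite_type_of_isJacobsonRing k (C ⧸ P)
  let e : k ≃ₐ[k] C ⧸ P := AlgEquiv.ofBijective (Algebra.ofId k (C ⧸ P))
    IsAlgClosed.algebraMap_bijective_of_isIntegral
  refine ⟨(e.symm : (C ⧸ P) →ₐ[k] k).comp (Ideal.Quotient.mkₐ k P), fun a ha => ?_⟩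
  rw [RingHom.mem_ker, AlgHom.comp_apply, Ideal.Quotient.mkₐ_eq_mk,
    Ideal.Quotient.eq_zero_iff_mem.mpr (hIP ha), map_zero]

/-- A point on the exceptional divisor of the blowup of an ideal. -/
lemma exists_algHom_blowup_chart {k A L : Type*} [Field k] [IsAlgClosed k] [CommRing A]
    [Algebra k A] [Algebra.FiniteType k A] [Field L] [Algebra k L] (j : A →ₐ[k] L)
    (hj : Function.Injective j) {M : Ideal A} (hM : M ≠ ⊤) (hM0 : M ≠ ⊥) :
    ∃ x ∈ M, x ≠ 0 ∧ ∃ (C : Subalgebra k L) (hA : ∀ a, j a ∈ C) (χ : C →ₐ[k] k),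
      (∀ y ∈ M, (j x)⁻¹ * j y ∈ C) ∧ χ ⟨j x, hA x⟩ = 0 := by
  classical
  have hN : IsNoetherianRing A := Algebra.FiniteType.isNoetherianRing k A
  obtain ⟨s, hs⟩ := (isNoetherianRing_iff_ideal_fg A).mp hN M
  obtain ⟨t, ht⟩ := Algebra.FiniteType.out (R := k) (A := A)
  obtain ⟨V, hAV, hMV⟩ := Ideal.image_subset_nonunits_valuationSubring
    (M.map (j : A →+* L).rangeRestrict) (by
      intro h
      have hb : Function.Bijective (j : A →+* L).rangeRestrict :=
        ⟨fun a b hab => hj (congrArg Subtype.val hab), RingHom.rangeRestrict_surjective _⟩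
      refine hM ((Ideal.map_eq_top_iff_of_ker_le _ ?_ (RingHom.isIntegral_of_surjective _ hb.2)).mp h)
      rw [(RingHom.injective_iff_ker_eq_bot _).mp hb.1]
      exact bot_le)
  have hAV' (a : A) : j a ∈ V := hAV ⟨a, rfl⟩
  have hMV' (a : A) (ha : a ∈ M) : V.valuation (j a) < 1 :=
    V.mem_nonunits_iff.mp (hMV ⟨_, Ideal.mem_map_of_mem _ ha, rfl⟩)
  obtain ⟨y, hys, hy0⟩ : ∃ y ∈ s, y ≠ 0 := by
    by_contra! hcon
    exact hM0 (hs ▸ Ideal.span_eq_bot.mpr hcon)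
  obtain ⟨x, hxs, hx⟩ := s.exists_max_image (fun y => V.valuation (j y)) ⟨y, hys⟩
  have hxM : x ∈ M := hs ▸ Ideal.subset_span hxs
  have hx0 : j x ≠ 0 := by
    intro h
    have h1 := hx y hys
    rw [h, map_zero, le_zero_iff, map_eq_zero, map_eq_zero_iff _ hj] at h1
    exact hy0 h1
  let G : Finset L := t.image j ∪ s.image (fun y => (j x)⁻¹ * j y)
  let C : Subalgebra k L := Algebra.adjoin k G
  have hA (a : A) : j a ∈ C := by
    have h1 : (⊤ : Subalgebra k A).map j ≤ C := by
      rw [← ht, AlgHom.map_adjoin]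
      exact Algebra.adjoin_mono (by simp [G])
    exact h1 ⟨a, trivial, rfl⟩
  have hCM (y) (hy : y ∈ M) : (j x)⁻¹ * j y ∈ C := by
    rw [← hs] at hy
    induction hy using Submodule.span_induction with
    | mem y hy =>
      refine Algebra.subset_adjoin ?_
      simp only [G, Finset.coe_union, Finset.coe_image]
      exact Or.inr ⟨y, hy, rfl⟩
    | zero => simp
    | add a b _ _ ha hb => rw [map_add, mul_add]; exact add_mem ha hb
    | smul a b _ hb =>
      rw [smul_eq_mul, map_mul, mul_left_comm]
      exact mul_mem (hA a) hb
  have hCV (c : L) (hc : c ∈ C) : c ∈ V := by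
    induction hc using Algebra.adjoin_induction with
    | mem c hc =>
      simp only [G, Finset.coe_union, Finset.coe_image] at hc
      obtain ⟨a, -, rfl⟩ | ⟨y, hy, rfl⟩ := hc
      · exact hAV' a
      · rw [← V.valuation_le_one_iff, map_mul, map_inv₀]
        exact inv_mul_le_one_of_le₀ (hx y hy) zero_le
    | algebraMap r => rw [← j.commutes]; exact hAV' _
    | add a b _ _ ha hb => exact add_mem ha hb
    | mul a b _ _ ha hb => exact mul_mem ha hb
  have : Algebra.FiniteType k C := (Subalgebra.fg_iff_finiteType C).mp ⟨G, rfl⟩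
  obtain ⟨χ, hχ⟩ := IsAlgClosed.exists_algHom_of_ne_top (k := k)
    (I := Ideal.span {(⟨j x, hA x⟩ : C)}) (by
      rw [Ne, Ideal.span_singleton_eq_top]
      intro hu
      obtain ⟨b, hb⟩ := hu.exists_right_inv
      have h1 : j x * (b : L) = 1 := congrArg Subtype.val hb
      have h2 : V.valuation (b : L) ≤ 1 := (V.valuation_le_one_iff _).mpr (hCV _ b.2)
      have h3 : V.valuation (j x) * V.valuation (b : L) < 1 :=
        mul_lt_one_of_lt_of_le (hMV' x hxM) h2
      rw [← map_mul, h1, map_one] at h3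
      exact lt_irrefl _ h3)
  exact ⟨x, hxM, fun h => hx0 (by rw [h, map_zero]), C, hA, χ, hCM,
    hχ (Ideal.mem_span_singleton_self _)⟩

lemma exists_tangentCone_direction {k A : Type*} [Field k] [IsAlgClosed k] [CommRing A]
    [IsDomain A] [Algebra k A] [Algebra.FiniteType k A] (ε : A →ₐ[k] k)
    (hε : RingHom.ker ε ≠ ⊥) :
    ∃ ℓ h : A →ₗ[k] k, ℓ ≠ 0 ∧ (∀ a b, ℓ (a * b) = ε a * ℓ b + ε b * ℓ a) ∧
      ∀ a b, h (a * b) = ε a * h b + ε b * h a + ℓ a * ℓ b := by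
  let L := FractionRing A
  let j : A →ₐ[k] L := IsScalarTower.toAlgHom k A L
  have hj : Function.Injective j := IsFractionRing.injective A L
  obtain ⟨x, hxM, hx0, C, hA, χ, hC, hχ⟩ :=
    exists_algHom_blowup_chart j hj (RingHom.ker_ne_top ε) hε
  have hjx : j x ≠ 0 := (map_ne_zero_iff _ hj).mpr hx0
  let τ : A →ₗ[k] A := LinearMap.id - (Algebra.linearMap k A).comp ε.toLinearMap
  have hτ (a) : τ a = a - algebraMap k A (ε a) := rfl
  have hτM (a) : τ a ∈ RingHom.ker ε := by
    rw [RingHom.mem_ker, hτ, map_sub, ε.commutes]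
    exact sub_self _
  have hτmul (a b) : τ (a * b) = τ a * τ b + ε a • τ b + ε b • τ a := by
    simp only [hτ, map_mul, Algebra.smul_def]
    ring
  let u : A →ₗ[k] C := LinearMap.codRestrict (Subalgebra.toSubmodule C)
    ((LinearMap.mulLeft k (j x)⁻¹).comp (j.toLinearMap.comp τ)) (fun a => hC _ (hτM a))
  have hu (a) : (u a : L) = (j x)⁻¹ * j (τ a) := rfl
  let Q : Submodule k A := (RingHom.ker ε ^ 2).restrictScalars k
  have hQ (b) (hb : b ∈ Q) : (j x)⁻¹ ^ 2 * j b ∈ C := by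
    replace hb : b ∈ RingHom.ker ε * RingHom.ker ε := by rw [← pow_two]; exact hb
    induction hb using Submodule.mul_induction_on' with
    | mem_mul_mem a ha b hb =>
      have h1 : (j x)⁻¹ ^ 2 * j (a * b) = ((j x)⁻¹ * j a) * ((j x)⁻¹ * j b) := by
        rw [map_mul]; ring
      rw [h1]
      exact mul_mem (hC a ha) (hC b hb)
    | add a ha b hb iha ihb =>
      rw [map_add, mul_add]
      exact add_mem iha ihb
  let w : Q →ₗ[k] C := LinearMap.codRestrict (Subalgebra.toSubmodule C)
    ((LinearMap.mulLeft k ((j x)⁻¹ ^ 2)).comp (j.toLinearMap.comp Q.subtype))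
    (fun b => hQ b.1 b.2)
  have hw (b) : (w b : L) = (j x)⁻¹ ^ 2 * j b := rfl
  obtain ⟨h, hh⟩ := (χ.toLinearMap.comp w).exists_extend
  refine ⟨χ.toLinearMap.comp u, h.comp τ, fun h0 => ?_, fun a b => ?_, fun a b => ?_⟩
  · have h1 : u x = 1 := by
      apply Subtype.ext
      rw [hu, hτ, RingHom.mem_ker.mp hxM, map_zero, sub_zero, inv_mul_cancel₀ hjx]
      rfl
    have h2 := LinearMap.congr_fun h0 x
    simp [h1] at h2
  · have h1 : u (a * b) = ⟨j x, hA x⟩ * (u a * u b) + ε a • u b + ε b • u a := by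
      apply Subtype.ext
      change (u (a * b) : L) = j x * ((u a : L) * (u b : L)) + ε a • (u b : L) + ε b • (u a : L)
      simp only [hu, hτmul, map_add, map_mul, Algebra.smul_def, AlgHom.commutes]
      linear_combination (-(j x)⁻¹ * j (τ a) * j (τ b)) * mul_inv_cancel₀ hjx
    simp [h1, hχ]
  · have hab : τ a * τ b ∈ Q := by
      change _ ∈ RingHom.ker ε ^ 2
      rw [pow_two]
      exact Ideal.mul_mem_mul (hτM a) (hτM b)
    have h1 : h (τ a * τ b) = χ (w ⟨_, hab⟩) := LinearMap.congr_fun hh ⟨_, hab⟩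
    have h2 : w ⟨_, hab⟩ = u a * u b := by
      apply Subtype.ext
      change (w ⟨_, hab⟩ : L) = (u a : L) * (u b : L)
      rw [hw, hu, hu, map_mul]
      ring
    simp only [LinearMap.comp_apply, hτmul, map_add, map_smul, h1, h2, map_mul, smul_eq_mul,
      AlgHom.toLinearMap_apply]
    ring

end TangentCone

section PointDerivations

lemma map_mul_of_map_ker_sq_eq_zero {k A : Type*} [CommRing k] [CommRing A] [Algebra k A]
    (ε : A →ₐ[k] k) (δ : A →ₗ[k] k) (h1 : δ 1 = 0) (h : ∀ b ∈ RingHom.ker ε ^ 2, δ b = 0)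
    (a b : A) : δ (a * b) = ε a * δ b + ε b * δ a := by
  have hM (a) : a - algebraMap k A (ε a) ∈ RingHom.ker ε := by
    rw [RingHom.mem_ker, map_sub, ε.commutes]
    exact sub_self _
  have h2 := h _ (by rw [pow_two]; exact Ideal.mul_mem_mul (hM a) (hM b))
  have h3 : (a - algebraMap k A (ε a)) * (b - algebraMap k A (ε b)) =
      a * b - ε a • b - ε b • a + (ε a * ε b) • 1 := by
    simp only [Algebra.smul_def, map_mul]
    ring
  rw [h3] at h2
  simp only [map_add, map_sub, map_smul, h1, smul_eq_mul] at h2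
  linear_combination h2

lemma exists_two_derivations {k A : Type*} [Field k] [CommRing A] [Algebra k A]
    (ε : A →ₐ[k] k)
    (H : ∀ y : A, ∃ a, ∀ c d : k, a - algebraMap k A c - d • y ∉ RingHom.ker ε ^ 2) :
    ∃ (δ : Fin 2 → A →ₗ[k] k) (y : Fin 2 → A),
      (∀ e a b, δ e (a * b) = ε a * δ e b + ε b * δ e a) ∧
      ∀ e e', δ e (y e') = if e = e' then 1 else 0 := by
  let Q : Submodule k A := (RingHom.ker ε ^ 2).restrictScalars k
  obtain ⟨a, ha⟩ := H 0
  obtain ⟨b, hb⟩ := H a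
  have key (a b : A) (hab : ∀ c d : k, b - algebraMap k A c - d • a ∉ Q) :
      ∃ δ : A →ₗ[k] k, (∀ x y, δ (x * y) = ε x * δ y + ε y * δ x) ∧ δ a = 0 ∧ δ b = 1 := by
    have hb : b ∉ Q ⊔ Submodule.span k {1, a} := by
      intro h
      obtain ⟨q, hq, r, hr, hqr⟩ := Submodule.mem_sup.mp h
      obtain ⟨c, d, rfl⟩ := Submodule.mem_span_pair.mp hr
      refine hab c d ?_
      convert hq using 1
      rw [← hqr, Algebra.algebraMap_eq_smul_one]
      abel
    obtain ⟨δ, hδ, hδb⟩ := LinearMap.exists_extend_of_notMem (0 : _ →ₗ[k] k) hb 1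
    have h0 (x) (hx : x ∈ Q ⊔ Submodule.span k {1, a}) : δ x = 0 :=
      LinearMap.congr_fun hδ ⟨x, hx⟩
    refine ⟨δ, map_mul_of_map_ker_sq_eq_zero ε δ ?_ fun x hx => ?_, ?_, hδb⟩
    · exact h0 _ (Submodule.mem_sup_right (Submodule.subset_span (by simp)))
    · exact h0 _ (Submodule.mem_sup_left hx)
    · exact h0 _ (Submodule.mem_sup_right (Submodule.subset_span (by simp)))
  obtain ⟨δ₁, h₁, h₁a, h₁b⟩ := key a b hb
  obtain ⟨δ₀, h₀, h₀b, h₀a⟩ := key b a (by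
    intro c d hcd
    obtain rfl | hd := eq_or_ne d 0
    · refine ha c 0 ?_
      rw [zero_smul, sub_zero] at hcd ⊢
      exact hcd
    · refine hb (-(d⁻¹ * c)) d⁻¹ ?_
      change _ ∈ Q
      convert Q.smul_mem (-d⁻¹) hcd using 1
      simp only [smul_sub, smul_smul, neg_mul, inv_mul_cancel₀ hd, neg_smul, one_smul,
        Algebra.algebraMap_eq_smul_one]
      abel)
  refine ⟨![δ₀, δ₁], ![a, b], ?_, ?_⟩
  · simp [Fin.forall_fin_two, h₀, h₁]
  · simp [Fin.forall_fin_two, h₀a, h₀b, h₁a, h₁b]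

end PointDerivations

section Curve

lemma eq_zero_of_jetSub_coeff_zero_mem_radical {k σ A : Type*} [CommRing k] [CommRing A]
    [IsReduced A] [Algebra k A] {m : ℕ} (F : Set (MvPolynomial σ k)) (π : MvPolynomial σ k →ₐ[k] A)
    (hF : Ideal.span F ≤ RingHom.ker π) (f : MvPolynomial σ k)
    (hf : (jetSub k σ m f).coeff 0 ∈ (jetIdeal k σ m F).radical) : π f = 0 := by
  obtain ⟨ψ, hψ⟩ := exists_jetHom_eq (m := m) ((IsScalarTower.toAlgHom k A (TruncPoly A m)).comp π)
  have hker : jetIdeal k σ m F ≤ RingHom.ker ψ := by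
    rw [jetIdeal_le_ker_iff, hψ]
    intro g hg
    rw [RingHom.mem_ker, AlgHom.comp_apply, RingHom.mem_ker.mp (hF hg), map_zero]
  have h0 : ψ ((jetSub k σ m f).coeff 0) = π f := by
    have := (jetHom_eq_mk_iff ψ f (Polynomial.C (π f))).mp (by rw [hψ]; rfl) 0 (Nat.zero_le _)
    rwa [Polynomial.coeff_C_zero] at this
  obtain ⟨n, hn⟩ := hf
  exact IsReduced.eq_zero _ ⟨n, by rw [← h0, ← map_pow]; exact hker hn⟩

lemma smooth_of_radical_jetIdeal_isPrime {k σ A : Type*} [Field k] [IsAlgClosed k] [Finite σ]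
    [CommRing A] [IsDomain A] [Algebra k A] (hdim : ringKrullDim A = 1) {m : ℕ} (hm : 1 ≤ m)
    (F : Set (MvPolynomial σ k)) (π : MvPolynomial σ k →ₐ[k] A) (hπ : Function.Surjective π)
    (hF : RingHom.ker π = Ideal.span F) (hJ : (jetIdeal k σ m F).radical.IsPrime) :
    Algebra.Smooth k A := by
  have : Algebra.FiniteType k A := .of_surjective π hπ
  have hA : ¬ IsField A := by
    intro h
    rw [ringKrullDim_eq_zero_of_isField h] at hdim
    exact zero_ne_one hdim
  have hJ0 := eq_zero_of_jetSub_coeff_zero_mem_radical (m := m) F π hF.ge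
  by_contra hsm
  have hex : ∃ M : Ideal A, M.IsMaximal ∧
      ∀ y : A, ∃ a, ∀ c d : k, a - algebraMap k A c - d • y ∉ M ^ 2 := by
    by_contra! hcon
    exact hsm (Algebra.smooth_of_forall_isMaximal_exists_sub_mem_sq hA hcon)
  obtain ⟨M, hM, hMy⟩ := hex
  obtain ⟨ε, hε⟩ := IsAlgClosed.exists_algHom_of_ne_top (k := k) hM.ne_top
  obtain rfl := hM.eq_of_le (RingHom.ker_ne_top ε) hε
  have hε0 : RingHom.ker ε ≠ ⊥ := fun h => hA (Ring.isField_iff_maximal_bot.mpr (h ▸ hM))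
  obtain ⟨a, ha, ha0⟩ := Submodule.exists_mem_ne_zero_of_ne_bot hε0
  obtain ⟨δ, y, hδ, hy⟩ := exists_two_derivations ε hMy
  obtain ⟨ℓ, h, hℓ0, hℓ, hh⟩ := exists_tangentCone_direction ε hε0
  have hlow := le_ringKrullDim_of_mul_eq hm F π hπ hF.ge hJ hJ0 ε ℓ h δ hℓ hh hδ hℓ0 y hy a ha0 ha
  have hup := ringKrullDim_le_of_jetIdeal_le_ker (m := m) (d := 1) F π hπ hF
    (by exact_mod_cast hdim) (Ideal.Quotient.mkₐ k (jetIdeal k σ m F).radical)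
    (Ideal.Quotient.mkₐ_surjective k _)
    (fun g hg => Ideal.Quotient.eq_zero_iff_mem.mpr (Ideal.le_radical hg))
    (fun f hf => hJ0 f (Ideal.Quotient.eq_zero_iff_mem.mp hf))
  have := hlow.trans hup
  norm_cast at this
  omega

end Curve

/- STATEMENT 9: An integral (affine) curve `X = V(F) ⊆ 𝔸^N` over an algebraically closed field
is nonsingular (smooth over `k`) if and only if `X_m` is irreducible for some (equivalently,
every) `m ≥ 1`.  We state the equivalence for each individual `m ≥ 1`, which gives both the
"some" and the "every" versions at once. -/
theorem stmt9 (k : Type*) [Field k] [IsAlgClosed k] (N : ℕ)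
    (F : Set (MvPolynomial (Fin N) k))
    (hdom : IsDomain (MvPolynomial (Fin N) k ⧸ Ideal.span F))
    -- `X` is a curve
    (hdim : ringKrullDim (MvPolynomial (Fin N) k ⧸ Ideal.span F) = 1) :
    ∀ m : ℕ, 1 ≤ m →
      ((jetIdeal k (Fin N) m F).radical.IsPrime ↔
        Algebra.Smooth k (MvPolynomial (Fin N) k ⧸ Ideal.span F)) := by
  intro m hm
  constructor
  · exact smooth_of_radical_jetIdeal_isPrime hdim hm F (Ideal.Quotient.mkₐ k (Ideal.span F))
      (Ideal.Quotient.mkₐ_surjective k _) (Ideal.Quotient.mkₐ_ker k _)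
  · intro hs
    have := jetIdeal_isPrime_of_formallySmooth F (Ideal.Quotient.mkₐ k (Ideal.span F))
      (Ideal.Quotient.mkₐ_surjective k _) (Ideal.Quotient.mkₐ_ker k _) m
    rwa [this.radical]
end
end

section
/- Let k be a field, n ≥ 3, F = X_1^{d_1} + ... + X_n^{d_n} with d_i ≥ 2, such that char k divides at most one of the d_i, and let Z = V(F) ⊂ A^n. Set d = d_1···d_n. If for a_i = d/d_i one counts jets: the locally closed set of homomorphisms φ : k[X]/(F) → k[t]/(t^d) with ord φ(X_i) = a_i has dimension d(n − ∑_i 1/d_i). Consequently, if Z_{d−1} is irreducible then ∑_{i=1}^n 1/d_i > 1. -/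
noncomputable section

/-- If `p(0) ≠ 0`, the exponent `e` is invertible and the coefficients of `p ^ e` up to order `m`
lie in a subring `Ω` closed under roots and exact division, then so do those of `p`. -/
theorem coeff_mem_of_coeff_pow_mem {B : Type*} [CommRing B] [IsDomain B] (Ω : Subring B)
    (hdiv : ∀ u v : B, u ∈ Ω → u ≠ 0 → u * v ∈ Ω → v ∈ Ω)
    (e : ℕ) (hroot : ∀ u : B, u ^ e ∈ Ω → u ∈ Ω) (he : (e : B) ≠ 0)
    (p : Polynomial B) (hp : p.coeff 0 ≠ 0) (m : ℕ) (h : ∀ l ≤ m, (p ^ e).coeff l ∈ Ω) :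
    ∀ l ≤ m, p.coeff l ∈ Ω := by
  intro l
  induction l using Nat.strong_induction_on with
  | _ l ih =>
    intro hl
    rcases Nat.eq_zero_or_pos l with rfl | hl0
    · apply hroot
      simpa [Polynomial.coeff_zero_eq_eval_zero] using h 0 hl
    set q : Polynomial B := ∑ j ∈ Finset.range l, Polynomial.C (p.coeff j) * Polynomial.X ^ j
      with hq
    have hqc : ∀ j, q.coeff j = if j < l then p.coeff j else 0 := by
      intro j
      simp [hq, Polynomial.finsetSum_coeff, Polynomial.coeff_C_mul, Polynomial.coeff_X_pow]
    obtain ⟨r, hr⟩ : Polynomial.X ^ l ∣ p - q := by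
      rw [Polynomial.X_pow_dvd_iff]
      intro j hj
      simp [hqc, hj]
    have hpq : p = q + Polynomial.X ^ l * r := by rw [← hr]; ring
    have hqΩ : q ∈ Polynomial.lifts Ω.subtype := by
      rw [Polynomial.lifts_iff_coeff_lifts]
      intro j
      rw [hqc]
      split_ifs with hj
      · exact ⟨⟨_, ih j hj (by omega)⟩, rfl⟩
      · exact ⟨0, rfl⟩
    obtain ⟨⟨x, hx⟩, hx'⟩ := (Polynomial.lifts_iff_coeff_lifts _).1 (pow_mem hqΩ e) l
    obtain ⟨z, hz⟩ := Polynomial.powAddExpansion q (Polynomial.X ^ l * r) e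
    have hql : (q ^ e).coeff l ∈ Ω := by rw [← hx']; exact hx
    have hq0 : q.coeff 0 = p.coeff 0 := by simp [hqc, hl0]
    have hrl : p.coeff l = r.coeff 0 := by
      have : (Polynomial.X ^ l * r).coeff (0 + l) = r.coeff 0 := Polynomial.coeff_X_pow_mul _ _ _
      rw [← this, ← hr]
      simp [hqc]
    have key : (p ^ e).coeff l = (q ^ e).coeff l + (e * p.coeff 0 ^ (e - 1)) * p.coeff l := by
      have h1 : ((e : Polynomial B) * q ^ (e - 1) * (Polynomial.X ^ l * r)).coeff (0 + l) =
          e * p.coeff 0 ^ (e - 1) * p.coeff l := by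
        rw [show (e : Polynomial B) * q ^ (e - 1) * (Polynomial.X ^ l * r) =
          Polynomial.X ^ l * ((e : Polynomial B) * q ^ (e - 1) * r) by ring,
          Polynomial.coeff_X_pow_mul, hrl, ← hq0]
        simp [Polynomial.coeff_zero_eq_eval_zero]
      have h2 : (z * (Polynomial.X ^ l * r) ^ 2).coeff l = 0 := by
        have hdvd : Polynomial.X ^ (l + 1) ∣ z * (Polynomial.X ^ l * r) ^ 2 :=
          (pow_dvd_pow _ (by omega : l + 1 ≤ l * 2)).trans
            ⟨z * r ^ 2, by rw [mul_pow, ← pow_mul]; ring⟩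
        exact Polynomial.X_pow_dvd_iff.1 hdvd l (by omega)
      rw [zero_add] at h1
      rw [← h1, hpq, hz, Polynomial.coeff_add, Polynomial.coeff_add, h2, add_zero]
    have hc0 : p.coeff 0 ∈ Ω := ih 0 hl0 (by omega)
    refine hdiv (e * p.coeff 0 ^ (e - 1)) _
      (mul_mem (natCast_mem _ _) (pow_mem hc0 _)) (mul_ne_zero he (pow_ne_zero _ hp)) ?_
    have := sub_mem (h l hl) hql
    rwa [key, add_sub_cancel_left] at this

/-- A surjection from a domain that is algebraic over the subalgebra generated by `ι` elements
onto a polynomial ring in at least `#ι` variables is injective. -/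
theorem injective_of_isAlgebraic_adjoin {k B : Type*} [Field k] [CommRing B] [IsDomain B]
    [Algebra k B] {ι T : Type} [Finite ι] [Finite T] (y : ι → B)
    (halg : Algebra.IsAlgebraic (Algebra.adjoin k (Set.range y)) B)
    (hcard : Nat.card ι ≤ Nat.card T) (g : B →ₐ[k] MvPolynomial T k)
    (hg : Function.Surjective g) : Function.Injective g := by
  choose x hx using fun t : T => hg (MvPolynomial.X t)
  have hind : AlgebraicIndependent k (g ∘ x) := by
    have : g ∘ x = MvPolynomial.X := funext hx
    rw [this]
    exact MvPolynomial.algebraicIndependent_X T k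
  have hx' : AlgebraicIndependent k x := hind.of_comp g
  have hbasis : IsTranscendenceBasis k x := by
    apply hx'.isTranscendenceBasis_of_lift_trdeg_le_of_finite
    refine (Cardinal.lift_le.2
      (Algebra.IsAlgebraic.trdeg_le_cardinalMk k (Set.range y))).trans ?_
    refine Cardinal.mk_range_le_lift.trans ?_
    rw [Cardinal.lift_le]
    have := Fintype.ofFinite ι
    have := Fintype.ofFinite T
    simpa using hcard
  have := hbasis.isAlgebraic
  rw [injective_iff_map_eq_zero]
  intro b hb
  by_contra hb0
  refine Ideal.comap_ne_bot_of_algebraic_mem (R := Algebra.adjoin k (Set.range x))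
    (I := RingHom.ker g) hb0 hb (Algebra.IsAlgebraic.isAlgebraic b) ?_
  rw [eq_bot_iff]
  rintro ⟨c, hc⟩ hgc
  have hgc' : g c = 0 := hgc
  rw [Algebra.adjoin_range_eq_range_aeval] at hc
  obtain ⟨P, rfl⟩ := hc
  have hP : MvPolynomial.aeval (g ∘ x) P = 0 := by
    rw [← hgc']
    exact (MvPolynomial.comp_aeval_apply x g P).symm
  have hP0 : P = 0 := (injective_iff_map_eq_zero _).1 hind P hP
  subst hP0
  exact Subtype.ext (map_zero (MvPolynomial.aeval x))

/-- Substituting power series of order at least `a i` into `∑ X_i ^ d_i` gives a power series of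
order at least `N`, provided `N ≤ d_i a_i`. -/
theorem X_pow_dvd_aeval_sum_X_pow {k A ι : Type*} [CommRing k] [CommRing A] [Algebra k A]
    [Fintype ι] {N : ℕ} (d a : ι → ℕ) (h : ∀ i, N ≤ a i * d i) (p : ι → Polynomial A)
    (hp : ∀ i, Polynomial.X ^ a i ∣ p i) :
    Polynomial.X ^ N ∣ MvPolynomial.aeval p (∑ i, MvPolynomial.X i ^ d i : MvPolynomial ι k) := by
  simp only [map_sum, map_pow, MvPolynomial.aeval_X]
  refine Finset.dvd_sum fun i _ => (pow_dvd_pow _ (h i)).trans ?_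
  rw [pow_mul]
  exact pow_dvd_pow_of_dvd (hp i) _

theorem coeff_sum_C_mul_X_pow {A : Type*} [CommRing A] {m : ℕ} (c : Fin (m + 1) → A)
    (j : Fin (m + 1)) :
    (∑ j, Polynomial.C (c j) * Polynomial.X ^ (j : ℕ)).coeff j = c j := by
  simp [Polynomial.finsetSum_coeff, Polynomial.coeff_X_pow, Fin.val_inj]

theorem X_pow_dvd_sum_C_mul_X_pow {A : Type*} [CommRing A] {m : ℕ} (c : Fin (m + 1) → A) (e : ℕ)
    (h : ∀ j : Fin (m + 1), (j : ℕ) < e → c j = 0) :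
    (Polynomial.X : Polynomial A) ^ e ∣ ∑ j, Polynomial.C (c j) * Polynomial.X ^ (j : ℕ) := by
  refine Finset.dvd_sum fun j _ => ?_
  by_cases hj : (j : ℕ) < e
  · simp [h j hj]
  · exact (pow_dvd_pow _ (not_lt.1 hj)).mul_left _

/-- Specializing the universal jet along `φ`. -/
theorem map_jetSub {k σ A : Type*} [CommRing k] [CommRing A] [Algebra k A] (m : ℕ)
    (φ : MvPolynomial (σ × Fin (m + 1)) k →ₐ[k] A) (f : MvPolynomial σ k) :
    (jetSub k σ m f).map (φ : MvPolynomial (σ × Fin (m + 1)) k →+* A) =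
      MvPolynomial.aeval (fun i => ∑ j : Fin (m + 1),
        Polynomial.C (φ (MvPolynomial.X (i, j))) * Polynomial.X ^ (j : ℕ)) f := by
  have : (Polynomial.mapAlgHom φ).comp (jetSub k σ m) =
      MvPolynomial.aeval (fun i => ∑ j : Fin (m + 1),
        Polynomial.C (φ (MvPolynomial.X (i, j))) * Polynomial.X ^ (j : ℕ)) := by
    apply MvPolynomial.algHom_ext
    intro i
    simp [jetSub, Polynomial.map_sum]
  exact DFunLike.congr_fun this f

theorem jetIdeal_singleton_le_ker {k σ A : Type*} [CommRing k] [CommRing A] [Algebra k A] (m : ℕ)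
    (φ : MvPolynomial (σ × Fin (m + 1)) k →ₐ[k] A) (f : MvPolynomial σ k)
    (h : Polynomial.X ^ (m + 1) ∣ MvPolynomial.aeval (fun i => ∑ j : Fin (m + 1),
        Polynomial.C (φ (MvPolynomial.X (i, j))) * Polynomial.X ^ (j : ℕ)) f) :
    jetIdeal k σ m {f} ≤ RingHom.ker φ := by
  rw [jetIdeal, Ideal.span_le]
  rintro _ ⟨_, rfl, l, hl, rfl⟩
  rw [← map_jetSub, Polynomial.X_pow_dvd_iff] at h
  simpa using h l (by omega)

/-- The ideal generated by some of the variables is the kernel of the projection onto the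
polynomial ring in the other variables. -/
theorem span_X_eq_ker_killCompl {k σ : Type*} [CommRing k] (p : σ → Prop) :
    Ideal.span {g : MvPolynomial σ k | ∃ s, ¬ p s ∧ g = MvPolynomial.X s} =
      RingHom.ker (MvPolynomial.killCompl (R := k)
        (Subtype.val_injective : Function.Injective (Subtype.val : {s // p s} → σ))) := by
  apply le_antisymm
  · rw [Ideal.span_le]
    rintro _ ⟨s, hs, rfl⟩
    simp [MvPolynomial.killCompl, hs]
  · set J := Ideal.span {g : MvPolynomial σ k | ∃ s, ¬ p s ∧ g = MvPolynomial.X s}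
    have hinj : Function.Injective (Subtype.val : {s // p s} → σ) := Subtype.val_injective
    have : ((Ideal.Quotient.mkₐ k J).comp (MvPolynomial.rename Subtype.val)).comp
        (MvPolynomial.killCompl (R := k) hinj) = Ideal.Quotient.mkₐ k J := by
      apply MvPolynomial.algHom_ext
      intro s
      by_cases hs : p s
      · have := MvPolynomial.killCompl_rename_app (R := k) hinj (MvPolynomial.X ⟨s, hs⟩)
        rw [MvPolynomial.rename_X] at this
        simp [this]
      · have h0 : MvPolynomial.killCompl (R := k) hinj (MvPolynomial.X s) = 0 := by
          simp [MvPolynomial.killCompl, hs]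
        have h1 : MvPolynomial.X s ∈ J := Ideal.subset_span ⟨s, hs, rfl⟩
        simpa [h0] using (Ideal.Quotient.eq_zero_iff_mem.2 h1).symm
    intro f hf
    rw [RingHom.mem_ker] at hf
    have h := DFunLike.congr_fun this f
    simp only [AlgHom.comp_apply, hf, map_zero] at h
    exact Ideal.Quotient.eq_zero_iff_mem.1 h.symm

theorem natCard_le_snd {n m : ℕ} (a : Fin n → ℕ) (ha : ∀ i, a i ≤ m + 1) :
    Nat.card {s : Fin n × Fin (m + 1) // a s.1 ≤ s.2} = (m + 1) * n - ∑ i, a i := by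
  classical
  rw [Nat.card_eq_fintype_card, Fintype.card_subtype]
  have h1 : (Finset.univ.filter fun s : Fin n × Fin (m + 1) => ¬ a s.1 ≤ s.2).card =
      ∑ i, a i := by
    rw [Finset.card_filter, ← Finset.univ_product_univ, Finset.sum_product]
    refine Finset.sum_congr rfl fun i _ => ?_
    rw [← Finset.card_filter]
    simp [Fin.card_filter_val_lt, ha i]
  have h2 := Finset.card_filter_add_card_filter_not
    (s := (Finset.univ : Finset (Fin n × Fin (m + 1))))
    (fun s => a s.1 ≤ s.2)
  rw [h1, Finset.card_univ, Fintype.card_prod, Fintype.card_fin, Fintype.card_fin] at h2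
  rw [Nat.mul_comm]
  omega

/-- The initial value `X_{i,0}` of the `i`-th coordinate does not vanish identically on the jet
scheme of a Fermat hypersurface. -/
theorem X_zero_notMem_radical_jetIdeal {k ι : Type*} [Field k] [Fintype ι] (m : ℕ) (d : ι → ℕ)
    (hd : ∀ i, d i ≠ 0) {i i' : ι} (hi : i ≠ i') :
    MvPolynomial.X (i, (0 : Fin (m + 1))) ∉
      (jetIdeal k ι m {∑ i, MvPolynomial.X i ^ d i}).radical := by
  classical
  obtain ⟨y, hy⟩ := IsAlgClosed.exists_pow_nat_eq (-1 : AlgebraicClosure k)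
    (Nat.pos_of_ne_zero (hd i'))
  set c : ι → AlgebraicClosure k := fun s => if s = i then 1 else if s = i' then y else 0 with hc
  set φ : MvPolynomial (ι × Fin (m + 1)) k →ₐ[k] AlgebraicClosure k :=
    MvPolynomial.aeval fun s => if s.2 = 0 then c s.1 else 0 with hφ
  have hle : jetIdeal k ι m {∑ i, MvPolynomial.X i ^ d i} ≤ RingHom.ker φ := by
    apply jetIdeal_singleton_le_ker
    have h1 : ∀ s : ι, ∑ j : Fin (m + 1), Polynomial.C (φ (MvPolynomial.X (s, j))) *
        Polynomial.X ^ (j : ℕ) = Polynomial.C (c s) := by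
      intro s
      rw [Finset.sum_eq_single 0] <;> simp +contextual [hφ]
    have h2 : ∑ s, c s ^ d s = 0 := by
      rw [Finset.sum_eq_add (a := i) (b := i') hi] <;> simp +contextual [hc, hi.symm, hy, hd]
    simp only [h1, map_sum, map_pow, MvPolynomial.aeval_X]
    simp only [← map_pow, ← map_sum, h2, map_zero, dvd_zero]
  intro hmem
  have := (Ideal.radical_mono hle) hmem
  rw [(RingHom.ker_isPrime φ).radical, RingHom.mem_ker] at this
  simp [hφ, hc] at this

theorem jetIdeal_le_span_X {k : Type*} [Field k] {n m : ℕ} (d a : Fin n → ℕ)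
    (h : ∀ i, m + 1 ≤ a i * d i) :
    jetIdeal k (Fin n) m {∑ i : Fin n, MvPolynomial.X i ^ d i} ≤
      Ideal.span {g | ∃ s : Fin n × Fin (m + 1), ¬ a s.1 ≤ s.2 ∧ g = MvPolynomial.X s} := by
  rw [span_X_eq_ker_killCompl]
  refine jetIdeal_singleton_le_ker _ _ _ (X_pow_dvd_aeval_sum_X_pow d a h _ fun i =>
    X_pow_dvd_sum_C_mul_X_pow _ _ fun j hj => ?_)
  rw [← RingHom.mem_ker, ← span_X_eq_ker_killCompl]
  exact Ideal.subset_span ⟨(i, j), by simpa using hj, rfl⟩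

/-- The ideal of jets of order at least `a i` in the `i`-th coordinate. -/
theorem jetFiberIdeal_sup_span_eq {k : Type*} [Field k] {n m : ℕ} (d a : Fin n → ℕ)
    (ha : ∀ i, 0 < a i) (h : ∀ i, m + 1 ≤ a i * d i) :
    jetFiberIdeal k (Fin n) m {∑ i : Fin n, MvPolynomial.X i ^ d i} (fun _ => 0) ⊔
        Ideal.span {g | ∃ i : Fin n, ∃ j : Fin (m + 1), (j : ℕ) < a i ∧
          g = MvPolynomial.X (i, j)} =
      Ideal.span {g | ∃ s : Fin n × Fin (m + 1), ¬ a s.1 ≤ s.2 ∧ g = MvPolynomial.X s} := by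
  have hset : {g : MvPolynomial (Fin n × Fin (m + 1)) k | ∃ i : Fin n, ∃ j : Fin (m + 1),
      (j : ℕ) < a i ∧ g = MvPolynomial.X (i, j)} =
      {g | ∃ s : Fin n × Fin (m + 1), ¬ a s.1 ≤ s.2 ∧ g = MvPolynomial.X s} := by
    ext g
    simp [Prod.exists]
  rw [hset, sup_eq_right, jetFiberIdeal, sup_le_iff]
  constructor
  · exact jetIdeal_le_span_X d a h
  · rw [Ideal.span_le]
    rintro _ ⟨i, rfl⟩
    simp only [MvPolynomial.C_0, sub_zero]
    exact Ideal.subset_span ⟨(i, 0), by simpa using (ha i).ne', rfl⟩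

theorem ringKrullDim_quotient_span_X {k σ : Type*} [Field k] [Finite σ] (p : σ → Prop) :
    ringKrullDim (MvPolynomial σ k ⧸
      Ideal.span {g : MvPolynomial σ k | ∃ s, ¬ p s ∧ g = MvPolynomial.X s}) =
      Nat.card {s // p s} := by
  have hinj : Function.Injective (Subtype.val : {s // p s} → σ) := Subtype.val_injective
  have e := Ideal.quotientKerAlgEquivOfSurjective (f := MvPolynomial.killCompl (R := k) hinj)
    fun f => ⟨_, MvPolynomial.killCompl_rename_app hinj f⟩
  rw [span_X_eq_ker_killCompl, ringKrullDim_eq_of_ringEquiv e.toRingEquiv]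
  simp

/-- Away from the vanishing locus of `X_{i,0}`, every coordinate of the universal jet is algebraic
over the coordinates `X_{j,l}` with `j ≠ i`. -/
theorem isAlgebraic_adjoin_quotient {k : Type*} [Field k] {n m : ℕ} (d : Fin n → ℕ) {i : Fin n}
    (hi : (d i : k) ≠ 0) (P : Ideal (MvPolynomial (Fin n × Fin (m + 1)) k)) [P.IsPrime]
    (hP : jetIdeal k (Fin n) m {∑ i : Fin n, MvPolynomial.X i ^ d i} ≤ P)
    (hX : MvPolynomial.X (i, (0 : Fin (m + 1))) ∉ P) :
    Algebra.IsAlgebraic (Algebra.adjoin k (Set.range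
      fun s : {j : Fin n // j ≠ i} × Fin (m + 1) =>
        Ideal.Quotient.mkₐ k P (MvPolynomial.X (s.1.1, s.2))))
      (MvPolynomial (Fin n × Fin (m + 1)) k ⧸ P) := by
  set φ := Ideal.Quotient.mkₐ k P
  set A := Algebra.adjoin k (Set.range
      fun s : {j : Fin n // j ≠ i} × Fin (m + 1) => φ (MvPolynomial.X (s.1.1, s.2)))
  set Ω := Subalgebra.algebraicClosure A (MvPolynomial (Fin n × Fin (m + 1)) k ⧸ P)
  have hother : ∀ j ≠ i, ∀ l, φ (MvPolynomial.X (j, l)) ∈ Ω := fun j hj l =>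
    Ω.algebraMap_mem (⟨_, Algebra.subset_adjoin ⟨(⟨j, hj⟩, l), rfl⟩⟩ : A)
  set p : Fin n → Polynomial (MvPolynomial (Fin n × Fin (m + 1)) k ⧸ P) := fun j =>
    ∑ l : Fin (m + 1), Polynomial.C (φ (MvPolynomial.X (j, l))) * Polynomial.X ^ (l : ℕ) with hp
  have hcoeff : ∀ l ≤ m, (∑ j, p j ^ d j).coeff l = 0 := by
    intro l hl
    have h1 : (jetSub k (Fin n) m (∑ i : Fin n, MvPolynomial.X i ^ d i)).coeff l ∈ P :=
      hP (Ideal.subset_span ⟨_, rfl, l, hl, rfl⟩)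
    have h2 := map_jetSub m φ (∑ i : Fin n, MvPolynomial.X i ^ d i)
    simp only [map_sum (MvPolynomial.aeval _), map_pow (MvPolynomial.aeval _),
      MvPolynomial.aeval_X] at h2
    rw [hp, ← h2, Polynomial.coeff_map]
    exact Ideal.Quotient.eq_zero_iff_mem.2 h1
  have hlift : ∀ j ≠ i, p j ^ d j ∈ Polynomial.lifts Ω.toSubring.subtype := by
    intro j hj
    refine pow_mem (sum_mem fun l _ => mul_mem ?_ ?_) _
    · exact Polynomial.C'_mem_lifts (f := Ω.toSubring.subtype) ⟨⟨_, hother j hj l⟩, rfl⟩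
    · exact Polynomial.X_pow_mem_lifts _ _
  have hpow : ∀ l ≤ m, (p i ^ d i).coeff l ∈ Ω.toSubring := by
    intro l hl
    have h1 : ∑ j ∈ Finset.univ.erase i, p j ^ d j ∈ Polynomial.lifts Ω.toSubring.subtype :=
      sum_mem fun j hj => hlift j (Finset.ne_of_mem_erase hj)
    obtain ⟨x, hx⟩ := (Polynomial.lifts_iff_coeff_lifts _).1 h1 l
    have h2 := hcoeff l hl
    rw [← Finset.add_sum_erase _ _ (Finset.mem_univ i), Polynomial.coeff_add, ← hx] at h2
    rw [eq_neg_of_add_eq_zero_left h2]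
    exact neg_mem x.2
  have hpi : ∀ l : Fin (m + 1), (p i).coeff l = φ (MvPolynomial.X (i, l)) :=
    coeff_sum_C_mul_X_pow _
  have hdi : d i ≠ 0 := fun h => hi (by simp [h])
  have hown : ∀ l ≤ m, (p i).coeff l ∈ Ω.toSubring := by
    refine coeff_mem_of_coeff_pow_mem Ω.toSubring ?_ (d i) ?_ ?_ (p i) ?_ m hpow
    · exact fun u v hu hu0 huv => IsAlgebraic.of_mul (mem_nonZeroDivisors_of_ne_zero hu0) hu huv
    · exact fun u hu => IsAlgebraic.of_pow (Nat.pos_of_ne_zero hdi) hu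
    · rw [← map_natCast (algebraMap k (MvPolynomial (Fin n × Fin (m + 1)) k ⧸ P))]
      exact (map_ne_zero_iff _ (algebraMap k _).injective).2 hi
    · have := hpi 0
      rw [Fin.val_zero] at this
      rw [this]
      exact fun h => hX (Ideal.Quotient.eq_zero_iff_mem.1 h)
  have hall : ∀ s, φ (MvPolynomial.X s) ∈ Ω := by
    rintro ⟨j, l⟩
    by_cases hj : j = i
    · subst hj
      rw [← hpi]
      exact hown l (by omega)
    · exact hother j hj l
  refine ⟨fun b => ?_⟩
  obtain ⟨f, rfl⟩ := Ideal.Quotient.mkₐ_surjective k P b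
  change φ f ∈ Ω
  induction f using MvPolynomial.induction_on with
  | C r => exact (Ω.restrictScalars k).algebraMap_mem r
  | add f g hf hg => rw [map_add]; exact add_mem hf hg
  | mul_X f s hf => rw [map_mul]; exact mul_mem hf (hall s)

theorem lt_sum_of_isPrime_radical_jetIdeal {k : Type*} [Field k] {n m : ℕ} (hn : 3 ≤ n)
    (d a : Fin n → ℕ) (hd : ∀ i, d i ≠ 0)
    (hchar : ∀ i j : Fin n, ((d i : k) = 0) → ((d j : k) = 0) → i = j)
    (ha : ∀ i, 0 < a i) (ha' : ∀ i, a i ≤ m + 1) (h : ∀ i, m + 1 ≤ a i * d i)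
    (hprime : (jetIdeal k (Fin n) m {∑ i : Fin n, MvPolynomial.X i ^ d i}).radical.IsPrime) :
    m + 1 < ∑ i, a i := by
  obtain ⟨i, i', hii', hi⟩ : ∃ i i' : Fin n, i ≠ i' ∧ (d i : k) ≠ 0 := by
    have h01 : (⟨0, by omega⟩ : Fin n) ≠ ⟨1, by omega⟩ := by simp
    by_cases h0 : (d ⟨0, by omega⟩ : k) = 0
    · exact ⟨_, _, h01.symm, fun h1 => h01 (hchar _ _ h0 h1)⟩
    · exact ⟨_, _, h01, h0⟩
  set P := (jetIdeal k (Fin n) m {∑ i : Fin n, MvPolynomial.X i ^ d i}).radical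
  have hX : MvPolynomial.X (i, (0 : Fin (m + 1))) ∉ P :=
    X_zero_notMem_radical_jetIdeal m d hd hii'
  by_contra! hle
  set g := MvPolynomial.killCompl (R := k) (Subtype.val_injective :
    Function.Injective (Subtype.val : {s : Fin n × Fin (m + 1) // a s.1 ≤ s.2} → _))
  have hPg : P ≤ RingHom.ker g := by
    rw [← (RingHom.ker_isPrime g).radical, ← span_X_eq_ker_killCompl]
    exact Ideal.radical_mono (jetIdeal_le_span_X d a h)
  have hinj : Function.Injective (Ideal.Quotient.liftₐ P g hPg) := by
    refine injective_of_isAlgebraic_adjoin _ (isAlgebraic_adjoin_quotient d hi P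
      Ideal.le_radical hX) ?_ _ ?_
    · rw [natCard_le_snd a ha']
      simp only [Nat.card_eq_fintype_card, Fintype.card_prod, Fintype.card_fin, ne_eq,
        Fintype.card_subtype_compl, Fintype.card_unique]
      obtain ⟨n, rfl⟩ : ∃ n', n = n' + 1 := ⟨n - 1, by omega⟩
      have hmul : (m + 1) * (n + 1) = (m + 1) * n + (m + 1) := Nat.mul_succ _ _
      rw [Nat.add_sub_cancel, mul_comm n, hmul]
      generalize (m + 1) * n = N
      omega
    · exact fun f => ⟨Ideal.Quotient.mk P (MvPolynomial.rename Subtype.val f),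
        MvPolynomial.killCompl_rename_app _ f⟩
  refine hX (Ideal.Quotient.eq_zero_iff_mem.1 (hinj ?_))
  rw [map_zero]
  change g (MvPolynomial.X (i, 0)) = 0
  rw [← RingHom.mem_ker, ← span_X_eq_ker_killCompl]
  exact Ideal.subset_span ⟨(i, 0), by simpa using (ha i).ne', rfl⟩

/- STATEMENT 10: Let `F = X_1^{d_1} + … + X_n^{d_n}` (`n ≥ 3`), with `char k` dividing at most
one of the `d_i`, `Z = V(F) ⊂ 𝔸^n`, `D = d_1⋯d_n` and `a_i = D/d_i`.  Then:
(1) every `(D-1)`-jet `φ` centered at `0` with `ord φ(X_i) ≥ a_i` automatically satisfies the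
jet equations of `Z` (the coordinates can be chosen arbitrarily), so that
(2) the locally closed locus of such jets has dimension `∑_i (D − a_i) = D(n − ∑_i 1/d_i)`;
(3) consequently, if `Z_{D-1}` is irreducible then `∑_{i=1}^n 1/d_i > 1`
(equivalently, `D < ∑_i D/d_i`). -/
theorem stmt10 (k : Type*) [Field k] (n : ℕ) (hn : 3 ≤ n)
    (d : Fin n → ℕ) (hd : ∀ i, 2 ≤ d i)
    -- `char k` divides at most one of the `d_i`
    (hchar : ∀ i j : Fin n, ((d i : k) = 0) → ((d j : k) = 0) → i = j)
    (D : ℕ) (hD : D = ∏ i, d i)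
    (a : Fin n → ℕ) (ha : ∀ i, a i = D / d i) :
    -- (1) jets with `ord φ(X_i) ≥ a_i` satisfy the equations of `Z_{D-1}` over `0`:
    (∀ c : Fin n → Fin (D - 1 + 1) → k,
      (∀ i : Fin n, ∀ j : Fin (D - 1 + 1), (j : ℕ) < a i → c i j = 0) →
      MvPolynomial.aeval (R := k)
          (fun i : Fin n => ∑ j : Fin (D - 1 + 1),
            Polynomial.C (c i j) * Polynomial.X ^ (j : ℕ))
          (∑ i : Fin n, MvPolynomial.X i ^ d i) ∈
        Ideal.span {(Polynomial.X : Polynomial k) ^ (D - 1 + 1)}) ∧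
    -- (2) this locus, inside the fiber of `Z_{D-1}` over `0`, has dimension `D·n − ∑_i a_i`:
    (ringKrullDim (MvPolynomial (Fin n × Fin (D - 1 + 1)) k ⧸
        (jetFiberIdeal k (Fin n) (D - 1)
            {∑ i : Fin n, MvPolynomial.X i ^ d i} (fun _ => 0) ⊔
          Ideal.span {g | ∃ i : Fin n, ∃ j : Fin (D - 1 + 1), (j : ℕ) < a i ∧
            g = MvPolynomial.X (i, j)})) = ((D * n - ∑ i, a i : ℕ) : WithBot (WithTop ℕ))) ∧
    -- (3) if `Z_{D-1}` is irreducible then `∑ 1/d_i > 1`: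
    ((jetIdeal k (Fin n) (D - 1) {∑ i : Fin n, MvPolynomial.X i ^ d i}).radical.IsPrime →
      D < ∑ i, a i) := by
  have hd0 : ∀ i, d i ≠ 0 := fun i => by have := hd i; omega
  have hdvd : ∀ i, d i ∣ D := fun i => hD ▸ Finset.dvd_prod_of_mem d (Finset.mem_univ i)
  have hDpos : 0 < D := hD ▸ Finset.prod_pos fun i _ => Nat.pos_of_ne_zero (hd0 i)
  have hmul : ∀ i, a i * d i = D := fun i => by rw [ha, Nat.div_mul_cancel (hdvd i)]
  have hapos : ∀ i, 0 < a i := fun i =>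
    Nat.pos_of_mul_pos_right (hmul i ▸ hDpos)
  have hale : ∀ i, a i ≤ D := fun i => ha i ▸ Nat.div_le_self _ _
  clear hD ha hdvd
  obtain ⟨m, rfl⟩ : ∃ m, D = m + 1 := ⟨D - 1, by omega⟩
  have hge : ∀ i, m + 1 ≤ a i * d i := fun i => (hmul i).ge
  refine ⟨fun c hc => ?_, ?_, lt_sum_of_isPrime_radical_jetIdeal hn d a hd0 hchar hapos hale hge⟩
  · rw [Ideal.mem_span_singleton]
    exact X_pow_dvd_aeval_sum_X_pow d a hge _ fun i => X_pow_dvd_sum_C_mul_X_pow _ _ (hc i)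
  · rw [← natCard_le_snd a hale]
    exact (congrArg (fun I => ringKrullDim (MvPolynomial (Fin n × Fin (m + 1)) k ⧸ I))
      (jetFiberIdeal_sup_span_eq d a hapos hge)).trans
      (ringKrullDim_quotient_span_X fun s : Fin n × Fin (m + 1) => a s.1 ≤ s.2)
end
end
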